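/- arXiv:2209.01617 — 8 statements merged into one kernel-verified Lean document; each statement's English description precedes it below -/
import Mathlib

section
/- If Γ = ⟨X, Δ, Y⟩ is a bipartite graph such that every vertex x ∈ X has valency v(x) > 0, and v(x) ≥ v(y) whenever x ∈ X, y ∈ Y and {x,y} ∈ Δ, then there is a matching from X into Y, i.e., an injective function φ : X → Y with {x, φ(x)} ∈ Δ for all x ∈ X. -/
open Cardinal

/-- A matching of all of `X` into `Y` along the relation `Δ`. -/
def HasMatching {X Y : Type*} (Δ : X → Y → Prop) : Prop :=
  ∃ φ : X → Y, Function.Injective φ ∧ ∀ x, Δ x (φ x)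

theorem HasMatching.mono {X Y : Type*} {Δ Δ' : X → Y → Prop} (h : HasMatching Δ)
    (hle : ∀ x y, Δ x y → Δ' x y) : HasMatching Δ' :=
  let ⟨φ, hφ, h⟩ := h
  ⟨φ, hφ, fun x => hle _ _ (h x)⟩

/-- Matchings of the fibres of `a` can be glued when distinct fibres share no neighbour. -/
theorem hasMatching_of_fibers {X Y ι : Type*} {Δ : X → Y → Prop} (a : X → ι)
    (ha : ∀ x x' y, Δ x y → Δ x' y → a x = a x')
    (H : ∀ i, HasMatching (fun (x : {x // a x = i}) y => Δ x y)) : HasMatching Δ := by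
  choose φ hφ hΔ using H
  refine ⟨fun x => φ (a x) ⟨x, rfl⟩, fun x x' h => ?_, fun x => hΔ (a x) ⟨x, rfl⟩⟩
  have key : ∀ i j (hij : i = j) (u : {x // a x = i}) (v : {x // a x = j}),
      φ i u = φ j v → u.1 = v.1 := by
    rintro i _ rfl u v huv
    exact congrArg Subtype.val (hφ i huv)
  refine key _ _ (ha x x' (φ (a x) ⟨x, rfl⟩) (hΔ (a x) ⟨x, rfl⟩) ?_) _ _ h
  have := hΔ (a x') ⟨x', rfl⟩
  simp only at h
  rwa [← h] at this

/-- Greedy choice: if every neighbourhood is at least as large as `X`, there is a matching. -/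
theorem hasMatching_of_mk_le {X Y : Type u} {Δ : X → Y → Prop}
    (h : ∀ x, #X ≤ #{y | Δ x y}) : HasMatching Δ := by
  classical
  obtain ⟨r, wo, hr⟩ := Cardinal.exists_ord_eq X
  have hlt : ∀ x, #{x' | r x' x} < #X := fun x => by
    have := Cardinal.card_typein_lt x hr
    rwa [Ordinal.card_typein] at this
  have step : ∀ x (f : ∀ x', r x' x → Y), ∃ y, Δ x y ∧ ∀ x' (hx : r x' x), f x' hx ≠ y := by
    intro x f
    by_contra hcon
    push Not at hcon
    have hsub : {y | Δ x y} ⊆ Set.range (fun z : {x' | r x' x} => f z.1 z.2) := by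
      intro y hy
      obtain ⟨x', hx, e⟩ := hcon y hy
      exact ⟨⟨x', hx⟩, e⟩
    exact absurd ((h x).trans ((mk_le_mk_of_subset hsub).trans mk_range_le)) (hlt x).not_ge
  let F := wo.wf.fix (C := fun _ => Y) fun x f => (step x f).choose
  have hF : ∀ x, F x = (step x fun x' _ => F x').choose := fun x => wo.wf.fix_eq _ x
  have hF' : ∀ x, Δ x (F x) ∧ ∀ x', r x' x → F x' ≠ F x := fun x => by
    have := (step x fun x' _ => F x').choose_spec
    rwa [← hF] at this
  refine ⟨F, fun x x' e => ?_, fun x => (hF' x).1⟩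
  rcases trichotomous_of r x x' with h' | h' | h'
  · exact absurd e ((hF' x').2 _ h')
  · exact h'
  · exact absurd e.symm ((hF' x).2 _ h')

/-- The points reachable from a set of size at most `θ` along a relation with out-degrees at most
`θ` form a set of size at most `θ`. -/
theorem mk_reachable_le {Z : Type u} (r : Z → Z → Prop) (A : Set Z) {θ : Cardinal.{u}}
    (hθ : ℵ₀ ≤ θ) (hA : #A ≤ θ) (hr : ∀ z, #{z' | r z z'} ≤ θ) :
    #{z | ∃ a ∈ A, Relation.ReflTransGen r a z} ≤ θ := by
  let L : ℕ → Set Z := fun n => Nat.rec (motive := fun _ => Set Z) A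
    (fun _ B => ⋃ z : B, {z' | r z z'}) n
  have hL : ∀ n, #↥(L n) ≤ θ := by
    intro n
    induction n with
    | zero => exact hA
    | succ n ih =>
      refine (mk_iUnion_le _).trans ?_
      exact (mul_le_mul' ih (ciSup_le' fun z => hr _)).trans (mul_eq_self hθ).le
  have hsub : {z | ∃ a ∈ A, Relation.ReflTransGen r a z} ⊆ ⋃ n : ULift.{u} ℕ, L n.down := by
    rintro z ⟨a, ha, haz⟩
    induction haz with
    | refl => exact Set.mem_iUnion.2 ⟨⟨0⟩, ha⟩
    | tail _ hbc ih =>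
      obtain ⟨⟨n⟩, hn⟩ := Set.mem_iUnion.1 ih
      exact Set.mem_iUnion.2 ⟨⟨n + 1⟩, Set.mem_iUnion.2 ⟨⟨_, hn⟩, hbc⟩⟩
  refine (mk_le_mk_of_subset hsub).trans ((mk_iUnion_le _).trans ?_)
  refine (mul_le_mul' (b := θ) ?_ (ciSup_le' fun n => hL _)).trans (mul_eq_self hθ).le
  simpa using hθ

/-- Composing relations with at most `θ` successors gives at most `θ` successors. -/
theorem mk_comp_le {X Y Z : Type u} {r : X → Y → Prop} {s : Y → Z → Prop} {θ : Cardinal.{u}}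
    (hθ : ℵ₀ ≤ θ) (x : X) (hx : #{y | r x y} ≤ θ) (hy : ∀ y, r x y → #{z | s y z} ≤ θ) :
    #{z | ∃ y, r x y ∧ s y z} ≤ θ := by
  have : {z | ∃ y, r x y ∧ s y z} = ⋃ y : {y | r x y}, {z | s y z} := by
    ext z; simp
  rw [this]
  exact (mk_iUnion_le _).trans
    ((mul_le_mul' hx (ciSup_le' fun y => hy _ y.2)).trans (mul_eq_self hθ).le)

/-- If vertices of `X` sharing a neighbour have the same cost `c`, and each `x` shares a neighbour
with at most `c x` vertices, then it suffices to match the sets of constant cost `κ` and size at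
most `κ`. -/
theorem hasMatching_of_components {X Y : Type u} {Δ : X → Y → Prop} (c : X → Cardinal.{u})
    (hc : ∀ x, ℵ₀ ≤ c x)
    (hshare : ∀ x x' y, Δ x y → Δ x' y → c x = c x')
    (hdeg : ∀ x, #{x' | ∃ y, Δ x y ∧ Δ x' y} ≤ c x)
    (H : ∀ (S : Set X) (κ : Cardinal.{u}), (∀ x ∈ S, c x = κ) → ℵ₀ ≤ κ → #S ≤ κ →
      HasMatching (fun (x : S) y => Δ x y)) : HasMatching Δ := by
  let r : X → X → Prop := fun x x' => ∃ y, Δ x y ∧ Δ x' y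
  have rsymm : ∀ x x', r x x' → r x' x := fun x x' ⟨y, h1, h2⟩ => ⟨y, h2, h1⟩
  let cl : X → Set X := fun x => {z | Relation.ReflTransGen r x z}
  have hcl : ∀ x, ∀ z ∈ cl x, c z = c x := by
    intro x z hz
    induction hz with
    | refl => rfl
    | tail _ hbc ih =>
      obtain ⟨y, h1, h2⟩ := hbc
      rw [← ih, hshare _ _ y h1 h2]
  have hsymm : ∀ x z, z ∈ cl x → x ∈ cl z := fun x z h =>
    have : Std.Symm r := ⟨rsymm⟩
    Relation.ReflTransGen.stdSymm.symm _ _ h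
  have heq : ∀ x z, z ∈ cl x → cl z = cl x := fun x z h => by
    ext u
    exact ⟨fun hu => Relation.ReflTransGen.trans h hu,
      fun hu => Relation.ReflTransGen.trans (hsymm _ _ h) hu⟩
  refine hasMatching_of_fibers cl (fun x x' y h1 h2 => ?_) fun i => ?_
  · exact (heq _ _ (Relation.ReflTransGen.single ⟨y, h1, h2⟩)).symm
  · rcases isEmpty_or_nonempty {x // cl x = i} with hE | ⟨⟨x, rfl⟩⟩
    · exact ⟨fun x => (hE.false x).elim, fun x => (hE.false x).elim, fun x => (hE.false x).elim⟩
    have hmem : ∀ z, cl z = cl x → z ∈ cl x := fun z hz => hz ▸ Relation.ReflTransGen.refl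
    refine H {z | cl z = cl x} (c x) (fun z hz => hcl _ _ (hmem z hz)) (hc x) ?_
    let r' : X → X → Prop := fun u v => c u = c x ∧ r u v
    have hr' : ∀ u, #{v | r' u v} ≤ c x := by
      intro u
      by_cases hu : c u = c x
      · rw [← hu]
        exact (mk_le_mk_of_subset fun v hv => hv.2).trans (hdeg u)
      · have : {v | r' u v} = ∅ := by
          ext v; simp [r', hu]
        simp [this]
    refine (mk_le_mk_of_subset ?_).trans
      (mk_reachable_le r' {x} (hc x) (by simpa using one_le_aleph0.trans (hc x)) hr')
    intro z hz
    refine ⟨x, rfl, ?_⟩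
    have hz := hmem z hz
    induction hz with
    | refl => exact Relation.ReflTransGen.refl
    | tail hab hbc ih => exact ih (heq _ _ hab) |>.tail ⟨hcl _ _ hab, hbc⟩

/-- Hall's condition when each degree `D y` is at most the degree of every neighbour `x` of `y`. -/
theorem card_le_card_biUnion_of_degree_le {F Y : Type*} [DecidableEq Y] (t : F → Finset Y)
    (D : Y → ℕ) (h0 : ∀ x, (t x).Nonempty) (hD : ∀ x, ∀ y ∈ t x, D y ≤ (t x).card)
    (hdeg : ∀ (A : Finset F) (y : Y), (A.filter fun x => y ∈ t x).card ≤ D y) (A : Finset F) :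
    A.card ≤ (A.biUnion t).card := by
  have h1 : ∀ x, (1 : ℚ) ≤ ∑ y ∈ t x, (D y : ℚ)⁻¹ := by
    intro x
    have hpos : (0 : ℚ) < (t x).card := by exact_mod_cast (h0 x).card_pos
    calc (1 : ℚ) = ∑ y ∈ t x, ((t x).card : ℚ)⁻¹ := by
          rw [Finset.sum_const, nsmul_eq_mul, mul_inv_cancel₀ hpos.ne']
      _ ≤ _ := by
          refine Finset.sum_le_sum fun y hy => ?_
          have hy1 := hdeg {x} y
          have hDpos : 0 < D y := by
            rw [Finset.filter_singleton, if_pos hy] at hy1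
            exact hy1
          exact inv_anti₀ (by exact_mod_cast hDpos) (by exact_mod_cast hD x y hy)
  have h2 : (A.card : ℚ) ≤ (A.biUnion t).card := by
    calc (A.card : ℚ) = ∑ x ∈ A, (1 : ℚ) := by simp
      _ ≤ ∑ x ∈ A, ∑ y ∈ t x, (D y : ℚ)⁻¹ := Finset.sum_le_sum fun x _ => h1 x
      _ = ∑ y ∈ A.biUnion t, ∑ x ∈ A.filter (fun x => y ∈ t x), (D y : ℚ)⁻¹ := by
          refine Finset.sum_comm' fun x y => ?_
          simp only [Finset.mem_filter, Finset.mem_biUnion]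
          exact ⟨fun h => ⟨h, x, h⟩, fun h => h.1⟩
      _ ≤ ∑ y ∈ A.biUnion t, (1 : ℚ) := by
          refine Finset.sum_le_sum fun y _ => ?_
          rw [Finset.sum_const, nsmul_eq_mul]
          exact mul_inv_le_one_of_le₀ (by exact_mod_cast hdeg A y) (by positivity)
      _ = _ := by simp
  exact_mod_cast h2

/-- If Hall's condition holds after the removal of a finite set `R`, it still holds after the
removal of one more vertex, suitably chosen in an infinite set `N` whose elements have spare
degree. -/
theorem exists_insert_hall {F Y : Type*} [DecidableEq Y] (t : F → Finset Y)
    (D : Y → ℕ) (hD : ∀ x, ∀ y ∈ t x, D y ≤ (t x).card) (N : Set Y) (hN : N.Infinite)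
    (hdeg : ∀ (A : Finset F) (y : Y), (A.filter fun x => y ∈ t x).card ≤ D y)
    (hdegN : ∀ (A : Finset F), ∀ y ∈ N, (A.filter fun x => y ∈ t x).card + 1 ≤ D y)
    (R : Finset Y) (hR : ∀ A : Finset F, A.card ≤ (A.biUnion t \ R).card) :
    ∃ y ∈ N, y ∉ R ∧ ∀ A : Finset F, A.card ≤ (A.biUnion t \ insert y R).card := by
  classical
  by_contra! hcon
  have hunion : ∀ A B : Finset F, (A.biUnion t \ R).card ≤ A.card →
      (B.biUnion t \ R).card ≤ B.card → ((A ∪ B).biUnion t \ R).card ≤ (A ∪ B).card := by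
    intro A B hA hB
    have e1 := Finset.card_union_add_card_inter (A.biUnion t \ R) (B.biUnion t \ R)
    have e2 := Finset.card_union_add_card_inter A B
    have e3 := hR (A ∩ B)
    have e4 : ((A ∩ B).biUnion t \ R).card ≤ ((A.biUnion t \ R) ∩ (B.biUnion t \ R)).card := by
      refine Finset.card_le_card fun y hy => ?_
      simp only [Finset.mem_sdiff, Finset.mem_biUnion, Finset.mem_inter] at hy ⊢
      obtain ⟨⟨x, ⟨hA, hB⟩, hx⟩, hyR⟩ := hy
      exact ⟨⟨⟨x, hA, hx⟩, hyR⟩, ⟨x, hB, hx⟩, hyR⟩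
    have e5 : (A ∪ B).biUnion t \ R = (A.biUnion t \ R) ∪ (B.biUnion t \ R) := by
      rw [Finset.union_biUnion, Finset.union_sdiff_distrib]
    rw [e5]
    lia
  have htight : ∀ y ∈ N, y ∉ R → ∃ A : Finset F, (A.biUnion t \ R).card ≤ A.card ∧
      y ∈ A.biUnion t := by
    intro y hy hyR
    obtain ⟨A, hA⟩ := hcon y hy hyR
    rw [Finset.sdiff_insert] at hA
    have h1 := hR A
    have hmem : y ∈ A.biUnion t \ R := by
      by_contra hn
      rw [Finset.erase_eq_of_notMem hn] at hA
      lia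
    rw [Finset.card_erase_of_mem hmem] at hA
    exact ⟨A, by lia, (Finset.mem_sdiff.1 hmem).1⟩
  have hcover : ∀ Q : Finset Y, (∀ y ∈ Q, y ∈ N ∧ y ∉ R) → ∃ A : Finset F,
      (A.biUnion t \ R).card ≤ A.card ∧ Q ⊆ A.biUnion t := by
    intro Q
    induction Q using Finset.induction_on with
    | empty => exact fun _ => ⟨∅, by simp, by simp⟩
    | insert y Q _ ih =>
      intro hQ
      obtain ⟨A, hA, hQA⟩ := ih fun z hz => hQ z (Finset.mem_insert_of_mem hz)
      obtain ⟨B, hB, hyB⟩ := htight y (hQ y (Finset.mem_insert_self _ _)).1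
        (hQ y (Finset.mem_insert_self _ _)).2
      refine ⟨A ∪ B, hunion A B hA hB, Finset.insert_subset ?_ ?_⟩
      · rw [Finset.union_biUnion]
        exact Finset.mem_union_right _ hyB
      · rw [Finset.union_biUnion]
        exact hQA.trans Finset.subset_union_left
  obtain ⟨Q, hQN, hQcard⟩ := (hN.sdiff R.finite_toSet).exists_subset_card_eq (∑ y ∈ R, D y + 1)
  have hQ : ∀ y ∈ Q, y ∈ N ∧ y ∉ R := fun y hy => by simpa using hQN hy
  obtain ⟨A, hA, hQA⟩ := hcover Q hQ
  obtain ⟨f, hf, hft⟩ := (Finset.all_card_le_biUnion_card_iff_exists_injective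
    (fun x => t x \ R)).1 fun B => (hR B).trans_eq (by congr 1; ext y; simp; tauto)
  have himg : A.image f = A.biUnion t \ R := by
    refine Finset.eq_of_subset_of_card_le (fun y hy => ?_) ?_
    · obtain ⟨x, hx, rfl⟩ := Finset.mem_image.1 hy
      have := Finset.mem_sdiff.1 (hft x)
      exact Finset.mem_sdiff.2 ⟨Finset.mem_biUnion.2 ⟨x, hx, this.1⟩, this.2⟩
    · rwa [Finset.card_image_of_injective _ hf]
  have c1 : ∑ x ∈ A, (t x).card = ∑ y ∈ A.biUnion t, (A.filter fun x => y ∈ t x).card := by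
    simp only [Finset.card_eq_sum_ones]
    refine Finset.sum_comm' fun x y => ?_
    simp only [Finset.mem_filter, Finset.mem_biUnion]
    exact ⟨fun h => ⟨h, x, h⟩, fun h => h.1⟩
  have c2 : ∑ y ∈ A.biUnion t, (A.filter fun x => y ∈ t x).card + Q.card
      ≤ ∑ y ∈ A.biUnion t, D y := by
    rw [← Finset.sum_sdiff hQA, ← Finset.sum_sdiff hQA (f := D), add_assoc,
      Finset.card_eq_sum_ones Q, ← Finset.sum_add_distrib]
    exact add_le_add (Finset.sum_le_sum fun y _ => hdeg A y)
      (Finset.sum_le_sum fun y hy => hdegN A y (hQ y hy).1)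
  have c3 : ∑ y ∈ A.biUnion t, D y ≤ ∑ y ∈ A.biUnion t \ R, D y + ∑ y ∈ R, D y := by
    have : A.biUnion t ⊆ (A.biUnion t \ R) ∪ R := by simp
    exact (Finset.sum_le_sum_of_subset this).trans (Finset.sum_union_inter (f := D) ▸ by simp)
  have c4 : ∑ y ∈ A.biUnion t \ R, D y ≤ ∑ x ∈ A, (t x).card := by
    rw [← himg, Finset.sum_image fun x _ x' _ e => hf e]
    exact Finset.sum_le_sum fun x _ => hD x _ (Finset.mem_sdiff.1 (hft x)).1
  lia

/-- The countable case with finite degrees on the `Y` side. -/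
theorem hasMatching_of_countable {X Y : Type*} [Countable X] {Δ : X → Y → Prop}
    (hY : ∀ y, {x | Δ x y}.Finite) (h0 : ∀ x, ∃ y, Δ x y)
    (h1 : ∀ x y, {y | Δ x y}.Finite → Δ x y → {x' | Δ x' y}.ncard ≤ {y' | Δ x y'}.ncard) :
    HasMatching Δ := by
  classical
  let F := {x // {y | Δ x y}.Finite}
  let S := {x // ¬ {y | Δ x y}.Finite}
  let t : F → Finset Y := fun x => x.2.toFinset
  let D : Y → ℕ := fun y => {x | Δ x y}.ncard
  have ht : ∀ x y, y ∈ t x ↔ Δ x.1 y := fun x y => by simp [t]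
  have hD : ∀ x, ∀ y ∈ t x, D y ≤ (t x).card := fun x y hy => by
    rw [← Set.ncard_eq_toFinset_card _ x.2]
    exact h1 x y x.2 ((ht _ _).1 hy)
  have hcard : ∀ (A : Finset F) y, (A.filter fun x => y ∈ t x).card =
      (((A.filter fun x => y ∈ t x).map (Function.Embedding.subtype _) : Finset X) :
        Set X).ncard := fun A y => by rw [Set.ncard_coe_finset, Finset.card_map]
  have hsub : ∀ (A : Finset F) y, (((A.filter fun x => y ∈ t x).map
      (Function.Embedding.subtype _) : Finset X) : Set X) ⊆ {x | Δ x y} := by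
    intro A y x hx
    simp only [Finset.coe_map, Set.mem_image, Finset.mem_coe, Finset.mem_filter] at hx
    obtain ⟨u, ⟨_, hu⟩, rfl⟩ := hx
    exact (ht _ _).1 hu
  have hdeg : ∀ (A : Finset F) (y : Y), (A.filter fun x => y ∈ t x).card ≤ D y := fun A y => by
    rw [hcard]
    exact Set.ncard_le_ncard (hsub A y) (hY y)
  have hdegS : ∀ (s : S) (A : Finset F), ∀ y ∈ {y | Δ s.1 y},
      (A.filter fun x => y ∈ t x).card + 1 ≤ D y := fun s A y hy => by
    rw [hcard, Nat.add_one_le_iff]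
    refine Set.ncard_lt_ncard ⟨hsub A y, fun hle => ?_⟩ (hY y)
    have := hle (show s.1 ∈ {x | Δ x y} from hy)
    simp only [Finset.coe_map, Set.mem_image] at this
    obtain ⟨u, _, hu⟩ := this
    exact s.2 (hu ▸ u.2)
  have hall : ∀ A : Finset F, A.card ≤ (A.biUnion t \ ∅).card := fun A => by
    rw [Finset.sdiff_empty]
    exact card_le_card_biUnion_of_degree_le t D
      (fun x => (h0 x).imp fun y hy => (ht x y).2 hy) hD hdeg A
  let Good := {R : Finset Y // ∀ A : Finset F, A.card ≤ (A.biUnion t \ R).card}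
  have step : ∀ (R : Good) (s : S), ∃ y, Δ s.1 y ∧ y ∉ R.1 ∧
      ∀ A : Finset F, A.card ≤ (A.biUnion t \ insert y R.1).card := fun R s =>
    exists_insert_hall t D hD _ s.2 hdeg (hdegS s) R.1 R.2
  have key : ∃ (T : Set Y) (ψ : S → Y), Function.Injective ψ ∧ (∀ s, Δ s.1 (ψ s) ∧ ψ s ∈ T) ∧
      ∀ B : Finset Y, ∃ R : Good, ∀ y ∈ B, y ∈ T → y ∈ R.1 := by
    rcases isEmpty_or_nonempty S with hS | hS
    · exact ⟨∅, fun s => (hS.false s).elim, fun s => (hS.false s).elim,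
        fun s => (hS.false s).elim, fun B => ⟨⟨∅, hall⟩, fun y _ hy => hy.elim⟩⟩
    obtain ⟨e, he⟩ := exists_surjective_nat S
    choose nxt hnxt using step
    let R : ℕ → Good := fun n => Nat.rec (motive := fun _ => Good) ⟨∅, hall⟩
      (fun n R => ⟨insert (nxt R (e n)) R.1, (hnxt R (e n)).2.2⟩) n
    have hRs : ∀ n, (R (n + 1)).1 = insert (nxt (R n) (e n)) (R n).1 := fun n => rfl
    have hmono : Monotone fun n => (R n).1 := monotone_nat_of_le_succ fun n => by
      simp only [hRs]
      exact Finset.subset_insert _ _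
    have hlt : ∀ m n, m < n → nxt (R m) (e m) ≠ nxt (R n) (e n) := fun m n hmn heq => by
      have h1 : nxt (R m) (e m) ∈ (R (m + 1)).1 := by
        rw [hRs]
        exact Finset.mem_insert_self _ _
      exact (hnxt (R n) (e n)).2.1 (heq ▸ hmono (Nat.succ_le_of_lt hmn) h1)
    have hinj : Function.Injective fun n => nxt (R n) (e n) := fun m n h => by
      by_contra hne
      rcases lt_or_gt_of_ne hne with h' | h'
      · exact hlt _ _ h' h
      · exact hlt _ _ h' h.symm
    refine ⟨{y | ∃ n, y ∈ (R n).1}, fun s => nxt (R (Function.surjInv he s))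
      (e (Function.surjInv he s)), hinj.comp (Function.injective_surjInv he), fun s => ⟨?_, ?_⟩,
      fun B => ?_⟩
    · have := (hnxt (R (Function.surjInv he s)) (e (Function.surjInv he s))).1
      rwa [show (e (Function.surjInv he s)).1 = s.1 by rw [Function.surjInv_eq he s]] at this
    · refine ⟨Function.surjInv he s + 1, ?_⟩
      rw [hRs]
      exact Finset.mem_insert_self _ _
    · suffices ∃ n, ∀ y ∈ B, y ∈ {y | ∃ n, y ∈ (R n).1} → y ∈ (R n).1 from
        this.imp' R fun n h => h
      induction B using Finset.induction_on with
      | empty => exact ⟨0, by simp⟩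
      | insert b B _ ih =>
        obtain ⟨n, hn⟩ := ih
        by_cases hb : ∃ m, b ∈ (R m).1
        · obtain ⟨m, hm⟩ := hb
          refine ⟨max m n, fun y hy hyT => ?_⟩
          rcases Finset.mem_insert.1 hy with rfl | hy
          · exact hmono (le_max_left m n) hm
          · exact hmono (le_max_right m n) (hn y hy hyT)
        · refine ⟨n, fun y hy hyT => ?_⟩
          rcases Finset.mem_insert.1 hy with rfl | hy
          · exact (hb hyT).elim
          · exact hn y hy hyT
  obtain ⟨T, ψ, hψ, hψΔ, hT⟩ := key
  obtain ⟨f, hf, hft⟩ := (Finset.all_card_le_biUnion_card_iff_exists_injective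
    (fun x => (t x).filter (· ∉ T))).1 fun A => by
      obtain ⟨R, hR⟩ := hT (A.biUnion t)
      refine (R.2 A).trans (Finset.card_le_card fun y hy => ?_)
      obtain ⟨hy1, hy2⟩ := Finset.mem_sdiff.1 hy
      obtain ⟨x, hx, hxy⟩ := Finset.mem_biUnion.1 hy1
      exact Finset.mem_biUnion.2 ⟨x, hx, Finset.mem_filter.2 ⟨hxy, fun h => hy2 (hR y hy1 h)⟩⟩
  have hfT : ∀ x, Δ x.1 (f x) ∧ f x ∉ T := fun x =>
    ⟨(ht _ _).1 (Finset.mem_filter.1 (hft x)).1, (Finset.mem_filter.1 (hft x)).2⟩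
  refine ⟨fun x => if h : {y | Δ x y}.Finite then f ⟨x, h⟩ else ψ ⟨x, h⟩, fun x x' h => ?_,
    fun x => ?_⟩
  · by_cases hx : {y | Δ x y}.Finite <;> by_cases hx' : {y | Δ x' y}.Finite <;>
      simp only [hx, hx', dif_pos, dif_neg, not_false_eq_true] at h
    · exact congrArg Subtype.val (hf h)
    · exact absurd (h ▸ (hψΔ ⟨x', hx'⟩).2) (hfT ⟨x, hx⟩).2
    · exact absurd (h ▸ (hψΔ ⟨x, hx⟩).2) (hfT ⟨x', hx'⟩).2
    · exact congrArg Subtype.val (hψ h)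
  · by_cases hx : {y | Δ x y}.Finite
    · simp only [hx, dif_pos]
      exact (hfT ⟨x, hx⟩).1
    · simp only [hx, dif_neg, not_false_eq_true]
      exact (hψΔ ⟨x, hx⟩).1

/-- The case of finite degrees on the `Y` side. -/
theorem hasMatching_of_finite {X Y : Type u} {Δ : X → Y → Prop}
    (hY : ∀ y, {x | Δ x y}.Finite) (h0 : ∀ x, ∃ y, Δ x y)
    (h1 : ∀ x y, {y | Δ x y}.Finite → Δ x y → {x' | Δ x' y}.ncard ≤ {y' | Δ x y'}.ncard) :
    HasMatching Δ := by
  have hsel : ∀ x, ∃ B ⊆ {y | Δ x y}, B.Countable ∧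
      ({y | Δ x y}.Finite → B = {y | Δ x y}) ∧ (B.Finite → {y | Δ x y}.Finite) := by
    intro x
    by_cases hx : {y | Δ x y}.Finite
    · exact ⟨_, subset_rfl, hx.countable, fun _ => rfl, fun h => h⟩
    · refine ⟨Set.range fun n => (Set.Infinite.natEmbedding _ hx n).1, ?_, Set.countable_range _,
        fun h => (hx h).elim, fun h => (Set.infinite_range_of_injective ?_ h).elim⟩
      · rintro _ ⟨n, rfl⟩
        exact (Set.Infinite.natEmbedding _ hx n).2
      · exact Subtype.val_injective.comp (Set.Infinite.natEmbedding _ hx).injective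
  choose B hB hBc hBeq hBfin using hsel
  have hBY : ∀ y, {x | y ∈ B x} ⊆ {x | Δ x y} := fun y x hx => hB x hx
  refine HasMatching.mono (Δ := fun x y => y ∈ B x) ?_ fun x y h => hB x h
  refine hasMatching_of_components (fun _ => ℵ₀) (fun _ => le_rfl) (fun _ _ _ _ _ => rfl)
    (fun x => ?_) fun S κ hκ hκ' hS => ?_
  · refine mk_comp_le (r := fun x y => y ∈ B x) (s := fun y x => y ∈ B x) le_rfl x ?_ fun y _ => ?_
    · exact le_aleph0_iff_set_countable.2 (hBc x)
    · exact le_aleph0_iff_set_countable.2 ((hY y).subset (hBY y)).countable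
  rcases isEmpty_or_nonempty S with hE | ⟨⟨x0, hx0⟩⟩
  · exact ⟨fun x => (hE.false x).elim, fun x => (hE.false x).elim, fun x => (hE.false x).elim⟩
  have : Countable S := by
    rw [← hκ x0 hx0] at hS
    exact mk_le_aleph0_iff.1 hS
  have hsub : ∀ y, Subtype.val '' {x : S | y ∈ B x} ⊆ {x | Δ x y} := by
    rintro y _ ⟨x, hx, rfl⟩
    exact hB _ hx
  refine hasMatching_of_countable (fun y => ?_) (fun x => ?_) fun x y hfin hxy => ?_
  · exact Set.Finite.of_finite_image ((hY y).subset (hsub y)) Subtype.val_injective.injOn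
  · by_cases hx : {y | Δ x y}.Finite
    · obtain ⟨y, hy⟩ := h0 x
      exact ⟨y, (hBeq x hx).symm ▸ hy⟩
    · by_contra hcon
      refine hx (hBfin x ?_)
      rw [Set.eq_empty_iff_forall_notMem.2 fun y hy => hcon ⟨y, hy⟩]
      exact Set.finite_empty
  · have hfin' := hBfin x hfin
    have e : {y | y ∈ B x} = {y | Δ x y} := hBeq x hfin'
    rw [e]
    refine le_trans ?_ (h1 x y hfin' (hB x hxy))
    rw [← Set.ncard_image_of_injective _ Subtype.val_injective]
    exact Set.ncard_le_ncard (hsub y) (hY y)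

/-- A set of infinite size contained in a union of two sets is no larger than one of them, if it is
larger than the other. -/
theorem mk_le_of_subset_union {Y : Type u} {A B C : Set Y} (hA : ℵ₀ ≤ #A) (h : A ⊆ B ∪ C)
    (hB : #B < #A) : #A ≤ #C := by
  by_contra! hC
  exact ((mk_le_mk_of_subset h).trans (mk_union_le B C)).not_gt (add_lt_of_lt hA hB hC)

/-- The infinite form of the Milner–Shelah condition, with the degrees on the `Y` side replaced by
upper bounds `w`. -/
structure IsDominated {X Y : Type u} (Δ : X → Y → Prop) (w : Y → Cardinal.{u}) : Prop where
  aleph0_le_weight : ∀ y, ℵ₀ ≤ w y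
  degree_le_weight : ∀ y, #{x | Δ x y} ≤ w y
  weight_le_degree : ∀ x y, Δ x y → w y ≤ #{y | Δ x y}
  aleph0_le_degree : ∀ x, ℵ₀ ≤ #{y | Δ x y}

/-- A filtration of the graph by small sets closed under neighbours of vertices of small weight, in
which each new vertex of `X` acquires many new neighbours. -/
theorem exists_filtration {X Y : Type u} (Δ : X → Y → Prop) (w : Y → Cardinal.{u})
    (hdeg : ∀ y, #{x | Δ x y} ≤ w y) (idx : X → Ordinal.{u}) (hidx : Function.Injective idx) :
    ∃ M : Ordinal.{u} → Set (X ⊕ Y),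
      (∀ α, (⋃ β < α, M β) ⊆ M α) ∧ (∀ α, #(M α) ≤ max α.card ℵ₀) ∧
      (∀ x, Sum.inl x ∈ M (idx x)) ∧
      (∀ α x y, Sum.inr y ∈ M α → Δ x y → w y ≤ max α.card ℵ₀ → Sum.inl x ∈ M α) ∧
      ∀ α x, Sum.inl x ∈ M α →
        min (max α.card ℵ₀) #{y | Δ x y ∧ Sum.inr y ∉ ⋃ β < α, M β} ≤
          #{y | Δ x y ∧ Sum.inr y ∈ M α ∧ Sum.inr y ∉ ⋃ β < α, M β} := by
  have hT : ∀ (θ : Cardinal.{u}) (B : Set Y), ∃ T ⊆ B, #T = min θ #B := fun θ B =>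
    le_mk_iff_exists_subset.1 (min_le_right _ _)
  choose T hTB hTcard using hT
  let rel : Cardinal.{u} → Set (X ⊕ Y) → X ⊕ Y → X ⊕ Y → Prop := fun θ U a b =>
    (∃ x y, a = Sum.inl x ∧ b = Sum.inr y ∧ y ∈ T θ {y | Δ x y ∧ Sum.inr y ∉ U}) ∨
    (∃ x y, a = Sum.inr y ∧ b = Sum.inl x ∧ Δ x y ∧ w y ≤ θ)
  have hrel : ∀ θ U a, #{b | rel θ U a b} ≤ θ := by
    rintro θ U (x | y)
    · refine (mk_le_mk_of_subset (t := Sum.inr '' T θ {y | Δ x y ∧ Sum.inr y ∉ U}) ?_).trans ?_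
      · rintro b (⟨x', y, h, rfl, hy⟩ | ⟨x', y, h, _⟩)
        · cases h
          exact ⟨y, hy, rfl⟩
        · cases h
      · exact mk_image_le.trans ((hTcard _ _).trans_le (min_le_left _ _))
    · by_cases hy : w y ≤ θ
      · refine (mk_le_mk_of_subset (t := Sum.inl '' {x | Δ x y}) ?_).trans ?_
        · rintro b (⟨x', y, h, _⟩ | ⟨x', y, h, rfl, hy, _⟩)
          · cases h
          · cases h
            exact ⟨x', hy, rfl⟩
        · exact mk_image_le.trans ((hdeg y).trans hy)
      · have : {b | rel θ U (Sum.inr y) b} = ∅ := by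
          ext b
          simp only [rel, Set.mem_ofPred_eq, Set.mem_empty_iff_false, iff_false]
          rintro (⟨x', y, h, _⟩ | ⟨x', y, h, _, _, hw⟩)
          · cases h
          · cases h
            exact hy hw
        simp [this]
  let next : Ordinal.{u} → Set (X ⊕ Y) → Set (X ⊕ Y) := fun α U =>
    {z | ∃ a ∈ U ∪ Sum.inl '' {x | idx x = α},
      Relation.ReflTransGen (rel (max α.card ℵ₀) U) a z}
  let M : Ordinal.{u} → Set (X ⊕ Y) := Ordinal.lt_wf.fix fun α ih =>
    next α (⋃ β, ⋃ h : β < α, ih β h)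
  have hM : ∀ α, M α = next α (⋃ β < α, M β) := fun α => Ordinal.lt_wf.fix_eq _ α
  have hclosed : ∀ α a b, a ∈ M α → rel (max α.card ℵ₀) (⋃ β < α, M β) a b → b ∈ M α := by
    intro α a b ha hab
    rw [hM] at ha ⊢
    obtain ⟨s, hs, hsa⟩ := ha
    exact ⟨s, hs, hsa.tail hab⟩
  refine ⟨M, fun α z hz => ?_, fun α => ?_, fun x => ?_, fun α x y hy hxy hw => ?_,
    fun α x hx => ?_⟩
  · rw [hM]
    exact ⟨z, Or.inl hz, Relation.ReflTransGen.refl⟩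
  · induction α using Ordinal.lt_wf.induction with
    | _ α ih =>
      rw [hM]
      refine mk_reachable_le _ _ (le_max_right _ _) ?_ (hrel _ _)
      refine (mk_union_le _ _).trans (add_le_of_le (le_max_right _ _) ?_ ?_)
      · exact mk_biUnion_le_of_le (le_max_left _ _) (le_max_right _ _) M fun β hβ =>
          (ih β hβ).trans (max_le_max_right _ (Ordinal.card_le_card hβ.le))
      · refine mk_image_le.trans (le_trans ?_ (one_le_aleph0.trans (le_max_right _ _)))
        refine mk_le_one_iff_set_subsingleton.2 fun x hx x' hx' => hidx ?_
        exact Eq.trans hx (Eq.symm hx')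
  · rw [hM]
    exact ⟨_, Or.inr ⟨x, rfl, rfl⟩, Relation.ReflTransGen.refl⟩
  · exact hclosed α _ _ hy (Or.inr ⟨x, y, rfl, rfl, hxy, hw⟩)
  · rw [← hTcard]
    refine mk_le_mk_of_subset fun y hy => ?_
    have h := hTB _ _ hy
    exact ⟨h.1, hclosed α _ _ hx (Or.inl ⟨x, y, rfl, rfl, hy⟩), h.2⟩

/-- The case where the weights of the neighbours of `x` are strictly below the degree of `x`,
reduced to graphs with fewer vertices. -/
theorem hasMatching_of_weight_lt {X Y : Type u} {Δ : X → Y → Prop} {w : Y → Cardinal.{u}}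
    (h : IsDominated Δ w) (hlt : ∀ x y, Δ x y → w y < #{y | Δ x y})
    (IH : ∀ (X' : Type u) (Δ' : X' → Y → Prop) (w' : Y → Cardinal.{u}), #X' < #X →
      IsDominated Δ' w' → HasMatching Δ') : HasMatching Δ := by
  rcases le_or_gt #X ℵ₀ with hX | hX
  · exact hasMatching_of_mk_le fun x => hX.trans (h.aleph0_le_degree x)
  obtain ⟨r, wo, hr⟩ := Cardinal.exists_ord_eq X
  let idx : X → Ordinal.{u} := fun x => Ordinal.typein r x
  have hidxX : ∀ x, (idx x).card < #X := fun x => Cardinal.card_typein_lt x hr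
  obtain ⟨M, hUM, hMcard, hidxM, hclosed, hnew⟩ :=
    exists_filtration Δ w h.degree_le_weight idx (Ordinal.typein_injective r)
  have hmono : ∀ β α, β ≤ α → M β ⊆ M α := by
    intro β α hβα
    rcases hβα.eq_or_lt with rfl | hlt'
    · exact subset_rfl
    · exact fun z hz => hUM α (Set.mem_biUnion (show β ∈ Set.Iio α from hlt') hz)
  have hUcard : ∀ α, #↥(⋃ β < α, M β) ≤ max α.card ℵ₀ := fun α =>
    (mk_le_mk_of_subset (hUM α)).trans (hMcard α)
  have hold : ∀ α x y, Sum.inr y ∈ (⋃ β < α, M β) → Δ x y → Sum.inl x ∉ (⋃ β < α, M β) →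
      max α.card ℵ₀ ≤ w y := by
    intro α x y hy hxy hx
    simp only [Set.mem_iUnion, not_exists] at hy hx
    obtain ⟨β, hβ, hyβ⟩ := hy
    by_contra! hw
    have hwα : w y < α.card := by
      rcases lt_max_iff.1 hw with hw | hw
      · exact hw
      · exact absurd hw (h.aleph0_le_weight y).not_gt
    have hord : (w y).ord < α :=
      lt_of_not_ge fun hle => (card_le_of_le_ord hle).not_gt hwα
    refine hx (max β (w y).ord) (max_lt hβ hord)
      (hclosed _ x y (hmono _ _ (le_max_left _ _) hyβ) hxy (le_trans ?_ (le_max_left _ _)))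
    calc w y = (w y).ord.card := (card_ord _).symm
      _ ≤ _ := Ordinal.card_le_card (le_max_right _ _)
  have hfirst : ∀ x, ∃ α, Sum.inl x ∈ M α ∧ Sum.inl x ∉ (⋃ β < α, M β) ∧ α ≤ idx x := by
    intro x
    obtain ⟨α, hα, hmin⟩ := Ordinal.lt_wf.has_min {α | Sum.inl x ∈ M α} ⟨idx x, hidxM x⟩
    refine ⟨α, hα, ?_, not_lt.1 (hmin _ (hidxM x))⟩
    simp only [Set.mem_iUnion, not_exists]
    exact fun β hβ hx => hmin β hx hβ
  choose a ha1 ha2 ha3 using hfirst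
  refine HasMatching.mono (Δ := fun x y => Δ x y ∧ Sum.inr y ∈ M (a x) ∧
    Sum.inr y ∉ ⋃ β < a x, M β) ?_ fun x y hxy => hxy.1
  refine hasMatching_of_fibers a (fun x x' y h1 h2 => ?_) fun α => ?_
  · rcases lt_trichotomy (a x) (a x') with hlt' | heq | hgt
    · exact absurd (Set.mem_biUnion (show a x ∈ Set.Iio (a x') from hlt') h1.2.1) h2.2.2
    · exact heq
    · exact absurd (Set.mem_biUnion (show a x' ∈ Set.Iio (a x) from hgt) h2.2.1) h1.2.2
  rcases isEmpty_or_nonempty {x // a x = α} with hE | ⟨⟨x0, hx0⟩⟩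
  · exact ⟨fun x => (hE.false x).elim, fun x => (hE.false x).elim, fun x => (hE.false x).elim⟩
  have hθX : max α.card ℵ₀ < #X := by
    refine max_lt ?_ hX
    rw [← hx0]
    exact (Ordinal.card_le_card (ha3 x0)).trans_lt (hidxX x0)
  have hsmall : #{x // a x = α} ≤ max α.card ℵ₀ := by
    refine le_trans ?_ (hMcard α)
    refine mk_le_of_injective (f := fun x => ⟨Sum.inl x.1, by have := ha1 x.1; rwa [x.2] at this⟩) fun x x' e => ?_
    simpa [Subtype.ext_iff] using e
  have hbig : ∀ x : {x // a x = α}, ∀ y, Δ x y → min (w y) (max α.card ℵ₀) ≤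
      #{y | Δ x y ∧ Sum.inr y ∈ M (a x) ∧ Sum.inr y ∉ ⋃ β < a x, M β} := by
    rintro ⟨x, rfl⟩ y hxy
    refine le_trans ?_ (hnew (a x) x (ha1 x))
    rcases le_or_gt #{y | Δ x y} (max (a x).card ℵ₀) with hV | hV
    · have : {y | Δ x y ∧ Sum.inr y ∉ ⋃ β < a x, M β} = {y | Δ x y} := by
        ext z
        refine ⟨fun hz => hz.1, fun hz => ⟨hz, fun hzU => ?_⟩⟩
        exact ((hold _ x z hzU hz (ha2 x)).trans_lt (hlt x z hz)).not_ge hV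
      rw [this, min_comm]
      exact min_le_min_left _ (hlt x y hxy).le
    · refine le_min (min_le_right _ _) ((min_le_right _ _).trans (hV.le.trans ?_))
      refine mk_le_of_subset_union (B := Sum.inr ⁻¹' ⋃ β < a x, M β) (h.aleph0_le_degree x)
        (fun z hz => ?_) ?_
      · by_cases hzU : Sum.inr z ∈ ⋃ β < a x, M β
        · exact Or.inl hzU
        · exact Or.inr ⟨hz, hzU⟩
      · exact ((mk_preimage_of_injective _ _ Sum.inr_injective).trans (hUcard _)).trans_lt hV
  refine IH _ _ (fun y => min (w y) (max α.card ℵ₀)) (hsmall.trans_lt hθX)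
    ⟨fun y => le_min (h.aleph0_le_weight y) (le_max_right _ _), fun y => le_min ?_ ?_,
      fun x y hxy => hbig x y hxy.1, fun x => ?_⟩
  · refine le_trans ?_ (h.degree_le_weight y)
    exact mk_le_of_injective (f := fun x => ⟨x.1.1, x.2.1⟩) fun x x' e => by
      simpa [Subtype.ext_iff] using e
  · exact (mk_set_le _).trans hsmall
  · obtain ⟨⟨y, hy⟩⟩ := mk_ne_zero_iff.1 (aleph0_pos.trans_le (h.aleph0_le_degree x)).ne'
    exact (le_min (h.aleph0_le_weight y) (le_max_right _ _)).trans (hbig x y hy)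

/-- Vertices with as many neighbours of maximal weight as their degree can be matched twice. -/
theorem hasMatching_prod_bool {X Y : Type u} {Δ : X → Y → Prop} {w : Y → Cardinal.{u}}
    (h : IsDominated Δ w) (E : Set X)
    (hE : ∀ x ∈ E, #{y | Δ x y} ≤ #{y | Δ x y ∧ w y = #{y | Δ x y}}) :
    HasMatching (fun (p : E × Bool) y => Δ p.1 y ∧ w y = #{y | Δ p.1 y}) := by
  have hsel : ∀ x : E, ∃ B ⊆ {y | Δ x y ∧ w y = #{y | Δ x y}}, #B = #{y | Δ x y} := fun x =>
    le_mk_iff_exists_subset.1 (hE x x.2)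
  choose B hB hBcard using hsel
  refine HasMatching.mono (Δ := fun (p : E × Bool) y => y ∈ B p.1) ?_ fun p y hy => hB _ hy
  refine hasMatching_of_components (fun p => #{y | Δ p.1 y})
    (fun p => h.aleph0_le_degree _) (fun p p' y hy hy' => ?_) (fun p => ?_) fun S κ hκ _ hS => ?_
  · exact (hB _ hy).2.symm.trans (hB _ hy').2
  · refine mk_comp_le (r := fun (p : E × Bool) y => y ∈ B p.1)
      (s := fun y (p : E × Bool) => y ∈ B p.1) (h.aleph0_le_degree _) p (hBcard _).le
      fun y hy => ?_
    rw [← (hB _ hy).2]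
    have hinj : #{q : E × Bool | y ∈ B q.1} ≤ #({x | Δ x y} × Bool) :=
      mk_le_of_injective (f := fun q => (⟨q.1.1, (hB _ q.2).1⟩, q.1.2)) fun q q' e => by
        simp only [Prod.mk.injEq, Subtype.mk.injEq] at e
        exact Subtype.ext (Prod.ext (Subtype.ext e.1) e.2)
    refine hinj.trans ?_
    rw [mk_prod, lift_uzero]
    refine (mul_le_mul' (h.degree_le_weight y) ?_).trans (mul_eq_self (h.aleph0_le_weight y)).le
    refine le_trans ?_ (h.aleph0_le_weight y)
    simp
  · refine hasMatching_of_mk_le fun p => hS.trans ?_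
    rw [← hκ p p.2, ← hBcard]
    rfl

/-- The infinite case of the Milner–Shelah theorem. -/
theorem IsDominated.hasMatching {X Y : Type u} {Δ : X → Y → Prop} {w : Y → Cardinal.{u}}
    (h : IsDominated Δ w) : HasMatching Δ := by
  classical
  induction hκ : #X using WellFoundedLT.induction generalizing X w with
  | _ κ IH =>
  subst hκ
  let V : X → Cardinal.{u} := fun x => #{y | Δ x y}
  let E : Set X := {x | V x ≤ #{y | Δ x y ∧ w y = V x}}
  obtain ⟨g, hg, hgΔ⟩ := hasMatching_prod_bool h E fun x hx => hx
  -- `q` identifies the two partners of each `x ∈ E`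
  let q : Y → Y := fun y => if hy : ∃ x, g (x, true) = y then g (hy.choose, false) else y
  let p : Y → Y := fun y => if hy : ∃ x, g (x, false) = y then g (hy.choose, true) else y
  have hqt : ∀ x, q (g (x, true)) = g (x, false) := fun x => by
    have hy : ∃ x', g (x', true) = g (x, true) := ⟨x, rfl⟩
    have := congrArg Prod.fst (hg hy.choose_spec)
    simp only [q, hy, dif_pos]
    rw [show hy.choose = x from this]
  have hqf : ∀ y, (∀ x, g (x, true) ≠ y) → q y = y := fun y hy => by
    simp [q, hy]
  have hpf : ∀ x, p (g (x, false)) = g (x, true) := fun x => by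
    have hy : ∃ x', g (x', false) = g (x, false) := ⟨x, rfl⟩
    have := congrArg Prod.fst (hg hy.choose_spec)
    simp only [p, hy, dif_pos]
    rw [show hy.choose = x from this]
  have hwg : ∀ x, w (g (x, true)) = w (g (x, false)) := fun x =>
    (hgΔ (x, true)).2.trans (hgΔ (x, false)).2.symm
  have hwq : ∀ y, w (q y) = w y := fun y => by
    by_cases hy : ∃ x, g (x, true) = y
    · obtain ⟨x, rfl⟩ := hy
      rw [hqt, hwg]
    · rw [hqf y fun x hx => hy ⟨x, hx⟩]
  have hwp : ∀ y, w (p y) = w y := fun y => by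
    by_cases hy : ∃ x, g (x, false) = y
    · obtain ⟨x, rfl⟩ := hy
      rw [hpf, hwg]
    · rw [show p y = y from dif_neg hy]
  have hpq : ∀ y, y = q y ∨ y = p (q y) := fun y => by
    by_cases hy : ∃ x, g (x, true) = y
    · obtain ⟨x, rfl⟩ := hy
      rw [hqt, hpf]
      exact Or.inr rfl
    · exact Or.inl (hqf y fun x hx => hy ⟨x, hx⟩).symm
  let Δ' : {x // x ∉ E} → Y → Prop := fun s z => ∃ y, Δ s y ∧ w y < V s ∧ q y = z
  have hlow : ∀ s : {x // x ∉ E}, V s ≤ #{y | Δ s y ∧ w y < V s} := fun s =>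
    mk_le_of_subset_union (B := {y | Δ s y ∧ w y = V s}) (C := {y | Δ s y ∧ w y < V s})
      (h.aleph0_le_degree s)
      (fun y hy => (h.weight_le_degree s y hy).eq_or_lt.imp (fun e => ⟨hy, e⟩) fun e => ⟨hy, e⟩)
      (not_le.1 s.2)
  have hV' : ∀ s : {x // x ∉ E}, V s ≤ #{z | Δ' s z} := by
    intro s
    by_contra! hlt
    have hsub : {y | Δ s y ∧ w y < V s} ⊆ {z | Δ' s z} ∪ p '' {z | Δ' s z} := by
      intro y hy
      have hz : Δ' s (q y) := ⟨y, hy.1, hy.2, rfl⟩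
      rcases hpq y with e | e
      · left
        rw [e]
        exact hz
      · exact Or.inr ⟨q y, hz, e.symm⟩
    refine ((hlow s).trans ((mk_le_mk_of_subset hsub).trans (mk_union_le _ _))).not_gt ?_
    exact add_lt_of_lt (h.aleph0_le_degree s) hlt (mk_image_le.trans_lt hlt)
  have hwV : ∀ (s : {x // x ∉ E}) z, Δ' s z → w z < #{z | Δ' s z} := by
    rintro s z ⟨y, hy, hw, rfl⟩
    rw [hwq]
    exact hw.trans_le (hV' s)
  have hdom : IsDominated Δ' w := by
    refine ⟨h.aleph0_le_weight, fun z => ?_, fun s z hz => (hwV s z hz).le,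
      fun s => (h.aleph0_le_degree s).trans (hV' s)⟩
    have hsub : Subtype.val '' {s | Δ' s z} ⊆ {x | Δ x z} ∪ {x | Δ x (p z)} := by
      rintro _ ⟨s, ⟨y, hy, _, rfl⟩, rfl⟩
      rcases hpq y with e | e
      · left
        rwa [e] at hy
      · right
        rwa [e] at hy
    rw [← mk_image_eq Subtype.val_injective]
    refine (mk_le_mk_of_subset hsub).trans ((mk_union_le _ _).trans ?_)
    exact add_le_of_le (h.aleph0_le_weight z) (h.degree_le_weight z)
      ((h.degree_le_weight _).trans (hwp z).le)
  obtain ⟨ψ, hψ, hψΔ⟩ := hasMatching_of_weight_lt hdom hwV fun X' Δ'' w' hX' h' =>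
    IH _ (hX'.trans_le (mk_subtype_le _)) h' rfl
  choose f hfΔ _ hfq using hψΔ
  have hfree : ∀ x : E, ∃ b, ∀ s, f s ≠ g (x, b) := by
    intro x
    by_contra! hcon
    obtain ⟨s, hs⟩ := hcon true
    obtain ⟨s', hs'⟩ := hcon false
    have h1 : ψ s = g (x, false) := by rw [← hfq, hs, hqt]
    have h2 : ψ s' = g (x, false) := by
      rw [← hfq, hs', hqf]
      intro x' hx'
      simpa using congrArg Prod.snd (hg hx')
    obtain rfl := hψ (h1.trans h2.symm)
    simpa using congrArg Prod.snd (hg (hs.symm.trans hs'))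
  choose b hb using hfree
  refine ⟨fun x => if hx : x ∈ E then g (⟨x, hx⟩, b ⟨x, hx⟩) else f ⟨x, hx⟩, fun x x' e => ?_,
    fun x => ?_⟩
  · by_cases hx : x ∈ E <;> by_cases hx' : x' ∈ E <;>
      simp only [hx, hx', dif_pos, dif_neg, not_false_eq_true] at e
    · exact congrArg (fun r : E × Bool => r.1.1) (hg e)
    · exact absurd e.symm (hb _ _)
    · exact absurd e (hb _ _)
    · refine congrArg Subtype.val (hψ (a₁ := ⟨x, hx⟩) (a₂ := ⟨x', hx'⟩) ?_)
      rw [← hfq, ← hfq, e]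
  · by_cases hx : x ∈ E
    · simp only [hx, dif_pos]
      exact (hgΔ (⟨x, hx⟩, b ⟨x, hx⟩)).1
    · simp only [hx, dif_neg, not_false_eq_true]
      exact hfΔ ⟨x, hx⟩

/-- Milner–Shelah: in a bipartite graph `⟨X, Δ, Y⟩`, if every `x ∈ X` has positive
valency and `v(x) ≥ v(y)` whenever `{x,y}` is an edge, then there is a matching of
`X` into `Y`. -/
theorem stmt_1 {X Y : Type u} (Δ : X → Y → Prop)
    (h0 : ∀ x, ∃ y, Δ x y)
    (h1 : ∀ x y, Δ x y → #{x' | Δ x' y} ≤ #{y' | Δ x y'}) :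
    ∃ φ : X → Y, Function.Injective φ ∧ ∀ x, Δ x (φ x) := by
  classical
  -- vertices with infinitely many neighbours, mostly of infinite degree, are treated separately
  let I : Set X := {x | ℵ₀ ≤ #{y | Δ x y} ∧
    #{y | Δ x y} ≤ #{y | Δ x y ∧ ℵ₀ ≤ #{x' | Δ x' y}}}
  have hI : HasMatching fun (x : I) y => Δ x y ∧ ℵ₀ ≤ #{x' | Δ x' y} := by
    refine IsDominated.hasMatching (w := fun y => max #{x' | Δ x' y} ℵ₀)
      ⟨fun y => le_max_right _ _, fun y => le_trans ?_ (le_max_left _ _), fun x y hxy => ?_,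
        fun x => x.2.1.trans x.2.2⟩
    · exact mk_le_of_injective (f := fun x => ⟨x.1.1, x.2.1⟩) fun x x' e => by
        simpa [Subtype.ext_iff] using e
    · exact max_le ((h1 x y hxy.1).trans x.2.2) (x.2.1.trans x.2.2)
  have hfinY : ∀ x y, #{y | Δ x y} < ℵ₀ → Δ x y → #{x' | Δ x' y} < ℵ₀ := fun x y hx hxy =>
    (h1 x y hxy).trans_lt hx
  have hnotI : ∀ x ∉ I, ({y | Δ x y}.Finite ∧
      {y | Δ x y ∧ #{x' | Δ x' y} < ℵ₀} = {y | Δ x y}) ∨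
      {y | Δ x y ∧ #{x' | Δ x' y} < ℵ₀}.Infinite := by
    intro x hx
    rcases lt_or_ge #{y | Δ x y} ℵ₀ with hV | hV
    · refine Or.inl ⟨lt_aleph0_iff_set_finite.1 hV, ?_⟩
      ext y
      exact ⟨fun h => h.1, fun h => ⟨h, hfinY x y hV h⟩⟩
    · right
      have hlt : #{y | Δ x y ∧ ℵ₀ ≤ #{x' | Δ x' y}} < #{y | Δ x y} :=
        not_le.1 fun hle => hx ⟨hV, hle⟩
      have := mk_le_of_subset_union (B := {y | Δ x y ∧ ℵ₀ ≤ #{x' | Δ x' y}})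
        (C := {y | Δ x y ∧ #{x' | Δ x' y} < ℵ₀}) hV
        (fun y hy => (le_or_gt ℵ₀ #{x' | Δ x' y}).imp (fun h => ⟨hy, h⟩) fun h => ⟨hy, h⟩) hlt
      rw [← Set.infinite_coe_iff, infinite_iff]
      exact hV.trans this
  have hJ : HasMatching fun (x : {x // x ∉ I}) y => Δ x y ∧ #{x' | Δ x' y} < ℵ₀ := by
    refine hasMatching_of_finite (fun y => ?_) (fun x => ?_) fun x y hfin hxy => ?_
    · by_cases hy : #{x' | Δ x' y} < ℵ₀
      · refine Set.Finite.of_finite_image ((lt_aleph0_iff_set_finite.1 hy).subset ?_)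
          Subtype.val_injective.injOn
        rintro _ ⟨x, hx, rfl⟩
        exact hx.1
      · simp [hy]
    · rcases hnotI x x.2 with ⟨_, e⟩ | hinf
      · obtain ⟨y, hy⟩ := h0 x
        exact ⟨y, (Set.ext_iff.1 e y).2 hy⟩
      · exact hinf.nonempty
    · rcases hnotI x x.2 with ⟨hfin', e⟩ | hinf
      · rw [e, ← Set.ncard_image_of_injective _ Subtype.val_injective]
        have hY := lt_aleph0_iff_set_finite.1 hxy.2
        refine (Set.ncard_le_ncard ?_ hY).trans (toNat_le_toNat (h1 x y hxy.1)
          (lt_aleph0_iff_set_finite.2 hfin'))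
        rintro _ ⟨x', hx', rfl⟩
        exact hx'.1
      · exact absurd hfin hinf
  obtain ⟨f, hf, hfΔ⟩ := hI
  obtain ⟨g, hg, hgΔ⟩ := hJ
  refine ⟨fun x => if hx : x ∈ I then f ⟨x, hx⟩ else g ⟨x, hx⟩, fun x x' e => ?_, fun x => ?_⟩
  · by_cases hx : x ∈ I <;> by_cases hx' : x' ∈ I <;>
      simp only [hx, hx', dif_pos, dif_neg, not_false_eq_true] at e
    · exact congrArg Subtype.val (hf e)
    · exact absurd (e ▸ (hfΔ ⟨x, hx⟩).2) (hgΔ ⟨x', hx'⟩).2.not_ge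
    · exact absurd (e ▸ (hgΔ ⟨x, hx⟩).2) (hfΔ ⟨x', hx'⟩).2.not_gt
    · exact congrArg Subtype.val (hg e)
  · by_cases hx : x ∈ I
    · simp only [hx, dif_pos]
      exact (hfΔ ⟨x, hx⟩).1
    · simp only [hx, dif_neg, not_false_eq_true]
      exact (hgΔ ⟨x, hx⟩).1
end

section
/- There exists a coloring c of the pairs of ω₁ with 4 colors such that every uncountable subset of ω₁ contains pairs of every color; that is, ℵ₁ ↛ [ℵ₁]²₄. -/
open Cardinal

section Coherent

variable {W : Type*} [LinearOrder W]

/-- In a linear order whose proper initial segments are countable and which is itself uncountable,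
countable sets are strictly bounded. -/
theorem exists_forall_lt_of_countable [Uncountable W]
    (hc : ∀ x : W, (Set.Iic x).Countable) {S : Set W} (hS : S.Countable) :
    ∃ δ, ∀ s ∈ S, s < δ := by
  have h : (⋃ s ∈ S, Set.Iic s).Countable := hS.biUnion fun s _ => hc s
  by_contra! hcon
  refine Set.not_countable_univ (α := W) (h.mono fun x _ => ?_)
  obtain ⟨s, hs, hxs⟩ := hcon x
  exact Set.mem_biUnion hs hxs

/-- The recursion along minimal walks: `g ξ β` is the next step of the walk from `β` to `ξ`,
and `f` weighs the steps. -/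
noncomputable def walkWeight [WellFoundedLT W] (f : W → W → ℕ) (g : W → W → W)
    (ξ β : W) : ℕ :=
  if _h : g ξ β < β then max (f β (g ξ β)) (walkWeight f g ξ (g ξ β)) else 0
termination_by (wellFounded_lt (α := W)).wrap β
decreasing_by exact _h

/-- Existence of a coherent family of finite-to-one functions on the proper initial segments. -/
theorem exists_coherent [WellFoundedLT W] (hc : ∀ x : W, (Set.Iic x).Countable) :
    ∃ ρ : W → W → ℕ, (∀ β n, {ξ | ξ < β ∧ ρ ξ β ≤ n}.Finite) ∧
      ∀ α β, α < β → {ξ | ξ < α ∧ ρ ξ α ≠ ρ ξ β}.Finite := by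
  have hf : ∀ β : W, ∃ f : W → ℕ, Set.InjOn f (Set.Iio β) := fun β =>
    Set.countable_iff_exists_injOn.1 ((hc β).mono Set.Iio_subset_Iic_self)
  choose f hf using hf
  have hg : ∀ ξ β : W, ∃ γ, ξ < β →
      ξ ≤ γ ∧ γ < β ∧ ∀ γ', ξ ≤ γ' → γ' < β → f β γ ≤ f β γ' := by
    intro ξ β
    by_cases h : ξ < β
    · obtain ⟨γ, hγ, hmin⟩ := exists_minimalFor_of_wellFoundedLT
        (fun γ => ξ ≤ γ ∧ γ < β) (f β) ⟨ξ, le_rfl, h⟩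
      refine ⟨γ, fun _ => ⟨hγ.1, hγ.2, fun γ' h1 h2 => ?_⟩⟩
      rcases le_total (f β γ) (f β γ') with h' | h'
      · exact h'
      · exact hmin ⟨h1, h2⟩ h'
    · exact ⟨ξ, fun h' => (h h').elim⟩
  choose g hg using hg
  have hρ : ∀ ξ β, ξ < β → walkWeight f g ξ β =
      max (f β (g ξ β)) (walkWeight f g ξ (g ξ β)) := by
    intro ξ β h
    rw [walkWeight, dif_pos (hg ξ β h).2.1]
  have hstep : ∀ β n, {γ | γ < β ∧ f β γ ≤ n}.Finite := fun β n =>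
    Set.Finite.of_finite_image ((Set.finite_Iic n).subset (by rintro _ ⟨γ, hγ, rfl⟩; exact hγ.2))
      ((hf β).mono fun γ hγ => hγ.1)
  have hfin : ∀ β n, {ξ | ξ < β ∧ walkWeight f g ξ β ≤ n}.Finite := by
    intro β
    induction β using WellFoundedLT.induction with
    | ind β ih =>
      intro n
      refine ((hstep β n).biUnion fun γ hγ =>
        ((ih γ hγ.1 n).union (Set.finite_singleton γ))).subset ?_
      rintro ξ ⟨hξ, hn⟩
      rw [hρ ξ β hξ] at hn
      obtain ⟨h1, h2, -⟩ := hg ξ β hξ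
      refine Set.mem_biUnion (x := g ξ β) ⟨h2, (le_max_left _ _).trans hn⟩ ?_
      rcases h1.lt_or_eq with h | h
      · exact Or.inl ⟨h, (le_max_right _ _).trans hn⟩
      · exact Or.inr h
  refine ⟨walkWeight f g, hfin, ?_⟩
  intro α β
  induction β using WellFoundedLT.induction generalizing α with
  | ind β ih =>
    intro hαβ
    have hcoh : ∀ γ, γ < β →
        {ξ | ξ < α ∧ ξ < γ ∧ walkWeight f g ξ α ≠ walkWeight f g ξ γ}.Finite := by
      intro γ hγ
      rcases lt_trichotomy α γ with h | h | h
      · exact (ih γ hγ α h).subset fun ξ hξ => ⟨hξ.1, hξ.2.2⟩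
      · subst h; simp
      · exact (ih α hαβ γ h).subset fun ξ hξ => ⟨hξ.2.1, hξ.2.2.symm⟩
    refine ((hstep β (f β α)).biUnion fun γ hγ =>
      (((hcoh γ hγ.1).union (Set.finite_singleton γ)).union (hfin γ (f β γ)))).subset ?_
    rintro ξ ⟨hξ, hne⟩
    obtain ⟨h1, h2, h3⟩ := hg ξ β (hξ.trans hαβ)
    refine Set.mem_biUnion (x := g ξ β) ⟨h2, h3 α hξ.le hαβ⟩ ?_
    rcases h1.lt_or_eq with h | h
    · by_cases hle : walkWeight f g ξ (g ξ β) ≤ f β (g ξ β)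
      · exact Or.inr ⟨h, hle⟩
      · refine Or.inl (Or.inl ⟨hξ, h, ?_⟩)
        rwa [hρ ξ β (hξ.trans hαβ), max_eq_right (not_le.1 hle).le] at hne
    · exact Or.inl (Or.inr h)

end Coherent

section Line

variable {W : Type*} [LinearOrder W]

/-- `a : W → A` presents a linear order as a lexicographically ordered Aronszajn tree
whose nodes are the restrictions to initial segments of the functions `e x`. -/
structure IsAronszajnLine {A : Type*} [LinearOrder A] (e : W → W → ℕ) (a : W → A) : Prop where
  injective : Function.Injective a
  eq_zero_iff : ∀ x ξ, e x ξ = 0 ↔ x ≤ ξ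
  finite_le : ∀ x n, {ξ | ξ < x ∧ e x ξ ≤ n}.Finite
  countable_level : ∀ δ, (Set.range fun x => (Set.Iic δ).domRestrict (e x)).Countable
  ordConnected : ∀ δ x y z, a x ≤ a y → a y ≤ a z →
    (∀ ξ ≤ δ, e x ξ = e z ξ) → ∀ ξ ≤ δ, e x ξ = e y ξ

theorem lex_ordConnected [WellFoundedLT W] (δ : W) (x y z : W → ℕ) (hxy : toLex x ≤ toLex y)
    (hyz : toLex y ≤ toLex z) (h : ∀ ξ ≤ δ, x ξ = z ξ) : ∀ ξ ≤ δ, x ξ = y ξ := by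
  rcases hxy.eq_or_lt with hxy | ⟨i, hi, hi'⟩
  · rw [toLex_inj.1 hxy]; simp
  rcases hyz.eq_or_lt with hyz | ⟨j, hj, hj'⟩
  · rwa [toLex_inj.1 hyz]
  simp only [Pi.toLex_apply] at hi hi' hj hj'
  intro ξ hξ
  rcases lt_or_ge δ i with hδ | hδ
  · exact hi ξ (hξ.trans_lt hδ)
  exfalso
  rcases lt_trichotomy i j with hij | rfl | hij
  · have := hj i hij; have := h i hδ; omega
  · have := h i hδ; omega
  · have := hi j hij; have := h j (hij.le.trans hδ); omega

theorem countable_setOf_finite_ne {ι : Type*} [Countable ι] (v : ι → ℕ) :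
    {u : ι → ℕ | {i | u i ≠ v i}.Finite}.Countable := by
  let φ : {u : ι → ℕ | {i | u i ≠ v i}.Finite} → (ι →₀ ℤ) := fun u =>
    Finsupp.ofSupportFinite (fun i => (u.1 i : ℤ) - v i)
      (u.2.subset fun i hi h => hi (by simp [h]))
  have hφ : Function.Injective φ := by
    intro u u' h
    ext i
    have := DFunLike.congr_fun h i
    simp only [φ, Finsupp.ofSupportFinite_coe] at this
    omega
  exact hφ.countable

theorem exists_isAronszajnLine [WellFoundedLT W] (hc : ∀ x : W, (Set.Iic x).Countable) :
    ∃ (e : W → W → ℕ), IsAronszajnLine e fun x => toLex (e x) := by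
  obtain ⟨ρ, hfin, hcoh⟩ := exists_coherent hc
  have hz : ∀ x ξ, (if ξ < x then ρ ξ x + 1 else 0) = 0 ↔ x ≤ ξ := by
    intro x ξ
    split_ifs with h <;> simp [h, not_lt.1]
  refine ⟨fun x ξ => if ξ < x then ρ ξ x + 1 else 0, ?_, hz, ?_, ?_, ?_⟩
  · intro x y h
    have h := toLex_inj.1 h
    exact le_antisymm ((hz x y).1 ((congrFun h y).trans ((hz y y).2 le_rfl)))
      ((hz y x).1 ((congrFun h x).symm.trans ((hz x x).2 le_rfl)))
  · intro x n
    refine (hfin x n).subset ?_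
    rintro ξ ⟨h, h'⟩
    simp only [if_pos h] at h'
    exact ⟨h, by omega⟩
  · intro δ
    have := (hc δ).to_subtype
    set p := fun x => (Set.Iic δ).domRestrict fun ξ => if ξ < x then ρ ξ x + 1 else 0 with hp
    refine (((hc δ).image p).union (countable_setOf_finite_ne (p δ))).mono ?_
    rintro _ ⟨x, rfl⟩
    rcases le_or_gt x δ with hx | hx
    · exact Or.inl ⟨x, hx, rfl⟩
    · refine Or.inr (Set.Finite.of_finite_image (f := Subtype.val) ?_
        Subtype.val_injective.injOn)
      refine ((hcoh δ x hx).union (Set.finite_singleton δ)).subset ?_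
      rintro _ ⟨⟨ξ, hξ⟩, hne, rfl⟩
      rcases (Set.mem_Iic.1 hξ).lt_or_eq with h | h
      · refine Or.inl ⟨h, fun h' => hne ?_⟩
        simp only [hp, Set.domRestrict_apply, if_pos h, if_pos (h.trans hx)]
        exact congrArg (· + 1) h'.symm
      · exact Or.inr h
  · intro δ x y z hxy hyz h
    exact lex_ordConnected δ _ _ _ hxy hyz h

namespace IsAronszajnLine

variable {A : Type*} [LinearOrder A] {e : W → W → ℕ} {a : W → A}

theorem dual (h : IsAronszajnLine e a) : IsAronszajnLine e (OrderDual.toDual ∘ a) where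
  injective := OrderDual.toDual.injective.comp h.injective
  eq_zero_iff := h.eq_zero_iff
  finite_le := h.finite_le
  countable_level := h.countable_level
  ordConnected δ x y z hxy hyz hxz ξ hξ :=
    (hxz ξ hξ).trans (h.ordConnected δ z y x hyz hxy (fun η hη => (hxz η hη).symm) ξ hξ)

/-- The underlying tree has no cofinal branch. -/
theorem false_of_branch [Uncountable W] (hc : ∀ x : W, (Set.Iic x).Countable)
    (h : IsAronszajnLine e a) (b : W → ℕ)
    (hb : ∀ δ, ∃ y, δ < y ∧ ∀ ξ ≤ δ, b ξ = e y ξ) : False := by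
  have hfin : ∀ n, {ξ | b ξ = n}.Finite := by
    intro n
    by_contra hinf
    obtain ⟨T, hT, hTinf, hTc⟩ : ∃ T ⊆ {ξ | b ξ = n}, T.Infinite ∧ T.Countable := by
      have := Set.Infinite.to_subtype hinf
      refine ⟨Set.range fun k => (Infinite.natEmbedding {ξ | b ξ = n} k : W), ?_, ?_,
        Set.countable_range _⟩
      · rintro _ ⟨k, rfl⟩
        exact Subtype.coe_prop _
      · exact Set.infinite_range_of_injective
          (Subtype.val_injective.comp (Infinite.natEmbedding _).injective)
    obtain ⟨δ, hδ⟩ := exists_forall_lt_of_countable hc hTc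
    obtain ⟨y, hy, hby⟩ := hb δ
    refine hTinf ((h.finite_le y n).subset fun ξ hξ => ⟨(hδ ξ hξ).trans hy, ?_⟩)
    rw [← hby ξ (hδ ξ hξ).le]
    exact (hT hξ).le
  refine Set.not_countable_univ (α := W)
    ((Set.countable_iUnion fun n => (hfin n).countable).mono fun ξ _ => ?_)
  exact Set.mem_iUnion.2 ⟨b ξ, rfl⟩

theorem exists_countable_reps (h : IsAronszajnLine e a) (Y : Set W) (δ : W) :
    ∃ R ⊆ Y, R.Countable ∧ ∀ y ∈ Y, ∃ y' ∈ R, ∀ ξ ≤ δ, e y ξ = e y' ξ := by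
  obtain ⟨R, hR, hbij⟩ :=
    (Set.surjOn_image (fun x => (Set.Iic δ).domRestrict (e x)) Y).exists_bijOn_subset
  refine ⟨R, hR, Set.MapsTo.countable_of_injOn hbij.mapsTo hbij.injOn
    ((h.countable_level δ).mono (Set.image_subset_range _ _)), fun y hy => ?_⟩
  obtain ⟨y', hy', heq⟩ := hbij.surjOn (Set.mem_image_of_mem _ hy)
  exact ⟨y', hy', fun ξ hξ => (congrFun heq ⟨ξ, hξ⟩).symm⟩

/-- Every subset of the line has a countable coinitial subset. -/
theorem exists_countable_coinitial [Uncountable W] (hc : ∀ x : W, (Set.Iic x).Countable)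
    (h : IsAronszajnLine e a) (Y : Set W) :
    ∃ Y' ⊆ Y, Y'.Countable ∧ ∀ y ∈ Y, ∃ y' ∈ Y', a y' ≤ a y := by
  by_contra! hcon
  choose R hRY hRc hR using h.exists_countable_reps Y
  have hy : ∀ δ, ∃ y ∈ Y, ∀ y' ∈ R δ ∪ Y ∩ Set.Iic δ, a y < a y' := fun δ =>
    hcon _ (Set.union_subset (hRY δ) Set.inter_subset_left)
      ((hRc δ).union ((hc δ).mono Set.inter_subset_right))
  choose y hyY hy using hy
  have hlt : ∀ δ, δ < y δ := fun δ => by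
    by_contra! hle
    exact lt_irrefl _ (hy δ (y δ) (Or.inr ⟨hyY δ, hle⟩))
  have key : ∀ δ δ', a (y δ) ≤ a (y δ') → ∀ ξ ≤ δ', e (y δ) ξ = e (y δ') ξ := by
    intro δ δ' hle
    obtain ⟨z, hz, hag⟩ := hR δ' (y δ) (hyY δ)
    exact h.ordConnected δ' _ _ z hle (hy δ' z (Or.inl hz)).le hag
  refine h.false_of_branch hc (fun ξ => e (y ξ) ξ) fun δ => ⟨y δ, hlt δ, fun ξ hξ => ?_⟩
  rcases le_total (a (y ξ)) (a (y δ)) with hle | hle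
  · exact key ξ δ hle ξ hξ
  · exact (key δ ξ hle ξ le_rfl).symm

/-- No uncountable suborder of the line is anti-isomorphic to a set of reals. -/
theorem countable_of_antitone_real [Uncountable W] (hc : ∀ x : W, (Set.Iic x).Countable)
    (h : IsAronszajnLine e a) {r : W → ℝ} (hr : Function.Injective r) {Z : Set W}
    (hZ : ∀ z ∈ Z, ∀ z' ∈ Z, r z < r z' → a z' < a z) : Z.Countable := by
  by_contra hunc
  have hd : ∀ p : ℚ × ℚ, ∃ d : W, (∃ z ∈ Z, p.1 < r z ∧ r z < p.2) →
      d ∈ Z ∧ p.1 < r d ∧ r d < p.2 := by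
    intro p
    by_cases hp : ∃ z ∈ Z, p.1 < r z ∧ r z < p.2
    · exact ⟨hp.choose, fun _ => hp.choose_spec⟩
    · exact ⟨Classical.arbitrary W, fun hp' => (hp hp').elim⟩
  choose d hd using hd
  obtain ⟨δ, hδ⟩ := exists_forall_lt_of_countable hc (Set.countable_range d)
  obtain ⟨s, hs⟩ : ∃ s, (Z ∩ Set.Ioi δ ∩ {x | (Set.Iic δ).domRestrict (e x) = s}).Infinite := by
    by_contra! hfin
    refine hunc (((hc δ).union ((h.countable_level δ).biUnion fun s _ =>
      (hfin s).countable)).mono fun z hz => ?_)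
    rcases le_or_gt z δ with hzδ | hzδ
    · exact Or.inl hzδ
    · exact Or.inr (Set.mem_biUnion ⟨z, rfl⟩ ⟨⟨hz, hzδ⟩, rfl⟩)
  obtain ⟨t, hts, ht⟩ := (hs.image hr.injOn).exists_subset_card_eq 3
  have hmem : ∀ i, t.orderEmbOfFin ht i ∈ r '' _ := fun i => hts (t.orderEmbOfFin_mem ht i)
  choose u hu hru using hmem
  have hlt : ∀ i j, i < j → r (u i) < r (u j) := fun i j hij => by
    rw [hru, hru]; exact (t.orderEmbOfFin ht).strictMono hij
  obtain ⟨p, hp0, hp1⟩ := exists_rat_btwn (hlt 0 1 (by decide))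
  obtain ⟨q, hq1, hq2⟩ := exists_rat_btwn (hlt 1 2 (by decide))
  obtain ⟨hdZ, hpd, hdq⟩ := hd (p, q) ⟨u 1, (hu 1).1.1, hp1, hq1⟩
  have hag : ∀ ξ ≤ δ, e (u 2) ξ = e (u 0) ξ := fun ξ hξ =>
    congrFun ((hu 2).2.trans (hu 0).2.symm) ⟨ξ, hξ⟩
  have := h.ordConnected δ _ _ _ (hZ _ hdZ _ (hu 2).1.1 (hdq.trans hq2)).le
    (hZ _ (hu 0).1.1 _ hdZ (hp0.trans hpd)).le hag δ le_rfl
  rw [(h.eq_zero_iff _ δ).2 (hδ _ ⟨_, rfl⟩).le, h.eq_zero_iff] at this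
  exact this.not_gt (hu 2).1.2

/-- Every uncountable set contains a pair on which the well-order, the order of the reals
and the order of the Aronszajn line all agree. -/
theorem exists_lt_lt_lt [Uncountable W] (hc : ∀ x : W, (Set.Iic x).Countable)
    (h : IsAronszajnLine e a) {r : W → ℝ} (hr : Function.Injective r) {X : Set W}
    (hX : ¬ X.Countable) : ∃ x ∈ X, ∃ y ∈ X, x < y ∧ r x < r y ∧ a x < a y := by
  by_contra! hcon
  let N : ℚ → Set W := fun q => {y ∈ X | q < r y ∧ ∃ x ∈ X, r x < q ∧ a x < a y}
  have hN : ∀ q, (N q).Countable := by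
    intro q
    obtain ⟨Y', hY', hY'c, hY'i⟩ := h.exists_countable_coinitial hc {x ∈ X | r x < q}
    obtain ⟨δ, hδ⟩ := exists_forall_lt_of_countable hc hY'c
    refine (hc δ).mono ?_
    rintro y ⟨hyX, hqy, x, hxX, hxq, hxy⟩
    obtain ⟨x', hx', hle⟩ := hY'i x ⟨hxX, hxq⟩
    by_contra hyδ
    exact (hcon x' (hY' hx').1 y hyX ((hδ x' hx').trans (not_le.1 hyδ))
      ((hY' hx').2.trans hqy)).not_gt (hle.trans_lt hxy)
  have hZ : (X \ ⋃ q, N q).Countable := by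
    refine h.countable_of_antitone_real hc hr fun z hz z' hz' hlt => ?_
    obtain ⟨q, hq, hq'⟩ := exists_rat_btwn hlt
    refine lt_of_le_of_ne (not_lt.1 fun hzz => hz'.2 ?_) ?_
    · exact Set.mem_iUnion.2 ⟨q, hz'.1, hq', z, hz.1, hq, hzz⟩
    · exact fun heq => hlt.ne' (congrArg r (h.injective heq))
  exact hX ((hZ.union (Set.countable_iUnion hN)).mono fun x hx => by
    by_cases hxN : x ∈ ⋃ q, N q
    · exact Or.inr hxN
    · exact Or.inl ⟨hx, hxN⟩)

end IsAronszajnLine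

end Line

/-- An uncountable well-order whose initial segments are countable and which injects into the reals
carries a symmetric 4-coloring for which every uncountable subset realizes every color. -/
theorem exists_coloring {W : Type*} [LinearOrder W] [WellFoundedLT W] [Uncountable W]
    (hc : ∀ x : W, (Set.Iic x).Countable) {r : W → ℝ} (hr : Function.Injective r) :
    ∃ c : W → W → Fin 4, (∀ x y, c x y = c y x) ∧
      ∀ S : Set W, ¬ S.Countable → ∀ k : Fin 4, ∃ x ∈ S, ∃ y ∈ S, x ≠ y ∧ c x y = k := by
  classical
  obtain ⟨e, he⟩ := exists_isAronszajnLine hc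
  let a : W → Lex (W → ℕ) := fun x => toLex (e x)
  let b : W → W → Fin 4 := fun x y =>
    if r x < r y then if a x < a y then 0 else 1 else if a x < a y then 2 else 3
  have hr' : Function.Injective fun x => -r x := neg_injective.comp hr
  refine ⟨fun x y => b (min x y) (max x y), fun x y => ?_, ?_⟩
  · simp only [min_comm, max_comm]
  intro S hS k
  suffices h : ∃ x ∈ S, ∃ y ∈ S, x < y ∧ b x y = k by
    obtain ⟨x, hx, y, hy, hxy, hb⟩ := h
    exact ⟨x, hx, y, hy, hxy.ne, by simpa only [min_eq_left hxy.le, max_eq_right hxy.le]⟩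
  fin_cases k
  · obtain ⟨x, hx, y, hy, hxy, h1, h2⟩ := he.exists_lt_lt_lt hc hr hS
    exact ⟨x, hx, y, hy, hxy, (if_pos h1).trans (if_pos h2)⟩
  · obtain ⟨x, hx, y, hy, hxy, h1, h2⟩ := he.dual.exists_lt_lt_lt hc hr hS
    exact ⟨x, hx, y, hy, hxy, (if_pos h1).trans (if_neg (OrderDual.toDual_lt_toDual.1 h2).not_gt)⟩
  · obtain ⟨x, hx, y, hy, hxy, h1, h2⟩ := he.exists_lt_lt_lt hc hr' hS
    exact ⟨x, hx, y, hy, hxy, (if_neg (neg_lt_neg_iff.1 h1).not_gt).trans (if_pos h2)⟩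
  · obtain ⟨x, hx, y, hy, hxy, h1, h2⟩ := he.dual.exists_lt_lt_lt hc hr' hS
    exact ⟨x, hx, y, hy, hxy, (if_neg (neg_lt_neg_iff.1 h1).not_gt).trans
      (if_neg (OrderDual.toDual_lt_toDual.1 h2).not_gt)⟩

/-- Galvin–Shelah: `ℵ₁ ↛ [ℵ₁]²₄`. There is a symmetric coloring of pairs from a set
of size `ℵ₁` with 4 colors such that every subset of full size `ℵ₁` realizes all
4 colors on its pairs. -/
theorem stmt_3 (W : Type) (hW : #W = Cardinal.aleph 1) :
    ∃ c : W → W → Fin 4, (∀ x y, c x y = c y x) ∧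
      ∀ S : Set W, #S = Cardinal.aleph 1 → ∀ k : Fin 4,
        ∃ x ∈ S, ∃ y ∈ S, x ≠ y ∧ c x y = k := by
  obtain ⟨φ⟩ : Nonempty (W ≃ (Cardinal.aleph 1).ord.ToType) :=
    Cardinal.eq.1 (by rw [hW, Cardinal.mk_ord_toType])
  obtain ⟨r⟩ : Nonempty ((Cardinal.aleph 1).ord.ToType ↪ ℝ) := by
    rw [← Cardinal.le_def, Cardinal.mk_ord_toType, Cardinal.mk_real]
    exact Cardinal.aleph_one_le_continuum
  have : Uncountable (Cardinal.aleph 1).ord.ToType := by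
    rw [← Cardinal.aleph0_lt_mk_iff, Cardinal.mk_ord_toType]
    exact Cardinal.aleph0_lt_aleph_one
  have hc : ∀ x : (Cardinal.aleph 1).ord.ToType, (Set.Iic x).Countable := fun x => by
    have h := (Cardinal.mk_Iio_lt x (by simp)).trans_eq
      ((Cardinal.mk_ord_toType _).trans Cardinal.succ_aleph0.symm)
    rw [Order.lt_succ_iff, Cardinal.le_aleph0_iff_set_countable] at h
    rw [← Set.Iio_insert]
    exact h.insert x
  obtain ⟨c, hsymm, hcol⟩ := exists_coloring hc r.injective
  refine ⟨fun x y => c (φ x) (φ y), fun x y => hsymm _ _, fun S hS k => ?_⟩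
  have hS' : ¬ (φ '' S).Countable := fun h => by
    have h := Set.countable_of_injective_of_countable_image φ.injective.injOn h
    rw [← Cardinal.le_aleph0_iff_set_countable, hS] at h
    exact h.not_gt Cardinal.aleph0_lt_aleph_one
  obtain ⟨_, ⟨x, hx, rfl⟩, _, ⟨y, hy, rfl⟩, hne, hk⟩ := hcol _ hS' k
  exact ⟨x, hx, y, hy, fun h => hne (congrArg φ h), hk⟩
end

section
/- There exists a coloring of the pairs of reals with ℵ₀ colors such that every set of reals of cardinality 2^{ℵ₀} contains pairs of every color; that is, 2^{ℵ₀} ↛ [2^{ℵ₀}]²_{ℵ₀}. -/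
open Cardinal

/-- The sequence agreeing with `s` below `k` and vanishing from `k` on. -/
def seqTrunc (k : ℕ) (s : ℕ → ℝ) : ℕ → ℝ := fun i => if i < k then s i else 0

theorem seqTrunc_apply_of_lt {k i : ℕ} (h : i < k) (s : ℕ → ℝ) : seqTrunc k s i = s i :=
  if_pos h

/-- A sequence may be defined by prescribing each term as a function of the preceding ones. -/
theorem exists_seq_eq_apply_seqTrunc (F : (ℕ → ℝ) → ℝ) :
    ∃ s : ℕ → ℝ, ∀ n, s n = F (seqTrunc n s) := by
  let P : ℕ → ℕ → ℝ := fun n => Nat.rec (fun _ => 0) (fun n p => Function.update p n (F p)) n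
  have hP : ∀ n, P n = seqTrunc n fun i => F (P i) := by
    intro n
    induction n with
    | zero => funext i; simp [P, seqTrunc]
    | succ n ih =>
      funext i
      change Function.update (P n) n (F (P n)) i = _
      rcases lt_trichotomy i n with h | rfl | h
      · rw [Function.update_of_ne h.ne, ih]
        simp [seqTrunc, h, h.trans n.lt_succ_self]
      · simp [seqTrunc]
      · rw [Function.update_of_ne h.ne', ih]
        simp [seqTrunc, h.not_gt, show ¬ i < n + 1 by omega]
  exact ⟨fun n => F (P n), fun n => congrArg F (hP n)⟩

/-- The upper envelope on `ℕ → ℝ` encoded by a set of pairs consisting of a rational number and a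
basic open set. -/
noncomputable def upperEnvelope
    (T : Set (ℚ × TopologicalSpace.countableBasis (ℕ → ℝ))) (p : ℕ → ℝ) : ℝ :=
  sSup {t : ℝ | ∃ q : ℚ, (q : ℝ) = t ∧
    ∀ U : TopologicalSpace.countableBasis (ℕ → ℝ), p ∈ U.1 → (q, U) ∈ T}

/-- There are continuum many sequences such that every upper envelope captures a term from the
preceding ones in fewer than continuum many of them. -/
theorem exists_seq_avoiding_upperEnvelope :
    ∃ r : ℝ → ℕ → ℝ, ∀ T : Set (ℚ × TopologicalSpace.countableBasis (ℕ → ℝ)),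
      #{x : ℝ | ∃ k, r x k = upperEnvelope T (seqTrunc k (r x))} < 𝔠 := by
  obtain ⟨lt, hwo, hord⟩ := Cardinal.exists_ord_eq ℝ
  have hseg : ∀ x : ℝ, #{y | lt y x} < 𝔠 := by
    intro x
    rw [← mk_real]
    exact card_typein_lt x hord
  have hT : #(Set (ℚ × TopologicalSpace.countableBasis (ℕ → ℝ))) ≤ #ℝ := by
    have : Countable (TopologicalSpace.countableBasis (ℕ → ℝ)) :=
      (TopologicalSpace.countable_countableBasis _).to_subtype
    rw [mk_set, mk_real, ← two_power_aleph0]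
    exact power_le_power_left two_ne_zero mk_le_aleph0
  obtain ⟨e⟩ := hT
  have hF : ∀ (x : ℝ) (p : ℕ → ℝ), ∃ t : ℝ, ∀ T, lt (e T) x → t ≠ upperEnvelope T p := by
    intro x p
    by_contra! hcon
    choose T hT hTt using hcon
    have hinj : Function.Injective fun t : ℝ => (⟨e (T t), hT t⟩ : {y | lt y x}) := by
      intro t t' h
      have h' : T t = T t' := e.injective (congrArg Subtype.val h)
      rw [hTt t, hTt t', h']
    exact ((mk_le_of_injective hinj).trans_lt (hseg x)).ne mk_real
  choose F hF using hF
  choose r hr using fun x => exists_seq_eq_apply_seqTrunc (F x)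
  refine ⟨r, fun T => ?_⟩
  have hsub : {x : ℝ | ∃ k, r x k = upperEnvelope T (seqTrunc k (r x))} ⊆
      insert (e T) {y | lt y (e T)} := by
    rintro x ⟨k, hk⟩
    rcases trichotomous_of lt x (e T) with h | h | h
    · exact Or.inr h
    · exact Or.inl h
    · exact absurd hk (by rw [hr x k]; exact hF x _ T h)
  refine (mk_le_mk_of_subset hsub).trans_lt (mk_insert_le.trans_lt ?_)
  exact add_lt_of_lt aleph0_le_continuum (hseg _) (one_lt_aleph0.trans aleph0_lt_continuum)

/-- A family of sequences is adherent if every subfamily of size continuum contains, for every `k`,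
a further such subfamily whose `k`-th terms lie below some rational, and each of whose truncations
is a limit of truncations of members whose `k`-th terms lie above that rational. -/
def IsAdherentFamily (r : ℝ → ℕ → ℝ) : Prop :=
  ∀ S : Set ℝ, #S = 𝔠 → ∀ k, ∃ q : ℚ, ∃ A ⊆ S, #A = 𝔠 ∧
    ∀ x ∈ A, r x k < q ∧ seqTrunc k (r x) ∈
      closure {p | ∃ y ∈ S, (q : ℝ) < r y k ∧ seqTrunc k (r y) = p}

theorem exists_isAdherentFamily : ∃ r, IsAdherentFamily r := by
  obtain ⟨r, hr⟩ := exists_seq_avoiding_upperEnvelope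
  refine ⟨r, fun S hS k => ?_⟩
  let B : ℚ → Set (ℕ → ℝ) := fun q => {p | ∃ y ∈ S, (q : ℝ) < r y k ∧ seqTrunc k (r y) = p}
  let T : Set (ℚ × TopologicalSpace.countableBasis (ℕ → ℝ)) := {z | (z.2.1 ∩ B z.1).Nonempty}
  have hclosure : ∀ (q : ℚ) p,
      (∀ U : TopologicalSpace.countableBasis (ℕ → ℝ), p ∈ U.1 → (q, U) ∈ T) ↔
        p ∈ closure (B q) := by
    intro q p
    rw [(TopologicalSpace.isBasis_countableBasis _).mem_closure_iff]
    exact ⟨fun h U hU hp => h ⟨U, hU⟩ hp, fun h U hp => h U.1 U.2 hp⟩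
  let G : Set ℝ := S \ {x | ∃ k, r x k = upperEnvelope T (seqTrunc k (r x))}
  have hG : 𝔠 ≤ #G := by
    by_contra! hlt
    have hle : #S ≤ #G + #{x : ℝ | ∃ k, r x k = upperEnvelope T (seqTrunc k (r x))} :=
      (mk_le_mk_of_subset (Set.subset_sdiff_union _ _)).trans (mk_union_le _ _)
    exact (hle.trans_lt (add_lt_of_lt aleph0_le_continuum hlt (hr T))).ne hS
  have hex : ∀ x : G, ∃ q : ℚ, r x k < q ∧ seqTrunc k (r x) ∈ closure (B q) := by
    rintro ⟨x, hxS, hx⟩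
    by_contra! hcon
    refine hx ⟨k, ?_⟩
    symm
    refine IsLUB.csSup_eq ⟨?_, ?_⟩ ?_
    · rintro _ ⟨q, rfl, hq⟩
      exact le_of_not_gt fun h => hcon q h ((hclosure _ _).1 hq)
    · intro b hb
      refine le_of_forall_rat_lt_imp_le fun q hq => hb ⟨q, rfl, ?_⟩
      exact (hclosure _ _).2 (subset_closure ⟨x, hxS, hq, rfl⟩)
    · obtain ⟨q, hq⟩ := exists_rat_lt (r x k)
      exact ⟨q, q, rfl, (hclosure _ _).2 (subset_closure ⟨x, hxS, hq, rfl⟩)⟩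
  choose f hf using hex
  have hcof : #ℚ < (𝔠).ord.cof := by
    rw [mk_eq_aleph0, ← two_power_aleph0]
    exact lt_cof_ord_power le_rfl one_lt_two
  obtain ⟨q, hq⟩ := infinite_pigeonhole_card f 𝔠 hG aleph0_le_continuum hcof
  refine ⟨q, Subtype.val '' (f ⁻¹' {q}), ?_, ?_, ?_⟩
  · rintro _ ⟨x, -, rfl⟩
    exact x.2.1
  · rw [mk_image_eq Subtype.val_injective]
    exact le_antisymm ((mk_subtype_le _).trans ((mk_subtype_le _).trans mk_real.le)) hq
  · rintro _ ⟨x, rfl, rfl⟩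
    exact hf x

theorem IsAdherentFamily.exists_forall_lt {r : ℝ → ℕ → ℝ} (hr : IsAdherentFamily r) (k : ℕ) :
    ∀ S : Set ℝ, #S = 𝔠 → ∃ x ∈ S, ∃ y ∈ S, ∀ i < k, r x i < r y i := by
  induction k with
  | zero =>
    intro S hS
    obtain ⟨x⟩ : Nonempty S := mk_ne_zero_iff.1 (hS ▸ continuum_ne_zero)
    exact ⟨x, x.2, x, x.2, by simp⟩
  | succ k ih =>
    intro S hS
    obtain ⟨q, A, hAS, hA, hq⟩ := hr S hS k
    obtain ⟨x, hx, y, hy, hxy⟩ := ih A hA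
    have hopen : IsOpen {p : ℕ → ℝ | ∀ i ∈ Set.Iio k, r x i < p i} := by
      simp only [Set.ofPred_forall]
      exact (Set.finite_Iio k).isOpen_biInter fun i _ =>
        isOpen_lt continuous_const (continuous_apply i)
    obtain ⟨_, hp, z, hz, hqz, rfl⟩ := mem_closure_iff.1 (hq y hy).2 _ hopen
      fun i hi => by rw [seqTrunc_apply_of_lt hi]; exact hxy i hi
    refine ⟨x, hAS hx, z, hz, fun i hi => ?_⟩
    rcases Nat.lt_succ_iff_lt_or_eq.1 hi with hi | rfl
    · simpa only [seqTrunc_apply_of_lt hi] using hp i hi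
    · exact (hq x hx).1.trans hqz

theorem IsAdherentFamily.exists_forall_lt_and_gt {r : ℝ → ℕ → ℝ} (hr : IsAdherentFamily r)
    {S : Set ℝ} (hS : #S = 𝔠) (k : ℕ) :
    ∃ x ∈ S, ∃ y ∈ S, (∀ i < k, r x i < r y i) ∧ r y k < r x k := by
  obtain ⟨q, A, hAS, hA, hq⟩ := hr S hS k
  obtain ⟨x, hx, y, hy, hxy⟩ := hr.exists_forall_lt k A hA
  have hopen : IsOpen {p : ℕ → ℝ | ∀ i ∈ Set.Iio k, p i < r y i} := by
    simp only [Set.ofPred_forall]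
    exact (Set.finite_Iio k).isOpen_biInter fun i _ =>
      isOpen_lt (continuous_apply i) continuous_const
  obtain ⟨_, hp, z, hz, hqz, rfl⟩ := mem_closure_iff.1 (hq x hx).2 _ hopen
    fun i hi => by rw [seqTrunc_apply_of_lt hi]; exact hxy i hi
  refine ⟨z, hz, y, hAS hy, fun i hi => ?_, (hq y hy).1.trans hqz⟩
  simpa only [seqTrunc_apply_of_lt hi] using hp i hi

/-- Galvin–Shelah: `2^ℵ₀ ↛ [2^ℵ₀]²_{ℵ₀}`. There is a symmetric coloring of pairs of
reals with `ℵ₀` colors such that every set of reals of cardinality continuum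
realizes all colors on its pairs. -/
theorem stmt_4 :
    ∃ c : ℝ → ℝ → ℕ, (∀ x y, c x y = c y x) ∧
      ∀ S : Set ℝ, #S = 2 ^ ℵ₀ → ∀ k : ℕ,
        ∃ x ∈ S, ∃ y ∈ S, x ≠ y ∧ c x y = k := by
  obtain ⟨r, hr⟩ := exists_isAdherentFamily
  refine ⟨fun x y => sInf {n | (r x 0 < r y 0 ∧ r y (n + 1) < r x (n + 1)) ∨
    (r y 0 < r x 0 ∧ r x (n + 1) < r y (n + 1))}, fun x y => ?_, fun S hS k => ?_⟩
  · simp only [or_comm]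
  · rw [two_power_aleph0] at hS
    obtain ⟨x, hx, y, hy, hlt, hgt⟩ := hr.exists_forall_lt_and_gt hS (k + 1)
    have h0 := hlt 0 k.succ_pos
    refine ⟨x, hx, y, hy, fun h => h0.ne (by rw [h]), ?_⟩
    refine IsLeast.csInf_eq ⟨Or.inl ⟨h0, hgt⟩, ?_⟩
    rintro n (⟨-, hn⟩ | ⟨hn, -⟩)
    · by_contra! h
      exact (hlt (n + 1) (by omega)).not_gt hn
    · exact absurd hn h0.not_gt
end

section
/- There exists an uncountable tournament with no uncountable transitive subtournament. -/
open Cardinal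

namespace GalvinShelah

theorem lex_eq_below_of_le_of_le {V : Type*} [LinearOrder V] {f g h : V → ℕ} {δ : V}
    (hfg : toLex f ≤ toLex g) (hgh : toLex g ≤ toLex h) (hfh : ∀ ξ < δ, f ξ = h ξ) : ∀ ξ < δ, g ξ = f ξ := by
  rcases hfg.eq_or_lt with e | ⟨i, hi, hi'⟩
  · intro ξ _
    rw [toLex_inj.1 e]
  rcases hgh.eq_or_lt with e | ⟨j, hj, hj'⟩
  · intro ξ hξ
    rw [toLex_inj.1 e, hfh ξ hξ]
  simp only [Pi.toLex_apply] at hi hi' hj hj'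
  intro ξ hξ
  rcases lt_trichotomy i j with hij | rfl | hij
  · have := hj i hij
    by_cases hd : i < δ
    · have := hfh i hd
      omega
    · exact (hi ξ (by order)).symm
  · by_cases hd : i < δ
    · have := hfh i hd
      omega
    · exact (hi ξ (by order)).symm
  · have := hi j hij
    by_cases hd : j < δ
    · have := hfh j hd
      omega
    · rw [hj ξ (by order), hfh ξ hξ]

theorem nonempty_of_not_countable {V : Type*} {S : Set V} (hS : ¬ S.Countable) : S.Nonempty := by
  rw [Set.nonempty_iff_ne_empty]
  rintro rfl
  exact hS Set.countable_empty

theorem exists_three_of_infinite {V X : Type*} [LinearOrder X] {x : V → X}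
    (hx : Function.Injective x) {S : Set V} (hS : S.Infinite) :
    ∃ a ∈ S, ∃ b ∈ S, ∃ c ∈ S, x a < x b ∧ x b < x c := by
  obtain ⟨t, hts, ht⟩ := (hS.image hx.injOn).exists_subset_card_eq 3
  have hmem (i : Fin 3) : ∃ a ∈ S, x a = t.orderEmbOfFin ht i :=
    hts (t.orderEmbOfFin_mem ht i)
  obtain ⟨a, ha, ha'⟩ := hmem 0
  obtain ⟨b, hb, hb'⟩ := hmem 1
  obtain ⟨c, hc, hc'⟩ := hmem 2
  refine ⟨a, ha, b, hb, c, hc, ?_, ?_⟩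
  · rw [ha', hb', OrderEmbedding.lt_iff_lt]
    decide
  · rw [hb', hc', OrderEmbedding.lt_iff_lt]
    decide

variable {V : Type*} [LinearOrder V]

theorem countable_Iic (hV : ∀ a : V, (Set.Iio a).Countable) (a : V) : (Set.Iic a).Countable := by
  rw [← Set.Iio_insert]
  exact (hV a).insert a

theorem not_countable_inter_Ioi (hV : ∀ a : V, (Set.Iio a).Countable) {S : Set V}
    (hS : ¬ S.Countable) (δ : V) : ¬ (S ∩ Set.Ioi δ).Countable := fun h =>
  hS ((h.union (countable_Iic hV δ)).mono fun s hs => by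
    rcases lt_or_ge δ s with h | h
    · exact .inl ⟨hs, h⟩
    · exact .inr h)

theorem exists_mem_gt (hV : ∀ a : V, (Set.Iio a).Countable) {S : Set V}
    (hS : ¬ S.Countable) (δ : V) : ∃ s ∈ S, δ < s :=
  nonempty_of_not_countable (not_countable_inter_Ioi hV hS δ)

theorem exists_bound [Uncountable V] (hV : ∀ a : V, (Set.Iio a).Countable) {N : Set V}
    (hN : N.Countable) : ∃ δ, ∀ ξ ∈ N, ξ < δ := by
  by_contra! h
  refine Set.not_countable_univ (α := V) ((hN.biUnion fun ξ _ => countable_Iic hV ξ).mono ?_)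
  intro δ _
  obtain ⟨ξ, hξ, h⟩ := h δ
  exact Set.mem_biUnion hξ h

/-- If every element of an uncountable set has a countable side with respect to `r`, then
`r` follows the given order, or its reverse, on an uncountable subset. -/
theorem exists_uncountable_compatible (hV : ∀ a : V, (Set.Iio a).Countable) (r : V → V → Prop)
    {S : Set V} (hS : ¬ S.Countable)
    (hr : ∀ a ∈ S, {s ∈ S | r a s}.Countable ∨ {s ∈ S | r s a}.Countable) :
    ∃ S' ⊆ S, ¬ S'.Countable ∧
      ((∀ a ∈ S', ∀ b ∈ S', a < b → ¬ r b a) ∨ (∀ a ∈ S', ∀ b ∈ S', a < b → ¬ r a b)) := by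
  have key (r : V → V → Prop) (S₁ : Set V) (hS₁ : ¬ S₁.Countable)
      (h : ∀ a ∈ S₁, {s ∈ S₁ | r s a}.Countable) :
      ∃ S' ⊆ S₁, ¬ S'.Countable ∧ ∀ a ∈ S', ∀ b ∈ S', a < b → ¬ r b a := by
    obtain ⟨M, hM⟩ := zorn_subset {M | M ⊆ S₁ ∧ ∀ a ∈ M, ∀ b ∈ M, a < b → ¬ r b a} (by
      intro c hc hchain
      refine ⟨⋃₀ c, ⟨Set.sUnion_subset fun s hs => (hc hs).1, ?_⟩,
        fun s hs => Set.subset_sUnion_of_mem hs⟩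
      rintro a ⟨s, hs, has⟩ b ⟨t, ht, hbt⟩
      rcases hchain.total hs ht with hst | hst
      · exact (hc ht).2 a (hst has) b hbt
      · exact (hc hs).2 a has b (hst hbt))
    refine ⟨M, hM.prop.1, fun hc => hS₁ ?_, hM.prop.2⟩
    refine (hc.biUnion fun a ha =>
      (h a (hM.prop.1 ha)).union (countable_Iic hV a)).mono fun s hs => ?_
    by_contra hcon
    simp only [Set.mem_iUnion, Set.mem_union, Set.mem_ofPred_eq, Set.mem_Iic, not_exists,
      not_or, not_and, not_le] at hcon
    have hins : insert s M ∈ {M | M ⊆ S₁ ∧ ∀ a ∈ M, ∀ b ∈ M, a < b → ¬ r b a} := by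
      refine ⟨Set.insert_subset hs hM.prop.1, ?_⟩
      rintro a (rfl | ha) b (rfl | hb) hab
      · exact absurd hab (lt_irrefl _)
      · exact absurd hab (hcon b hb).2.not_gt
      · exact (hcon a ha).1 hs
      · exact hM.prop.2 a ha b hb hab
    exact lt_irrefl _ (hcon s (hM.le_of_ge hins (Set.subset_insert s M) (Set.mem_insert s M))).2
  by_cases h : {a ∈ S | {s ∈ S | r s a}.Countable}.Countable
  · obtain ⟨S', hS', hu, hcomp⟩ := key (fun a b => r b a) {a ∈ S | {s ∈ S | r a s}.Countable}
      (fun h' => hS ((h.union h').mono fun a ha => by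
        rcases hr a ha with h | h
        · exact .inr ⟨ha, h⟩
        · exact .inl ⟨ha, h⟩))
      (fun a ha => Set.Countable.mono (s₂ := {s ∈ S | r a s})
        (fun s hs => ⟨hs.1.1, hs.2⟩) ha.2)
    exact ⟨S', hS'.trans (Set.sep_subset _ _), hu, .inr hcomp⟩
  · obtain ⟨S', hS', hu, hcomp⟩ := key r _ h
      (fun a ha => Set.Countable.mono (s₂ := {s ∈ S | r s a})
        (fun s hs => ⟨hs.1.1, hs.2⟩) ha.2)
    exact ⟨S', hS'.trans (Set.sep_subset _ _), hu, .inl hcomp⟩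

/-- `g` is *short* if the order it induces contains no uncountable well-ordered or reversely
well-ordered subset, as witnessed by the ambient order. -/
def Short {X : Type*} [LinearOrder X] (g : V → X) : Prop :=
  ∀ S : Set V, ¬ S.Countable → ¬ StrictMonoOn g S ∧ ¬ StrictAntiOn g S

theorem Short.exists_cut (hV : ∀ a : V, (Set.Iio a).Countable) {X : Type*} [LinearOrder X]
    {g : V → X} (hg : Short g) (hinj : Function.Injective g) {S : Set V} (hS : ¬ S.Countable) :
    ∃ a ∈ S, ¬ {s ∈ S | g a < g s}.Countable ∧ ¬ {s ∈ S | g s < g a}.Countable := by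
  by_contra! hcon
  obtain ⟨S', -, hu, h | h⟩ := exists_uncountable_compatible hV (fun a b => g a < g b) hS
    (fun a ha => or_iff_not_imp_left.2 (hcon a ha))
  · exact (hg S' hu).1 fun a ha b hb hab =>
      (not_lt.1 (h a ha b hb hab)).lt_of_ne (hinj.ne hab.ne)
  · exact (hg S' hu).2 fun a ha b hb hab =>
      (not_lt.1 (h a ha b hb hab)).lt_of_ne (hinj.ne hab.ne')

theorem Short.exists_separated (hV : ∀ a : V, (Set.Iio a).Countable) {X : Type*} [LinearOrder X]
    {g : V → X} (hg : Short g) (hinj : Function.Injective g) {P Q : Set V}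
    (hP : ¬ P.Countable) (hQ : ¬ Q.Countable) :
    ∃ P' ⊆ P, ∃ Q' ⊆ Q, ¬ P'.Countable ∧ ¬ Q'.Countable ∧
      ((∀ p ∈ P', ∀ q ∈ Q', g p < g q) ∨ (∀ p ∈ P', ∀ q ∈ Q', g q < g p)) := by
  obtain ⟨a, -, hgt, hlt⟩ := hg.exists_cut hV hinj hP
  by_cases h : {s ∈ Q | g a < g s}.Countable
  · refine ⟨_, Set.sep_subset _ _, {s ∈ Q | g s < g a}, Set.sep_subset _ _, hgt, fun h' => ?_,
      .inr fun p hp q hq => hq.2.trans hp.2⟩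
    refine hQ (((h.union h').insert a).mono fun s hs => ?_)
    rcases lt_trichotomy (g s) (g a) with h | h | h
    · exact .inr (.inr ⟨hs, h⟩)
    · exact .inl (hinj h)
    · exact .inr (.inl ⟨hs, h⟩)
  · exact ⟨_, Set.sep_subset _ _, _, Set.sep_subset _ _, hlt, h,
      .inl fun p hp q hq => hp.2.trans hq.2⟩

/-- The tournament obtained by multiplying the signs of three linear orders. -/
def signTournament {X Y : Type*} [LinearOrder X] [LinearOrder Y] (x : V → X) (y : V → Y)
    (a b : V) : Prop :=
  a ≠ b ∧ (a < b ↔ (x a < x b ↔ y a < y b))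

theorem signTournament_iff_not {X Y : Type*} [LinearOrder X] [LinearOrder Y] {x : V → X}
    {y : V → Y} (hx : Function.Injective x) (hy : Function.Injective y) {a b : V} (hab : a ≠ b) :
    signTournament x y a b ↔ ¬ signTournament x y b a := by
  have h₁ : b < a ↔ ¬ a < b := by rw [not_lt, hab.symm.le_iff_lt]
  have h₂ : x b < x a ↔ ¬ x a < x b := by rw [not_lt, (hx.ne hab).symm.le_iff_lt]
  have h₃ : y b < y a ↔ ¬ y a < y b := by rw [not_lt, (hy.ne hab).symm.le_iff_lt]
  simp only [signTournament, h₁, h₂, h₃, ne_eq, hab, hab.symm, not_false_eq_true, true_and]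
  tauto

theorem countable_of_transitive_signTournament (hV : ∀ a : V, (Set.Iio a).Countable)
    {X Y : Type*} [LinearOrder X] [LinearOrder Y] {x : V → X} {y : V → Y}
    (hx : Function.Injective x) (hy : Function.Injective y) (hxs : Short x) (hys : Short y)
    (hmono : ∀ S : Set V, ¬ S.Countable →
      ¬ (∀ a ∈ S, ∀ b ∈ S, x a < x b → y a < y b) ∧
      ¬ (∀ a ∈ S, ∀ b ∈ S, x a < x b → y b < y a))
    (S : Set V) (hS : ∀ a ∈ S, ∀ b ∈ S, ∀ c ∈ S, signTournament x y a b →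
      signTournament x y b c → signTournament x y a c) : S.Countable := by
  by_contra hu
  by_cases hcut : ∀ a ∈ S, {s ∈ S | signTournament x y a s}.Countable ∨
      {s ∈ S | signTournament x y s a}.Countable
  · obtain ⟨S', -, hu', h | h⟩ := exists_uncountable_compatible hV _ hu hcut
    · refine (hmono S' hu').1 fun a ha b hb hab => ?_
      have hne : a ≠ b := fun e => hab.ne (congrArg x e)
      rcases hne.lt_or_gt with hlt | hlt
      · exact (((signTournament_iff_not hx hy hne).2 (h a ha b hb hlt)).2.1 hlt).1 hab
      · have := ((signTournament_iff_not hx hy hne.symm).2 (h b hb a ha hlt)).2.1 hlt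
        have h' : ¬ y b < y a := fun h'' => hab.not_gt (this.2 h'')
        exact (not_lt.1 h').lt_of_ne (hy.ne hne)
    · refine (hmono S' hu').2 fun a ha b hb hab => ?_
      have hne : a ≠ b := fun e => hab.ne (congrArg x e)
      rcases hne.lt_or_gt with hlt | hlt
      · have := h a ha b hb hlt
        have h' : ¬ y a < y b := fun h'' => this ⟨hne, by simp [hlt, hab, h'']⟩
        exact (not_lt.1 h').lt_of_ne (hy.ne hne.symm)
      · have := h b hb a ha hlt
        by_contra h'
        exact this ⟨hne.symm, by simp [hlt, hab.not_gt, h']⟩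
  · push Not at hcut
    obtain ⟨a, ha, hP, hQ⟩ := hcut
    obtain ⟨P, hP', Q, hQ', hPu, hQu, hx'⟩ := hxs.exists_separated hV hx hP hQ
    obtain ⟨P', hP'', Q', hQ'', hPu', hQu', hy'⟩ := hys.exists_separated hV hy hPu hQu
    have hr : ∀ q ∈ Q', ∀ p ∈ P', signTournament x y q p := fun q hq p hp =>
      hS q (hQ' (hQ'' hq)).1 a ha p (hP' (hP'' hp)).1 (hQ' (hQ'' hq)).2 (hP' (hP'' hp)).2
    obtain ⟨p, hp⟩ := nonempty_of_not_countable hPu'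
    obtain ⟨q, hq, hpq⟩ := exists_mem_gt hV hQu' p
    obtain ⟨p', hp', hqp'⟩ := exists_mem_gt hV hPu' q
    have h₁ := (hr q hq p hp).2
    have h₂ := (hr q hq p' hp').2
    simp only [hpq.not_gt, hqp', true_iff, false_iff] at h₁ h₂
    have hxpq : x q < x p ↔ x q < x p' := by
      rcases hx' with h | h
      · simp [(h p (hP'' hp) q (hQ'' hq)).not_gt, (h p' (hP'' hp') q (hQ'' hq)).not_gt]
      · simp [h p (hP'' hp) q (hQ'' hq), h p' (hP'' hp') q (hQ'' hq)]
    have hypq : y q < y p ↔ y q < y p' := by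
      rcases hy' with h | h
      · simp [(h p hp q hq).not_gt, (h p' hp' q hq).not_gt]
      · simp [h p hp q hq, h p' hp' q hq]
    rw [hxpq, hypq] at h₁
    exact h₁ h₂

theorem exists_bound_dense [Uncountable V] (hV : ∀ a : V, (Set.Iio a).Countable) (x : V → ℝ)
    (S : Set V) : ∃ δ, ∀ a ∈ S, ∀ b ∈ S, ∀ c ∈ S, x a < x b → x b < x c →
      ∃ d ∈ S, d < δ ∧ x a < x d ∧ x d < x c := by
  obtain ⟨t, hts, htc, hst⟩ := (TopologicalSpace.IsSeparable.of_separableSpace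
    (x '' S)).exists_countable_dense_subset
  obtain ⟨D, hDS, hDc, rfl⟩ : ∃ D ⊆ S, D.Countable ∧ x '' D = t := by
    obtain ⟨D, hD, hbij⟩ := Set.SurjOn.exists_bijOn_subset (f := x) (s := S) (t := t) hts
    exact ⟨D, hD, Set.MapsTo.countable_of_injOn hbij.mapsTo hbij.injOn htc, hbij.image_eq⟩
  obtain ⟨δ, hδ⟩ := exists_bound hV hDc
  refine ⟨δ, fun a _ b hb c _ hab hbc => ?_⟩
  obtain ⟨_, h, d, hd, rfl⟩ := mem_closure_iff.1 (hst (Set.mem_image_of_mem x hb))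
    (Set.Ioo (x a) (x c)) isOpen_Ioo ⟨hab, hbc⟩
  exact ⟨d, hDS hd, hδ d hd, h.1, h.2⟩

theorem short_real [Uncountable V] (hV : ∀ a : V, (Set.Iio a).Countable) {x : V → ℝ}
    (hx : Function.Injective x) : Short x := by
  intro S hS
  obtain ⟨δ, hδ⟩ := exists_bound_dense hV x S
  obtain ⟨a, ha, b, hb, c, hc, hab, hbc⟩ := exists_three_of_infinite hx
    (fun h => not_countable_inter_Ioi hV hS δ h.countable)
  obtain ⟨d, hd, hdδ, had, hdc⟩ := hδ a ha.1 b hb.1 c hc.1 hab hbc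
  exact ⟨fun h => (h hd ha.1 (hdδ.trans ha.2)).not_gt had,
    fun h => (h hd hc.1 (hdδ.trans hc.2)).not_gt hdc⟩

/-- A coherent sequence of finite-to-one functions on proper initial segments. -/
theorem exists_coherent [WellFoundedLT V] (hV : ∀ a : V, (Set.Iio a).Countable) :
    ∃ e : V → V → ℕ, (∀ α k, {ξ | ξ < α ∧ e α ξ ≤ k}.Finite) ∧
      ∀ α, ∀ β < α, {ξ | ξ < β ∧ e α ξ ≠ e β ξ}.Finite := by
  have hi (α : V) : ∃ i : V → ℕ, Set.InjOn i (Set.Iio α) := Set.countable_iff_exists_injOn.1 (hV α)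
  choose i hi using hi
  have hn (α ξ : V) (h : ξ < α) : ∃ a, ξ ≤ a ∧ a < α ∧ ∀ b, ξ ≤ b → b < α → i α a ≤ i α b := by
    have hne : (Set.Ico ξ α).Nonempty := ⟨ξ, le_rfl, h⟩
    refine ⟨Function.argminOn (i α) _ hne, (Function.argminOn_mem (i α) _ hne).1,
      (Function.argminOn_mem (i α) _ hne).2, fun b hb hb' => ?_⟩
    exact Function.argminOn_le (i α) (Set.Ico ξ α)
      (show b ∈ Set.Ico ξ α from ⟨hb, hb'⟩)
  choose! n hn₁ hn₂ hn₃ using hn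
  classical
  let e : V → V → ℕ := WellFoundedLT.fix (motive := fun _ => V → ℕ) fun α ih ξ =>
    if h : ξ < α then max (ih (n α ξ) (hn₂ α ξ h) ξ) (i α (n α ξ)) else 0
  have he (α ξ : V) (h : ξ < α) : e α ξ = max (e (n α ξ) ξ) (i α (n α ξ)) := by
    simp only [e]
    rw [WellFoundedLT.fix_eq]
    simp [h]
  have hfin (α : V) (k : ℕ) : {a | a < α ∧ i α a ≤ k}.Finite :=
    Set.Finite.of_injOn (f := i α) (t := Set.Iic k) (fun a ha => ha.2)
      (fun a ha b hb h => hi α ha.1 hb.1 h) (Set.finite_Iic k)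
  have hfto : ∀ α k, {ξ | ξ < α ∧ e α ξ ≤ k}.Finite := by
    intro α
    induction α using WellFoundedLT.induction with
    | ind α ih =>
      intro k
      refine ((hfin α k).biUnion fun a ha => (ih a ha.1 k).insert a).subset ?_
      rintro ξ ⟨hξ, hk⟩
      rw [he α ξ hξ, max_le_iff] at hk
      refine Set.mem_biUnion (x := n α ξ) ⟨hn₂ α ξ hξ, hk.2⟩ ?_
      rcases (hn₁ α ξ hξ).eq_or_lt with h | h
      · exact .inl h
      · exact .inr ⟨h, hk.1⟩
  refine ⟨e, hfto, fun α => ?_⟩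
  induction α using WellFoundedLT.induction with
  | ind α ih =>
    intro β hβ
    have hcoh (a : V) (ha : a < α) : {ξ | ξ < a ∧ ξ < β ∧ e a ξ ≠ e β ξ}.Finite := by
      rcases lt_trichotomy a β with h | rfl | h
      · exact (ih β hβ a h).subset fun ξ hξ => ⟨hξ.1, hξ.2.2.symm⟩
      · simp
      · exact (ih a ha β h).subset fun ξ hξ => hξ.2
    refine ((hfin α (i α β)).biUnion fun a ha =>
      ((hcoh a ha.1).union (hfto a (i α a))).insert a).subset ?_
    rintro ξ ⟨hξ, hne⟩
    have hξα := hξ.trans hβ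
    refine Set.mem_biUnion (x := n α ξ) ⟨hn₂ α ξ hξα, hn₃ α ξ hξα β hξ.le hβ⟩ ?_
    rcases (hn₁ α ξ hξα).eq_or_lt with h | h
    · exact .inl h
    · rw [he α ξ hξα] at hne
      by_cases hle : e (n α ξ) ξ ≤ i α (n α ξ)
      · exact .inr (.inr ⟨h, hle⟩)
      · rw [max_eq_left (not_le.1 hle).le] at hne
        exact .inr (.inl ⟨h, hξ, hne⟩)

/-- A family of functions coding an Aronszajn line via its lexicographic order. -/
structure IsAronszajnFamily (F : V → V → ℕ) : Prop where
  finite_fiber : ∀ α k, {ξ | ξ < α ∧ F α ξ = k}.Finite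
  eq_zero_iff : ∀ α ξ, F α ξ = 0 ↔ α ≤ ξ
  exists_fiber : ∀ δ, ∀ S : Set V, ¬ S.Countable →
    ∃ S' ⊆ S, ¬ S'.Countable ∧ (∀ a ∈ S', δ < a) ∧
      ∀ a ∈ S', ∀ b ∈ S', ∀ ξ < δ, F a ξ = F b ξ

theorem exists_isAronszajnFamily [WellFoundedLT V] (hV : ∀ a : V, (Set.Iio a).Countable) :
    ∃ F : V → V → ℕ, IsAronszajnFamily F := by
  classical
  obtain ⟨e, hfto, hcoh⟩ := exists_coherent hV
  refine ⟨fun α ξ => if ξ < α then e α ξ + 1 else 0, ?_, ?_, ?_⟩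
  · rintro α k
    refine (hfto α k).subset ?_
    rintro ξ ⟨h, h'⟩
    simp only [h, if_true] at h'
    exact ⟨h, by omega⟩
  · intro α ξ
    simp
  · intro δ S hS
    have : Countable (Set.Iio δ) := (hV δ).to_subtype
    have hu := not_countable_inter_Ioi hV hS δ
    let c : V → Set (V × ℕ) := fun α => (fun ξ => (ξ, e α ξ)) '' {ξ | ξ < δ ∧ e α ξ ≠ e δ ξ}
    have hc : (c '' (S ∩ Set.Ioi δ)).Countable := by
      refine (Set.countable_ofPred_finite_subset
        ((hV δ).prod (Set.countable_univ (α := ℕ)))).mono ?_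
      rintro _ ⟨α, hα, rfl⟩
      refine ⟨(hcoh α δ hα.2).image _, ?_⟩
      rintro _ ⟨ξ, hξ, rfl⟩
      exact ⟨hξ.1, trivial⟩
    obtain ⟨v, hv⟩ : ∃ v, ¬ {α ∈ S ∩ Set.Ioi δ | c α = v}.Countable := by
      by_contra! hcon
      refine hu ((hc.biUnion fun v _ => hcon v).mono fun α hα => ?_)
      exact Set.mem_biUnion (Set.mem_image_of_mem c hα) ⟨hα, rfl⟩
    refine ⟨_, fun a ha => ha.1.1, hv, fun a ha => ha.1.2, ?_⟩
    rintro a ⟨ha, hav⟩ b ⟨hb, hbv⟩ ξ hξ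
    have key : ∀ a b, c a = c b → e a ξ ≠ e δ ξ → e a ξ = e b ξ := by
      intro a b hab hne
      have : (ξ, e a ξ) ∈ c b := hab ▸ Set.mem_image_of_mem _ ⟨hξ, hne⟩
      obtain ⟨η, -, h⟩ := this
      simp only [Prod.mk.injEq] at h
      obtain ⟨rfl, h⟩ := h
      exact h.symm
    have hab : e a ξ = e b ξ := by
      by_cases h : e a ξ = e δ ξ
      · by_cases h' : e b ξ = e δ ξ
        · rw [h, h']
        · exact (key b a (hbv.trans hav.symm) h').symm
      · exact key a b (hav.trans hbv.symm) h
    simp [hab, hξ.trans ha.2, hξ.trans hb.2]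

variable {F : V → V → ℕ}

theorem IsAronszajnFamily.injective (hF : IsAronszajnFamily F) :
    Function.Injective fun a => toLex (F a) := by
  intro a b h
  have h : F a = F b := toLex_inj.1 h
  refine le_antisymm ((hF.eq_zero_iff a b).1 ?_) ((hF.eq_zero_iff b a).1 ?_)
  · rw [h, hF.eq_zero_iff]
  · rw [← h, hF.eq_zero_iff]

theorem IsAronszajnFamily.not_eventually_constant [Uncountable V]
    (hV : ∀ a : V, (Set.Iio a).Countable) (hF : IsAronszajnFamily F) {S : Set V}
    (hS : ¬ S.Countable) :
    ¬ ∀ δ, ∃ a, ∀ c ∈ S, a ≤ c → ∀ ξ < δ, F c ξ = F a ξ := by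
  intro h
  choose a ha using h
  have hs (ξ : V) : ∃ δ, ξ < δ :=
    (exists_bound hV (Set.countable_singleton ξ)).imp fun _ h => h ξ rfl
  choose s hs using hs
  obtain ⟨k, hk⟩ : ∃ k, ¬ {ξ | F (a (s ξ)) ξ = k}.Countable := by
    by_contra! hcon
    exact Set.not_countable_univ (α := V)
      ((Set.countable_iUnion hcon).mono fun ξ _ => by simp)
  obtain ⟨N, hN, hNinf, hNc⟩ : ∃ N ⊆ {ξ | F (a (s ξ)) ξ = k}, N.Infinite ∧ N.Countable := by
    have hinf : {ξ | F (a (s ξ)) ξ = k}.Infinite := fun h => hk h.countable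
    have := hinf.to_subtype
    let f := Infinite.natEmbedding {ξ | F (a (s ξ)) ξ = k}
    refine ⟨Set.range fun m => (f m : V), ?_, ?_, Set.countable_range _⟩
    · rintro _ ⟨m, rfl⟩
      exact (f m).2
    · exact Set.infinite_range_of_injective (Subtype.val_injective.comp f.injective)
  obtain ⟨δ, hδ⟩ := exists_bound hV (hNc.union (hNc.image fun ξ => a (s ξ)))
  obtain ⟨c, hc, hδc⟩ := exists_mem_gt hV hS δ
  refine hNinf ((hF.finite_fiber c k).subset fun ξ hξ => ⟨(hδ ξ (.inl hξ)).trans hδc, ?_⟩)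
  rw [ha (s ξ) c hc ((hδ _ (.inr ⟨ξ, hξ, rfl⟩)).trans hδc).le ξ (hs ξ)]
  exact hN hξ

theorem IsAronszajnFamily.short [WellFoundedLT V] [Uncountable V] (hV : ∀ a : V, (Set.Iio a).Countable)
    (hF : IsAronszajnFamily F) : Short fun a => toLex (F a) := by
  intro S hS
  constructor <;> intro h <;> refine hF.not_eventually_constant hV hS fun δ => ?_
  all_goals
    obtain ⟨S', hS', hu, -, heq⟩ := hF.exists_fiber δ S hS
    obtain ⟨a, ha⟩ := nonempty_of_not_countable hu
    refine ⟨a, fun c hc hac => ?_⟩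
    obtain ⟨b, hb, hcb⟩ := exists_mem_gt hV hu c
  · exact lex_eq_below_of_le_of_le (h.monotoneOn (hS' ha) hc hac)
      (h.monotoneOn hc (hS' hb) hcb.le) (heq a ha b hb)
  · intro ξ hξ
    rw [lex_eq_below_of_le_of_le (h.antitoneOn hc (hS' hb) hcb.le)
      (h.antitoneOn (hS' ha) hc hac) (heq b hb a ha) ξ hξ, heq b hb a ha ξ hξ]

theorem IsAronszajnFamily.not_monotone_real [Uncountable V]
    (hV : ∀ a : V, (Set.Iio a).Countable) (hF : IsAronszajnFamily F) {x : V → ℝ}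
    (hx : Function.Injective x) (S : Set V) (hS : ¬ S.Countable) :
    ¬ (∀ a ∈ S, ∀ b ∈ S, x a < x b → toLex (F a) < toLex (F b)) ∧
    ¬ (∀ a ∈ S, ∀ b ∈ S, x a < x b → toLex (F b) < toLex (F a)) := by
  obtain ⟨δ, hδ⟩ := exists_bound_dense hV x S
  obtain ⟨S', hS', hu, hlt, heq⟩ := hF.exists_fiber δ S hS
  obtain ⟨a, ha, b, hb, c, hc, hab, hbc⟩ :=
    exists_three_of_infinite hx (fun h => hu h.countable)
  obtain ⟨d, hd, hdδ, had, hdc⟩ := hδ a (hS' ha) b (hS' hb) c (hS' hc) hab hbc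
  have hzero : F d d = 0 := (hF.eq_zero_iff d d).2 le_rfl
  have hpos (s : V) (hs : s ∈ S') : F d d ≠ F s d := fun h =>
    (hdδ.trans (hlt s hs)).not_ge ((hF.eq_zero_iff s d).1 (h ▸ hzero))
  constructor <;> intro h
  · exact hpos a ha (lex_eq_below_of_le_of_le (h a (hS' ha) d hd had).le
      (h d hd c (hS' hc) hdc).le (heq a ha c hc) d hdδ)
  · exact hpos c hc (lex_eq_below_of_le_of_le (h d hd c (hS' hc) hdc).le
      (h a (hS' ha) d hd had).le (heq c hc a ha) d hdδ)

end GalvinShelah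

open GalvinShelah in
/-- Galvin–Shelah: there is a tournament of cardinality `ℵ₁` with no uncountable
transitive subtournament. -/
theorem stmt_5 :
    ∃ (V : Type) (r : V → V → Prop), #V = Cardinal.aleph 1 ∧
      (∀ x, ¬ r x x) ∧
      (∀ x y : V, x ≠ y → (r x y ↔ ¬ r y x)) ∧
      ∀ S : Set V, (∀ x ∈ S, ∀ y ∈ S, ∀ z ∈ S, r x y → r y z → r x z) →
        S.Countable := by
  let V : Type := (Cardinal.aleph 1).ord.ToType
  have hcard : #V = Cardinal.aleph 1 := mk_ord_toType _
  have hV (a : V) : (Set.Iio a).Countable :=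
    by
    rw [← Cardinal.le_aleph0_iff_set_countable, ← Cardinal.lt_aleph_one_iff]
    exact (mk_Iio_lt a (by simp [V])).trans_eq hcard
  have : Uncountable V := by
    rw [← Cardinal.aleph0_lt_mk_iff, hcard]
    exact Cardinal.aleph0_lt_aleph_one
  obtain ⟨⟨x, hx⟩⟩ : Nonempty (V ↪ ℝ) := by
    rw [← Cardinal.le_def, hcard, Cardinal.mk_real]
    exact Cardinal.aleph_one_le_continuum
  obtain ⟨F, hF⟩ := exists_isAronszajnFamily hV
  exact ⟨V, signTournament x fun a => toLex (F a), hcard, fun a h => h.1 rfl,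
    fun a b hab => signTournament_iff_not hx hF.injective hab,
    countable_of_transitive_signTournament hV hx hF.injective (short_real hV hx) (hF.short hV)
      (hF.not_monotone_real hV hx)⟩
end

section
/- Assume 2^{ℵ₀} < 2^{ℵ₁}. Then for each function F : (2^{<ω₁}) → 2 there exists g : ω₁ → 2 such that for every f : ω₁ → 2, the set {α < ω₁ : F(f ↾ α) = g(α)} is stationary in ω₁. -/
open Cardinal Ordinal Set

/-- The first uncountable ordinal. -/
noncomputable def omegaOne : Ordinal := (Cardinal.aleph 1).ord

/-- `C` is a closed unbounded subset of `ω₁`. -/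
def IsClubBelowOmega1 (C : Set Ordinal) : Prop :=
  (∀ α < omegaOne, ∃ β ∈ C, α < β ∧ β < omegaOne) ∧
  (∀ α, α < omegaOne → (C ∩ Set.Iio α).Nonempty →
    sSup (C ∩ Set.Iio α) = α → α ∈ C)

/-- `S` is a stationary subset of `ω₁`. -/
def IsStationaryBelowOmega1 (S : Set Ordinal) : Prop :=
  ∀ C, IsClubBelowOmega1 C → (S ∩ C ∩ Set.Iio omegaOne).Nonempty

namespace WeakDiamond

universe u v

variable {W : Type u} [LinearOrder W]

/-- If `W` has at most continuum many elements and countable initial segments, then pairs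
`(a, p ↾ a)` with `a : W` and `p : ℕ → W → Bool` can be coded by reals. -/
theorem exists_code (hI : ∀ a : W, (Iio a).Countable) (hc : #W ≤ 𝔠) :
    ∃ code : W → (ℕ → W → Bool) → ℕ → Bool, ∀ a b p q, code a p = code b q →
      a = b ∧ ∀ k, ∀ c < a, p k c = q k c := by
  obtain ⟨i⟩ : Nonempty (W ↪ (ℕ → Bool)) := by
    rw [← Cardinal.lift_mk_le']
    simpa using hc
  have he : ∀ a : W, ∃ e : W → ℕ, InjOn e (Iio a) := fun a ↦
    (countable_iff_exists_injOn).1 (hI a)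
  choose e he using he
  classical
  refine ⟨fun a p m ↦ Sum.elim (i a)
    (fun kj : ℕ × ℕ ↦ decide (∃ c < a, e a c = kj.2 ∧ p kj.1 c = true))
    ((Denumerable.eqv (ℕ ⊕ ℕ × ℕ)).symm m), fun a b p q h ↦ ?_⟩
  have h' (s : ℕ ⊕ ℕ × ℕ) := congrFun h (Denumerable.eqv _ s)
  simp only [Equiv.symm_apply_apply] at h'
  obtain rfl : a = b := i.injective (funext fun m ↦ h' (.inl m))
  refine ⟨rfl, fun k c hca ↦ ?_⟩
  have key (r : ℕ → W → Bool) : (∃ d < a, e a d = e a c ∧ r k d = true) ↔ r k c = true :=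
    ⟨fun ⟨d, hd, hdc, hr⟩ ↦ he a hd hca hdc ▸ hr, fun hr ↦ ⟨c, hca, rfl, hr⟩⟩
  have := h' (.inr (k, e a c))
  simp only [Sum.elim_inr, key] at this
  simpa using this

/-- A tower over `x`: a sequence of countable families `p n` of functions on `W`, the first of which
is constantly `x`, with decreasing closed unbounded sets `C n` such that on `C (n + 1)` the values
of `F` at the odd members of `p (n + 1)` code `p n` up to the next element `next n α` of `C n`. -/
structure IsTower (F : W → (W → Bool) → Bool) (code : W → (ℕ → W → Bool) → ℕ → Bool)
    (x : W → Bool) (p : ℕ → ℕ → W → Bool) (C : ℕ → Set W) (next : ℕ → W → W) : Prop where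
  zero : p 0 0 = x
  isClub : ∀ n, IsClub (C n)
  isLeast : ∀ n a, IsLeast (C n ∩ Ioi a) (next n a)
  anti : Antitone C
  even : ∀ n k, p (n + 1) (2 * k) = p n k
  odd : ∀ n, ∀ a ∈ C (n + 1), ∀ m, F a (p (n + 1) (2 * m + 1)) = code (next n a) (p n) m

/-- If every `g : W → Bool` is guessed on a closed unbounded set, then so is every
`h : W → ℕ → Bool`, by countably many functions simultaneously. -/
theorem exists_guess_seq [WellFoundedLT W] (hW : ℵ₀ < Order.cof W) {F : W → (W → Bool) → Bool}
    (H : ∀ g : W → Bool, ∃ f : W → Bool, ∃ C, IsClub C ∧ ∀ a ∈ C, F a f = g a)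
    (h : W → ℕ → Bool) :
    ∃ f : ℕ → W → Bool, ∃ C, IsClub C ∧ ∀ a ∈ C, ∀ m, F a (f m) = h a m := by
  choose f C hC hf using fun m ↦ H fun a ↦ h a m
  exact ⟨f, ⋂ m, C m, .iInter_of_countable hW.ne' hC, fun a ha m ↦ hf m a (mem_iInter.1 ha m)⟩

theorem exists_isTower [WellFoundedLT W] (hW : ℵ₀ < Order.cof W) {F : W → (W → Bool) → Bool}
    (H : ∀ g : W → Bool, ∃ f : W → Bool, ∃ C, IsClub C ∧ ∀ a ∈ C, F a f = g a)
    (code : W → (ℕ → W → Bool) → ℕ → Bool) (x : W → Bool) :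
    ∃ p C next, IsTower F code x p C next := by
  have : Nonempty W := Order.cof_ne_zero_iff.1 (aleph0_pos.trans hW).ne'
  have : NoTopOrder W := Order.one_lt_cof_iff.1 (one_lt_aleph0.trans hW)
  have : NoMaxOrder W := NoTopOrder.to_noMaxOrder W
  have hnext (C : {C : Set W // IsClub C}) (a : W) : ∃ b, IsLeast (C.1 ∩ Ioi a) b := by
    obtain ⟨b, hb⟩ := exists_gt a
    obtain ⟨c, hc, hbc⟩ := C.2.isCofinal b
    have hne : (C.1 ∩ Ioi a).Nonempty := ⟨c, hc, hb.trans_le hbc⟩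
    exact ⟨_, wellFounded_lt.min_mem _ hne, fun d hd ↦ wellFounded_lt.min_le hd⟩
  choose next hnext using hnext
  have hstep (s : (ℕ → W → Bool) × {C : Set W // IsClub C}) :
      ∃ t : (ℕ → W → Bool) × {C : Set W // IsClub C}, t.2.1 ⊆ s.2.1 ∧
        (∀ k, t.1 (2 * k) = s.1 k) ∧
        ∀ a ∈ t.2.1, ∀ m, F a (t.1 (2 * m + 1)) = code (next s.2 a) s.1 m := by
    obtain ⟨f, C, hC, hf⟩ := exists_guess_seq hW H fun a ↦ code (next s.2 a) s.1
    refine ⟨⟨fun k ↦ if k % 2 = 0 then s.1 (k / 2) else f (k / 2),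
      s.2.1 ∩ C, s.2.2.inter hW.ne' hC⟩, inter_subset_left, fun k ↦ by simp, fun a ha m ↦ ?_⟩
    have h1 : (2 * m + 1) / 2 = m := by omega
    have h2 : (2 * m + 1) % 2 = 1 := by omega
    simpa [h1, h2] using hf a ha.2 m
  choose step hsub heven hodd using hstep
  let s : ℕ → (ℕ → W → Bool) × {C : Set W // IsClub C} :=
    Nat.rec (fun _ ↦ x, ⟨univ, .univ⟩) fun _ ↦ step
  exact ⟨fun n ↦ (s n).1, fun n ↦ (s n).2.1, fun n ↦ next (s n).2, rfl, fun n ↦ (s n).2.2,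
    fun n ↦ hnext _, antitone_nat_of_succ_le fun n ↦ hsub (s n), fun n ↦ heven (s n),
    fun n ↦ hodd (s n)⟩

theorem exists_isLUB [WellFoundedLT W] {s : Set W} (hs : BddAbove s) : ∃ b, IsLUB s b :=
  ⟨_, wellFounded_lt.min_mem _ hs, fun _ hd ↦ wellFounded_lt.min_le hd⟩

namespace IsTower

variable {F : W → (W → Bool) → Bool} {code : W → (ℕ → W → Bool) → ℕ → Bool}
  {x y : W → Bool} {p q : ℕ → ℕ → W → Bool} {C D : ℕ → Set W} {next next' : ℕ → W → W}

theorem exists_eq_of_le (hp : IsTower F code x p C next) (hq : IsTower F code y q D next')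
    {m n : ℕ} (hmn : m ≤ n) {b : W} (h : ∀ k, p n k b = q n k b) (k : ℕ) : p m k b = q m k b := by
  induction n, hmn using Nat.le_induction with
  | base => exact h k
  | succ n _ ih => exact ih fun j ↦ by rw [← hp.even, ← hq.even, h]

theorem next_mono (hp : IsTower F code x p C next) (a : W) : Monotone (next · a) :=
  fun m n hmn ↦ (hp.isLeast m a).2 ⟨hp.anti hmn (hp.isLeast n a).1.1, (hp.isLeast n a).1.2⟩

theorem mem_of_isLUB_next (hp : IsTower F code x p C next) {a b : W}
    (hb : IsLUB (range (next · a)) b) (n : ℕ) : b ∈ C n := by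
  refine (hp.isClub n).isLUB_mem (t := (next · a) '' Ici n) ?_ (nonempty_Ici.image _)
    ⟨fun _ hc ↦ hb.1 (image_subset_range _ _ hc), fun c hc ↦ hb.2 ?_⟩
  · rintro _ ⟨m, hm, rfl⟩
    exact hp.anti hm (hp.isLeast m a).1.1
  · rintro _ ⟨m, rfl⟩
    exact (hp.next_mono a (le_max_left m n)).trans (hc ⟨_, le_max_right m n, rfl⟩)

/-- The common points of two towers below which the towers agree. -/
def agreeSet (p q : ℕ → ℕ → W → Bool) (C D : ℕ → Set W) : Set W :=
  {a | (∀ n, a ∈ C n ∧ a ∈ D n) ∧ ∀ n k, ∀ b < a, p n k b = q n k b}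

variable [WellFoundedLT W]

theorem exists_gt_mem_agreeSet (hW : ℵ₀ < Order.cof W)
    (hcode : ∀ a b p q, code a p = code b q → a = b ∧ ∀ k, ∀ c < a, p k c = q k c)
    (hp : IsTower F code x p C next) (hq : IsTower F code y q D next') {a : W}
    (h : ∀ n, code (next n a) (p n) = code (next' n a) (q n)) :
    ∃ b ∈ agreeSet p q C D, a < b := by
  have hnn : (next · a) = (next' · a) := funext fun n ↦ (hcode _ _ _ _ (h n)).1
  have hbdd : BddAbove (range (next · a)) := by
    refine .of_not_isCofinal fun hg ↦ (Order.cof_le hg).not_gt (hW.trans_le' ?_)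
    rw [le_aleph0_iff_set_countable]
    exact countable_range _
  obtain ⟨b, hb⟩ := exists_isLUB hbdd
  refine ⟨b, ⟨fun n ↦ ⟨hp.mem_of_isLUB_next hb n, hq.mem_of_isLUB_next (hnn ▸ hb) n⟩,
    fun n k c hc ↦ ?_⟩, (hp.isLeast 0 a).1.2.trans_le (hb.1 ⟨0, rfl⟩)⟩
  obtain ⟨_, ⟨m, rfl⟩, hm⟩ := (lt_isLUB_iff hb).1 hc
  refine hp.exists_eq_of_le hq (le_max_left n m) (fun j ↦ ?_) k
  exact (hcode _ _ _ _ (h (max n m))).2 j c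
    (hm.trans_le (hp.next_mono a (le_max_right n m)))

theorem eq_of_code_eq (hW : ℵ₀ < Order.cof W)
    (hF : ∀ a f g, (∀ b < a, f b = g b) → F a f = F a g)
    (hcode : ∀ a b p q, code a p = code b q → a = b ∧ ∀ k, ∀ c < a, p k c = q k c)
    (hp : IsTower F code x p C next) (hq : IsTower F code y q D next') {a : W}
    (h : ∀ n, code (next n a) (p n) = code (next' n a) (q n)) : x = y := by
  obtain ⟨b, hb, -⟩ := exists_gt_mem_agreeSet hW hcode hp hq h
  have hgt : ∀ c ∈ agreeSet p q C D, ∃ d ∈ agreeSet p q C D, c < d := fun c hc ↦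
    exists_gt_mem_agreeSet hW hcode hp hq fun n ↦ funext fun m ↦ by
      rw [← hp.odd n c (hc.1 _).1, ← hq.odd n c (hc.1 _).2]
      exact hF _ _ _ (hc.2 _ _)
  have hunb : ¬ BddAbove (agreeSet p q C D) := by
    intro hbdd
    obtain ⟨s, hs⟩ := exists_isLUB hbdd
    have hsA : s ∈ agreeSet p q C D := by
      refine ⟨fun n ↦ ⟨(hp.isClub n).isLUB_mem (fun c hc ↦ (hc.1 n).1) ⟨b, hb⟩ hs,
        (hq.isClub n).isLUB_mem (fun c hc ↦ (hc.1 n).2) ⟨b, hb⟩ hs⟩, fun n k c hc ↦ ?_⟩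
      obtain ⟨d, hd, hcd⟩ := (lt_isLUB_iff hs).1 hc
      exact hd.2 n k c hcd
    obtain ⟨d, hd, hsd⟩ := hgt s hsA
    exact (hs.1 hd).not_gt hsd
  funext c
  obtain ⟨d, hd, hcd⟩ := not_bddAbove_iff.1 hunb c
  rw [← hp.zero, ← hq.zero]
  exact hd.2 0 0 c hcd

end IsTower

/-- If every `g : W → Bool` is guessed by `F` on a closed unbounded set, then there are at most
continuum many functions `W → Bool`. -/
theorem mk_fun_le_continuum [WellFoundedLT W] (hW : ℵ₀ < Order.cof W)
    (hI : ∀ a : W, (Iio a).Countable) (hc : #W ≤ 𝔠) {F : W → (W → Bool) → Bool}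
    (hF : ∀ a f g, (∀ b < a, f b = g b) → F a f = F a g)
    (H : ∀ g : W → Bool, ∃ f : W → Bool, ∃ C, IsClub C ∧ ∀ a ∈ C, F a f = g a) :
    #(W → Bool) ≤ 𝔠 := by
  obtain ⟨code, hcode⟩ := exists_code hI hc
  choose p C next hT using exists_isTower hW H code
  obtain ⟨a⟩ : Nonempty W := Order.cof_ne_zero_iff.1 (aleph0_pos.trans hW).ne'
  have hinj : Function.Injective fun x n ↦ code (next x n a) (p x n) := fun x y hxy ↦
    (hT x).eq_of_code_eq hW hF hcode (hT y) (congrFun hxy)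
  simpa using lift_mk_le_lift_mk_of_injective hinj

theorem isClub_preimage_val {C : Set Ordinal.{u}} (hC : IsClubBelowOmega1 C) :
    IsClub (Subtype.val ⁻¹' C : Set (Iio omegaOne.{u})) := by
  refine ⟨fun t ht htne _ x hx ↦ ?_, fun a ↦ ?_⟩
  · by_cases hxt : x ∈ t
    · exact ht hxt
    have hlt : ∀ b ∈ t, b < x := fun b hb ↦ (hx.1 hb).lt_of_ne fun h ↦ hxt (h ▸ hb)
    have hbdd : BddAbove (C ∩ Iio x.1) := ⟨x.1, fun b hb ↦ hb.2.le⟩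
    obtain ⟨b, hb⟩ := htne
    refine hC.2 x x.2 ⟨b, ht hb, hlt b hb⟩ (le_antisymm (csSup_le' fun b hb ↦ hb.2.le) ?_)
    by_contra! hs
    have : x ≤ ⟨sSup (C ∩ Iio x.1), hs.trans x.2⟩ :=
      hx.2 fun b hb ↦ le_csSup hbdd ⟨ht hb, hlt b hb⟩
    exact hs.not_ge this
  · obtain ⟨b, hb, hab, hb'⟩ := hC.1 a a.2
    exact ⟨⟨b, hb'⟩, hb, hab.le⟩

theorem two_power_aleph0_lt_transfer (h : (2 : Cardinal.{u}) ^ ℵ₀ < 2 ^ ℵ₁) :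
    (2 : Cardinal.{v}) ^ ℵ₀ < 2 ^ ℵ₁ := by
  rw [← Cardinal.lift_lt.{v, u}]
  simpa using Cardinal.lift_lt.{u, v}.2 h

end WeakDiamond

/-- Devlin–Shelah weak diamond: assume `2^ℵ₀ < 2^ℵ₁`. For every `F` assigning a bit
to each binary sequence of countable ordinal length (here coded as `F α f` depending
only on `f ↾ α`), there is `g : ω₁ → 2` such that for every `f : ω₁ → 2`,
`{α < ω₁ : F (f ↾ α) = g α}` is stationary. -/
theorem stmt_6 (h : (2 : Cardinal) ^ Cardinal.aleph0 < 2 ^ Cardinal.aleph 1)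
    (F : Ordinal → (Ordinal → Bool) → Bool)
    (hF : ∀ α < omegaOne, ∀ f g : Ordinal → Bool, (∀ β < α, f β = g β) → F α f = F α g) :
    ∃ g : Ordinal → Bool, ∀ f : Ordinal → Bool,
      IsStationaryBelowOmega1 {α | α < omegaOne ∧ F α f = g α} := by
  by_contra! hcon
  let ext (f : Iio omegaOne → Bool) (a : Ordinal) : Bool :=
    if ha : a < omegaOne then f ⟨a, ha⟩ else false
  have hmk : #(Iio omegaOne) = ℵ₁ := by simp [omegaOne, Cardinal.mk_Iio_ordinal]
  have hle : #(Iio omegaOne → Bool) ≤ 𝔠 := by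
    refine WeakDiamond.mk_fun_le_continuum (F := fun a f ↦ F a (ext f)) ?_ (fun a ↦ ?_)
      (hmk.trans_le aleph_one_le_continuum) (fun a f g hfg ↦ hF a a.2 _ _ fun b hb ↦ ?_)
      fun g ↦ ?_
    · rw [Ordinal.cof_Iio]
      simp [omegaOne]
    · have hcount : (Iio a.1).Countable := by
        rw [← le_aleph0_iff_set_countable, Cardinal.mk_Iio_ordinal, lift_le_aleph0,
          ← lt_aleph_one_iff]
        exact lt_ord.1 a.2
      exact hcount.preimage Subtype.val_injective
    · simp [ext, hb.trans a.2, hfg ⟨b, hb.trans a.2⟩ hb]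
    · obtain ⟨f, hf⟩ := hcon fun a ↦ !ext g a
      simp only [IsStationaryBelowOmega1, not_forall] at hf
      obtain ⟨C, hC, hne⟩ := hf
      refine ⟨fun a ↦ f a, _, WeakDiamond.isClub_preimage_val hC, fun a ha ↦ ?_⟩
      have h1 : F a (ext fun a ↦ f a) = F a f :=
        hF a a.2 _ _ fun b hb ↦ by simp [ext, hb.trans a.2]
      by_contra h2
      refine hne ⟨a, ⟨⟨a.2, ?_⟩, ha⟩, a.2⟩
      have h3 : ext g a = g a := dif_pos a.2
      rw [h3, ← h1]
      exact Bool.eq_not_of_ne h2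
  rw [mk_arrow, hmk, mk_bool, ← two_power_aleph0] at hle
  simp only [lift_two, Cardinal.lift_aleph, Ordinal.lift_one] at hle
  exact (WeakDiamond.two_power_aleph0_lt_transfer h).not_ge hle
end

section
/- Suppose cf(λ) ≠ cf(μ), F : T_μ → λ, and for every branch b of T_μ, sup{F(η) : η ∈ b} < λ. Then there is a subtree T ≤ T_μ (isomorphic to T_μ) such that sup{F(η) : η ∈ T} < λ. -/
open Cardinal

/-- The tree `T_μ` of finite sequences of ordinals `< μ`, ordered by the
initial-segment (prefix) relation. -/
def Tmu (μ : Cardinal) : Type 1 := {l : List Ordinal // ∀ o ∈ l, o < μ.ord}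

/-- `T` is a subtree of `T_μ`: nonempty and closed under initial segments. -/
def IsSubtree {μ : Cardinal} (T : Set (Tmu μ)) : Prop :=
  T.Nonempty ∧ ∀ η ∈ T, ∀ ν : Tmu μ, ν.val <+: η.val → ν ∈ T

/-- `T ≤ T_μ`: `T` is order-isomorphic (for the prefix order) to the full tree `T_μ`. -/
def IsoToFull {μ : Cardinal} (T : Set (Tmu μ)) : Prop :=
  ∃ e : Tmu μ ≃ T, ∀ a b : Tmu μ,
    (a.val <+: b.val ↔ ((e a) : Tmu μ).val <+: ((e b) : Tmu μ).val)

universe u v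

namespace RubinShelah

variable {α : Type u} {σ : Type v}

/-- A winning strategy in the game above `η` in which the first player forbids fewer than `#α`
immediate successors at each step, the second player moves to a successor which is not
forbidden, and the first player wins as soon as the value of `F` exceeds `β`. -/
def ForcesAbove [LT σ] (F : List α → σ) (β : σ) (η : List α) : Prop :=
  ∃ A : List α → Set α, (∀ l, #(A l) < #α) ∧
    ∀ g : ℕ → α, (∀ m, g m ∉ A ((List.range m).map g)) →
      ∃ m, β < F (η ++ (List.range m).map g)

theorem map_range_succ_eq_cons (g : ℕ → α) (m : ℕ) :
    (List.range (m + 1)).map g = g 0 :: (List.range m).map (fun k => g (k + 1)) := by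
  rw [List.range_succ_eq_map, List.map_cons, List.map_map]
  rfl

theorem map_range_succ_eq_append (g : ℕ → α) (m : ℕ) :
    (List.range (m + 1)).map g = (List.range m).map g ++ [g m] := by
  simp [List.range_succ]

theorem le_of_not_forcesAbove [Nonempty α] [LinearOrder σ] {F : List α → σ} {β : σ} {η : List α}
    (h : ¬ ForcesAbove F β η) : F η ≤ β := by
  by_contra! hlt
  refine h ⟨fun _ => ∅, fun l => ?_, fun g _ => ⟨0, by simpa using hlt⟩⟩
  simpa using Cardinal.mk_ne_zero α |>.bot_lt

theorem mk_le_mk_not_forcesAbove [Nonempty α] [LT σ] {F : List α → σ} {β : σ}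
    {η : List α} (h : ¬ ForcesAbove F β η) :
    #α ≤ #{i // ¬ ForcesAbove F β (η ++ [i])} := by
  classical
  by_contra! hlt
  refine h ?_
  have hch : ∀ i, ∃ A : List α → Set α, (∀ l, #(A l) < #α) ∧
      (ForcesAbove F β (η ++ [i]) → ∀ g : ℕ → α, (∀ m, g m ∉ A ((List.range m).map g)) →
        ∃ m, β < F ((η ++ [i]) ++ (List.range m).map g)) := by
    intro i
    by_cases hi : ForcesAbove F β (η ++ [i])
    · obtain ⟨A, h1, h2⟩ := hi
      exact ⟨A, h1, fun _ => h2⟩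
    · exact ⟨fun _ => ∅, fun l => by simpa using Cardinal.mk_ne_zero α |>.bot_lt,
        fun h => absurd h hi⟩
  choose B hB hBw using hch
  let A : List α → Set α := fun l =>
    match l with
    | [] => {i | ¬ ForcesAbove F β (η ++ [i])}
    | i :: l => B i l
  refine ⟨A, fun l => ?_, fun g hg => ?_⟩
  · cases l with
    | nil => exact hlt
    | cons i l => exact hB i l
  · have h0 : ForcesAbove F β (η ++ [g 0]) := by
      have : g 0 ∉ {i | ¬ ForcesAbove F β (η ++ [i])} := hg 0
      simpa using this
    obtain ⟨m, hm⟩ := hBw (g 0) h0 (fun k => g (k + 1)) (fun m => by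
      have := hg (m + 1)
      rwa [map_range_succ_eq_cons] at this)
    refine ⟨m + 1, ?_⟩
    rw [map_range_succ_eq_cons]
    simpa using hm

/-- The map on finite sequences which relabels the successors of each node by `e`. -/
def relabel (e : List α → α → α) : List α → List α → List α
  | _, [] => []
  | η, i :: l => e η i :: relabel e (η ++ [e η i]) l

theorem relabel_prefix_iff {e : List α → α → α} (he : ∀ η, Function.Injective (e η))
    (η a b : List α) : relabel e η a <+: relabel e η b ↔ a <+: b := by
  induction a generalizing η b with
  | nil => simp [relabel]
  | cons i a ih =>
    cases b with
    | nil => simp [relabel]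
    | cons j b =>
      simp only [relabel, List.cons_prefix_cons, (he η).eq_iff]
      constructor
      · rintro ⟨rfl, h⟩
        exact ⟨rfl, (ih _ _).1 h⟩
      · rintro ⟨rfl, h⟩
        exact ⟨rfl, (ih _ _).2 h⟩

theorem exists_relabel_eq_of_prefix (e : List α → α → α) {η ν a : List α}
    (h : ν <+: relabel e η a) : ∃ b, relabel e η b = ν := by
  induction a generalizing η ν with
  | nil => exact ⟨[], by simpa [relabel, eq_comm] using List.prefix_nil.1 h⟩
  | cons i a ih =>
    cases ν with
    | nil => exact ⟨[], rfl⟩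
    | cons j ν =>
      simp only [relabel, List.cons_prefix_cons] at h
      obtain ⟨rfl, h⟩ := h
      obtain ⟨b, hb⟩ := ih h
      exact ⟨i :: b, by simp [relabel, hb]⟩

theorem relabel_induction {e : List α → α → α} {P : List α → Prop}
    (he : ∀ η, P η → ∀ i, P (η ++ [e η i])) {η : List α} (hη : P η) (a : List α) :
    P (η ++ relabel e η a) := by
  induction a generalizing η with
  | nil => simpa [relabel] using hη
  | cons i a ih => simpa [relabel] using ih (he η hη i)

theorem exists_embedding {P : List α → Prop} (h0 : P [])
    (h : ∀ η, P η → #α ≤ #{i // P (η ++ [i])}) :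
    ∃ φ : List α → List α, (∀ a b, φ a <+: φ b ↔ a <+: b) ∧
      (∀ ν a, ν <+: φ a → ∃ b, φ b = ν) ∧ ∀ a, P (φ a) := by
  have hch : ∀ η, ∃ e : α → α, Function.Injective e ∧ (P η → ∀ i, P (η ++ [e i])) := by
    intro η
    by_cases hη : P η
    · obtain ⟨f⟩ := h η hη
      exact ⟨fun i => f i, Subtype.val_injective.comp f.injective, fun _ i => (f i).2⟩
    · exact ⟨id, Function.injective_id, fun h => absurd h hη⟩
  choose e he heP using hch
  exact ⟨relabel e [], relabel_prefix_iff he [], fun _ _ => exists_relabel_eq_of_prefix e,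
    fun a => relabel_induction heP h0 a⟩

/-- The node reached when the moves offered by `c` are selected by the given list of indices,
the last move first. -/
def nodeOf {I : Type*} (c : List α → I → α) : List I → List α
  | [] => []
  | n :: s => nodeOf c s ++ [c (nodeOf c s) n]

theorem nodeOf_replicate (c : List α → PUnit → α) (m : ℕ) :
    nodeOf c (List.replicate m PUnit.unit) = (List.range m).map
      (fun k => c (nodeOf c (List.replicate k PUnit.unit)) PUnit.unit) := by
  induction m with
  | zero => rfl
  | succ m ih =>
    rw [map_range_succ_eq_append, ← ih]
    rfl

theorem exists_not_forcesAbove {I S : Type*} [LinearOrder σ] (F : List α → σ) (b : S → σ)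
    (avoid : ∀ A : S → Set α, (∀ s, #(A s) < #α) → ∃ c : I → α, ∀ s, ∃ n, c n ∉ A s)
    (bdd : ∀ c : List α → I → α, ∃ s, ∀ l, F (nodeOf c l) ≤ b s) :
    ∃ s, ¬ ForcesAbove F (b s) [] := by
  by_contra! hall
  choose A hA hAw using hall
  choose c n hc using fun l => avoid (fun s => A s l) (fun s => hA s l)
  obtain ⟨s, hs⟩ := bdd c
  let state : ℕ → List I := Nat.rec [] (fun _ l => n (nodeOf c l) s :: l)
  let g : ℕ → α := fun k => c (nodeOf c (state k)) (n (nodeOf c (state k)) s)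
  have hg : ∀ m, nodeOf c (state m) = (List.range m).map g := by
    intro m
    induction m with
    | zero => rfl
    | succ m ih =>
      rw [map_range_succ_eq_append, ← ih]
      rfl
  obtain ⟨m, hm⟩ := hAw s g (fun m => by
    rw [← hg]
    exact hc _ s)
  rw [← hg, List.nil_append] at hm
  exact (hs _).not_gt hm

section Avoid

variable {β S : Type u}

theorem exists_notMem_of_mk_lt_cof [Infinite β] (hS : #S < (#β).ord.cof) (A : S → Set β)
    (hA : ∀ s, #(A s) < #β) : ∃ x, ∀ s, x ∉ A s := by
  by_contra! h
  choose f hf using h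
  obtain ⟨s, hs⟩ := infinite_pigeonhole f (aleph0_le_mk β) hS
  refine (hA s).not_ge (hs ▸ mk_le_mk_of_subset ?_)
  rintro x rfl
  exact hf x

theorem exists_selector_of_mk_lt [Infinite β] (hS : #S < #β) :
    ∃ I : Type u, #I = (#β).ord.cof ∧ ∀ A : S → Set β, (∀ s, #(A s) < #β) →
      ∃ c : I → β, ∀ s, ∃ n, c n ∉ A s := by
  obtain ⟨I, hI, hIc⟩ := Order.exists_cof_eq (#β).ord.ToType
  refine ⟨I, by rw [hIc, Ordinal.cof_toType], fun A hA => ?_⟩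
  let r : I → Cardinal.{u} := fun n => (Ordinal.ToType.toOrd n.1).1.card
  have hr : ∀ n, r n < #β := fun n => lt_ord.1 (Ordinal.ToType.toOrd n.1).2
  have hex : ∀ n : I, ∃ x, ∀ s, #(A s) ≤ r n → x ∉ A s := by
    intro n
    by_contra! h
    have hsub : (Set.univ : Set β) ⊆ ⋃ s : {s // #(A s) ≤ r n}, A s := by
      intro x _
      obtain ⟨s, hs, hx⟩ := h x
      exact Set.mem_iUnion.2 ⟨⟨s, hs⟩, hx⟩
    have h1 : #β ≤ #{s // #(A s) ≤ r n} * ⨆ s : {s // #(A s) ≤ r n}, #(A s) := by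
      rw [← mk_univ]
      exact (mk_le_mk_of_subset hsub).trans (mk_iUnion_le _)
    have h2 : (⨆ s : {s // #(A s) ≤ r n}, #(A s)) ≤ r n := ciSup_le' fun s => s.2
    exact h1.not_gt (mul_lt_of_lt (aleph0_le_mk β) ((mk_subtype_le _).trans_lt hS)
      (h2.trans_lt (hr n)))
  choose c hc using hex
  refine ⟨c, fun s => ?_⟩
  obtain ⟨y, hy, hle⟩ := hI (Ordinal.ToType.mk ⟨(#(A s)).ord, ord_lt_ord.2 (hA s)⟩)
  refine ⟨⟨y, hy⟩, hc _ s ?_⟩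
  have h1 : (⟨(#(A s)).ord, ord_lt_ord.2 (hA s)⟩ : Set.Iio (#β).ord) ≤ Ordinal.ToType.toOrd y := by
    have := Ordinal.ToType.mk.symm.monotone hle
    simpa using this
  exact ord_le.1 h1

end Avoid

theorem exists_forall_le_of_mk_lt_cof {ι : Type u} {σ : Type u} [LinearOrder σ]
    (h : #ι < Order.cof σ) (f : ι → σ) : ∃ β, ∀ i, f i ≤ β := by
  have : ¬ IsCofinal (Set.range f) := fun hc => ((Order.cof_le hc).trans mk_range_le).not_gt h
  obtain ⟨x, hx⟩ := not_isCofinal_iff.1 this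
  exact ⟨x, fun i => (hx _ ⟨i, rfl⟩).le⟩

theorem exists_bounded_embedding {α σ : Type u} [Infinite α] [LinearOrder σ] [WellFoundedLT σ]
    (hcf : Order.cof σ ≠ (#α).ord.cof) (F : List α → σ)
    (hb : ∀ g : ℕ → α, ∃ β, ∀ m, F ((List.range m).map g) ≤ β) :
    ∃ (φ : List α → List α) (β : σ), (∀ a b, φ a <+: φ b ↔ a <+: b) ∧
      (∀ ν a, ν <+: φ a → ∃ b, φ b = ν) ∧ ∀ a, F (φ a) ≤ β := by
  obtain ⟨S, hS, hSc⟩ := Order.exists_cof_eq σ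
  have lift_bdd : ∀ {ι : Type u} (f : ι → σ), (∃ β, ∀ i, f i ≤ β) →
      ∃ s : S, ∀ i, f i ≤ s := by
    rintro ι f ⟨β, hβ⟩
    obtain ⟨s, hs, hle⟩ := hS β
    exact ⟨⟨s, hs⟩, fun i => (hβ i).trans hle⟩
  have small_bdd : ∀ {I : Type u}, ℵ₀ ≤ #I → #I < Order.cof σ → ∀ c : List α → I → α,
      ∃ s : S, ∀ l, F (nodeOf c l) ≤ s := fun hI hlt c =>
    lift_bdd _ (exists_forall_le_of_mk_lt_cof
      ((mk_list_le_max _).trans_lt (by rwa [max_eq_right hI])) _)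
  have key : ∃ s : S, ¬ ForcesAbove F s.1 [] := by
    rcases hcf.lt_or_gt with hlt | hgt
    · refine exists_not_forcesAbove (I := PUnit.{u + 1}) F _ (fun A hA => ?_) (fun c => ?_)
      · obtain ⟨x, hx⟩ := exists_notMem_of_mk_lt_cof (hSc.trans_lt hlt) A hA
        exact ⟨fun _ => x, fun s => ⟨PUnit.unit, hx s⟩⟩
      · refine lift_bdd _ ?_
        obtain ⟨β, hβ⟩ := hb (fun k => c (nodeOf c (List.replicate k PUnit.unit)) PUnit.unit)
        refine ⟨β, fun l => ?_⟩
        rw [List.eq_replicate_of_mem (a := PUnit.unit) (l := l) (fun _ _ => rfl),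
          nodeOf_replicate]
        exact hβ _
    · rcases lt_trichotomy (Order.cof σ) #α with h | h | h
      · obtain ⟨I, hI, havoid⟩ := exists_selector_of_mk_lt (S := S) (β := α) (hSc.trans_lt h)
        refine exists_not_forcesAbove F _ havoid (small_bdd ?_ (hI.trans_lt hgt))
        rw [hI, Ordinal.aleph0_le_cof_iff, Ordinal.one_lt_cof_iff]
        exact isSuccLimit_ord (aleph0_le_mk α)
      · exact absurd (by rw [← h, Order.cof_ord_cof]) hcf
      · refine exists_not_forcesAbove (I := α) F _ (fun A hA => ⟨id, fun s => ?_⟩)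
          (small_bdd (aleph0_le_mk α) h)
        by_contra! hall
        have : A s = Set.univ := Set.eq_univ_of_forall hall
        exact (hA s).ne (by rw [this, mk_univ])
  obtain ⟨s, hs⟩ := key
  obtain ⟨φ, h1, h2, h3⟩ := exists_embedding (P := fun η => ¬ ForcesAbove F s.1 η) hs
    (fun η hη => mk_le_mk_not_forcesAbove hη)
  exact ⟨φ, s, h1, h2, fun a => le_of_not_forcesAbove (h3 a)⟩

/-- Finite sequences of elements of `μ.ord.ToType` are the nodes of `T_μ`. -/
noncomputable def nodeEquiv (μ : Cardinal.{0}) : List μ.ord.ToType ≃ Tmu μ :=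
  Equiv.ofBijective (fun l => ⟨l.map fun a => a.toOrd.1, by
    intro o ho
    obtain ⟨a, -, rfl⟩ := List.mem_map.1 ho
    exact a.toOrd.2⟩) <| by
    refine ⟨fun a b hab => ?_, fun η => ?_⟩
    · exact List.map_injective_iff.2
        (Subtype.val_injective.comp Ordinal.ToType.mk.symm.injective) (congrArg Subtype.val hab)
    · refine ⟨η.1.attach.map fun o => Ordinal.ToType.mk ⟨o.1, η.2 o.1 o.2⟩, Subtype.ext ?_⟩
      simp [Function.comp_def]

theorem nodeEquiv_val {μ : Cardinal.{0}} (l : List μ.ord.ToType) :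
    (nodeEquiv μ l).1 = l.map fun a => a.toOrd.1 :=
  rfl

theorem nodeEquiv_prefix_iff {μ : Cardinal.{0}} (a b : List μ.ord.ToType) :
    (nodeEquiv μ a).1 <+: (nodeEquiv μ b).1 ↔ a <+: b :=
  List.prefix_map_iff_of_injective
    (Subtype.val_injective.comp Ordinal.ToType.mk.symm.injective)

end RubinShelah

open RubinShelah

/-- Rubin–Shelah partition theorem: if `cf(λ) ≠ cf(μ)`, `F : T_μ → λ`, and along
every branch of `T_μ` (given by `g : ℕ → μ`, the branch being the set of its finite
initial segments) the values of `F` are bounded below `λ`, then there is a subtree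
`T ≤ T_μ` on which `F` is bounded below `λ`. -/
theorem stmt_12 (μ lam : Cardinal) (hμ : ℵ₀ ≤ μ) (hlam : ℵ₀ ≤ lam)
    (hcf : lam.ord.cof ≠ μ.ord.cof)
    (F : Tmu μ → Ordinal) (hF : ∀ η, F η < lam.ord)
    (hb : ∀ g : ℕ → Ordinal, (∀ m, g m < μ.ord) →
      ∃ β, β < lam.ord ∧ ∀ η : Tmu μ,
        (∃ m, η.val = List.map g (List.range m)) → F η ≤ β) :
    ∃ T : Set (Tmu μ), IsSubtree T ∧ IsoToFull T ∧
      ∃ β, β < lam.ord ∧ ∀ η ∈ T, F η ≤ β := by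
  have : Infinite μ.ord.ToType := by
    rw [infinite_iff, mk_ord_toType]
    exact hμ
  let G : List μ.ord.ToType → lam.ord.ToType := fun l =>
    Ordinal.ToType.mk ⟨F (nodeEquiv μ l), hF _⟩
  have G_le : ∀ l β, G l ≤ β ↔ F (nodeEquiv μ l) ≤ β.toOrd.1 := fun l β => by
    rw [← Ordinal.ToType.mk.symm.le_iff_le]
    simp [G, ← Subtype.coe_le_coe]
  obtain ⟨φ, β, hφ, hcl, hle⟩ := exists_bounded_embedding
    (by rwa [Ordinal.cof_toType, mk_ord_toType]) G (fun g => by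
      obtain ⟨β, hβ, hle⟩ := hb (fun m => (g m).toOrd.1) (fun m => (g m).toOrd.2)
      refine ⟨Ordinal.ToType.mk ⟨β, hβ⟩, fun m => (G_le _ _).2 ?_⟩
      simpa using hle _ ⟨m, by simp [nodeEquiv_val, Function.comp_def]⟩)
  have hinj : Function.Injective fun a => nodeEquiv μ (φ a) := fun a b hab => by
    have hab : φ a = φ b := (nodeEquiv μ).injective hab
    have h1 : a <+: b := (hφ a b).1 (hab ▸ List.prefix_rfl)
    have h2 : b <+: a := (hφ b a).1 (hab ▸ List.prefix_rfl)
    exact h1.eq_of_length_le h2.length_le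
  refine ⟨Set.range fun a => nodeEquiv μ (φ a), ⟨⟨_, [], rfl⟩, ?_⟩,
    ⟨(nodeEquiv μ).symm.trans (Equiv.ofInjective _ hinj), fun a b => ?_⟩,
    β.toOrd.1, β.toOrd.2, ?_⟩
  · rintro _ ⟨a, rfl⟩ ν hν
    obtain ⟨ν, rfl⟩ := (nodeEquiv μ).surjective ν
    obtain ⟨b, rfl⟩ := hcl ν a ((nodeEquiv_prefix_iff _ _).1 hν)
    exact ⟨b, rfl⟩
  · obtain ⟨a, rfl⟩ := (nodeEquiv μ).surjective a
    obtain ⟨b, rfl⟩ := (nodeEquiv μ).surjective b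
    simp [nodeEquiv_prefix_iff, hφ]
  · rintro _ ⟨a, rfl⟩
    exact (G_le _ _).1 (hle a)
end

section
/- If a Boolean algebra B satisfies the κ-chain condition, λ = λ^{<κ}, and |B| = λ⁺, then B \ {0} is the union of λ ultrafilters of B. -/
open Cardinal

/-- `S` is an ultrafilter of the Boolean algebra `B` (as a set of elements). -/
def IsBAUltrafilter {B : Type} [BooleanAlgebra B] (S : Set B) : Prop :=
  (∀ a ∈ S, ∀ b, a ≤ b → b ∈ S) ∧
  (∀ a ∈ S, ∀ b ∈ S, a ⊓ b ∈ S) ∧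
  ⊥ ∉ S ∧
  ∀ a : B, a ∈ S ∨ aᶜ ∈ S

/-- A small family of index types realizing every cardinality below `κ`. -/
theorem exists_arities_lt (κ : Cardinal.{0}) :
    ∃ (T : Type) (ar : T → Type), #T ≤ κ ∧ (∀ t, #(ar t) < κ) ∧
      ∀ D : Type, #D < κ → ∃ t, Nonempty (ar t ≃ D) := by
  refine ⟨κ.ord.ToType, fun t => Set.Iio t, by simp, fun t => ?_, ?_⟩
  · simpa using mk_Iio_lt t (by simp)
  intro D hD
  have hlt : (#D).ord < Ordinal.type ((· < ·) : κ.ord.ToType → κ.ord.ToType → Prop) := by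
    simpa using ord_lt_ord.2 hD
  refine ⟨Ordinal.enum (· < ·) ⟨(#D).ord, hlt⟩, Cardinal.eq.1 ?_⟩
  refine (Ordinal.card_typein (r := ((· < ·) : κ.ord.ToType → κ.ord.ToType → Prop))
    _).symm.trans ?_
  rw [Ordinal.typein_enum, card_ord]

theorem mk_sigma_le {lam : Cardinal.{0}} (hlam : ℵ₀ ≤ lam) {T : Type} {X : T → Type}
    (hT : #T ≤ lam) (hX : ∀ t, #(X t) ≤ lam) : #(Σ t, X t) ≤ lam := by
  rw [mk_sigma]
  refine (sum_le_sum _ (fun _ => lam) hX).trans ?_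
  rw [sum_const']
  exact mul_le_of_le hlam hT le_rfl

theorem le_of_forall_power_le {κ lam : Cardinal.{0}} (hlam : ℵ₀ ≤ lam)
    (hpow : ∀ c < κ, lam ^ c ≤ lam) : κ ≤ lam := by
  by_contra! h
  exact absurd (hpow lam h)
    (cantor' lam (one_lt_aleph0.trans_le hlam)).not_ge

/-- Engelking–Karłowicz: few functions suffice to extend all small partial functions. -/
theorem exists_functions_extending {κ : Cardinal.{0}} {Γ Λ : Type} (hκ : ℵ₀ ≤ κ)
    (hΛ : ℵ₀ ≤ #Λ) (hpow : ∀ c < κ, #Λ ^ c ≤ #Λ) (hΓ : #Γ ≤ 2 ^ #Λ) :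
    ∃ H : Λ → Γ → Λ, ∀ (D : Set Γ) (g : Γ → Λ), #D < κ → ∃ i, ∀ d ∈ D, H i d = g d := by
  classical
  obtain ⟨T, ar, hT, har, hsurj⟩ := exists_arities_lt κ
  rw [← mk_set] at hΓ
  obtain ⟨s, hs⟩ := hΓ
  have hcode : #(Λ × Prop × Λ) = #Λ := by
    simp only [mk_prod, lift_uzero, mk_Prop]
    rw [← mul_assoc, mul_comm (#Λ) 2, mul_assoc, mul_eq_self hΛ,
      mul_eq_right hΛ (ofNat_lt_aleph0.le.trans hΛ) two_ne_zero]
  have hX : #(Σ t, (ar t × ar t → Λ × Prop × Λ)) ≤ #Λ := by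
    refine mk_sigma_le hΛ (hT.trans (le_of_forall_power_le hΛ hpow)) fun t => ?_
    rw [← power_def, hcode]
    exact hpow _ (by simpa using mul_lt_of_lt hκ (har t) (har t))
  have hne : Nonempty (Σ t, (ar t × ar t → Λ × Prop × Λ)) := by
    obtain ⟨t, ⟨e⟩⟩ := hsurj Empty (by simpa using aleph0_pos.trans_le hκ)
    exact ⟨t, fun i => (e i.1).elim⟩
  obtain ⟨emb⟩ := hX
  have hdec := Function.invFun_surjective emb.injective
  have hΛne : Nonempty Λ := ⟨emb hne.some⟩
  let fits (x : Σ t, (ar t × ar t → Λ × Prop × Λ)) (γ : Γ) (k : ar x.1) : Prop :=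
    ∀ l, ((x.2 (k, l)).1 ∈ s γ ↔ (x.2 (k, l)).2.1)
  let decode (x : Σ t, (ar t × ar t → Λ × Prop × Λ)) (γ : Γ) : Λ :=
    if h : ∃ k, fits x γ k then (x.2 (h.choose, h.choose)).2.2 else hΛne.some
  refine ⟨fun i => decode (Function.invFun emb i), fun D g hD => ?_⟩
  obtain ⟨t, ⟨e⟩⟩ := hsurj D hD
  have hsep : ∀ k l : ar t, ∃ a : Λ, k ≠ l → ¬ (a ∈ s (e l) ↔ a ∈ s (e k)) := by
    intro k l
    by_cases hkl : k = l
    · exact ⟨hΛne.some, fun h => absurd hkl h⟩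
    · by_contra! hc
      exact hkl (e.injective (Subtype.ext (hs (Set.ext fun a => (hc a).2.symm))))
  choose a ha using hsep
  let x : Σ t, (ar t × ar t → Λ × Prop × Λ) :=
    ⟨t, fun p => (a p.1 p.2, a p.1 p.2 ∈ s (e p.1), g (e p.1))⟩
  obtain ⟨i, hi⟩ := hdec x
  refine ⟨i, fun d hd => ?_⟩
  obtain ⟨m, hm⟩ := e.surjective ⟨d, hd⟩
  have hmd : (e m : Γ) = d := by rw [hm]
  have hex : ∃ k, fits x d k := ⟨m, fun l => by simp [x, hmd]⟩
  have hk : hex.choose = m := by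
    by_contra hne
    refine ha _ _ hne ?_
    have hspec : a hex.choose m ∈ s d ↔ a hex.choose m ∈ s (e hex.choose) := hex.choose_spec m
    rwa [hmd]
  simp only [hi, decode, dif_pos hex]
  rw [hk, ← hmd]

theorem exists_ultrafilter_of_finset_inf_ne_bot {B : Type} [BooleanAlgebra B] {S : Set B}
    (h : ∀ F : Finset B, ↑F ⊆ S → F.inf id ≠ ⊥) : ∃ U, IsBAUltrafilter U ∧ S ⊆ U := by
  classical
  have hF : Order.IsPFilter {x : B | ∃ F : Finset B, ↑F ⊆ S ∧ F.inf id ≤ x} := by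
    refine Order.IsPFilter.of_def ⟨⊤, ∅, by simp, by simp⟩ ?_ ?_
    · rintro x ⟨F, hF, hx⟩ y ⟨G, hG, hy⟩
      refine ⟨x ⊓ y, ⟨F ∪ G, by simp [hF, hG], ?_⟩, inf_le_left, inf_le_right⟩
      rw [Finset.inf_union]
      exact inf_le_inf hx hy
    · rintro x y hxy ⟨F, hF, hx⟩
      exact ⟨F, hF, hx.trans hxy⟩
  obtain ⟨J, hJ, -, hdisj⟩ := DistribLattice.prime_ideal_of_disjoint_filter_ideal
    (F := hF.toPFilter) (I := Order.Ideal.principal (⊥ : B)) (by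
      rw [Set.disjoint_left]
      rintro x ⟨F, hF, hx⟩ hx'
      have hx' : x ≤ ⊥ := hx'
      exact h F hF (le_bot_iff.1 (hx.trans hx')))
  refine ⟨(J : Set B)ᶜ, ⟨?_, ?_, ?_, ?_⟩, ?_⟩
  · exact fun a ha b hab hb => ha (J.lower hab hb)
  · intro a ha b hb hab
    exact (hJ.mem_or_mem hab).elim ha hb
  · exact fun hb => hb J.bot_mem
  · intro a
    by_contra! hc
    simp only [Set.mem_compl_iff, not_not, SetLike.mem_coe] at hc
    refine hJ.toIsProper.notMem_of_compl_mem (x := a) hc.2 hc.1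
  · intro x hx
    exact Set.disjoint_left.1 hdisj ⟨{x}, by simpa using hx, by simp⟩

/-- A nonzero element disjoint from every element of `A`, if there is one. -/
noncomputable def disjointWitness {B : Type} [BooleanAlgebra B] (A : Set B) : B :=
  open Classical in if h : ∃ x : B, x ≠ ⊥ ∧ ∀ a ∈ A, x ⊓ a = ⊥ then h.choose else ⊥

/-- The closure of `X` under the Boolean operations and `disjointWitness` of families indexed by
the types `ar t`. -/
inductive WitnessClosure {B : Type} [BooleanAlgebra B] {T : Type} (ar : T → Type) (X : Set B) :
    B → Prop
  | base {x : B} : x ∈ X → WitnessClosure ar X x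
  | nand {a b : B} : WitnessClosure ar X a → WitnessClosure ar X b → WitnessClosure ar X (a ⊓ b)ᶜ
  | witness (t : T) (f : ar t → B) : (∀ i, WitnessClosure ar X (f i)) →
      WitnessClosure ar X (disjointWitness (Set.range f))

/-- A subalgebra `C` that contains a nonzero element disjoint from a given set of fewer than `κ`
of its members whenever the ambient algebra does. -/
structure IsReflecting {B : Type} [BooleanAlgebra B] (κ : Cardinal.{0}) (C : Set B) : Prop where
  nand_mem : ∀ a ∈ C, ∀ b ∈ C, (a ⊓ b)ᶜ ∈ C
  exists_disjoint : ∀ A ⊆ C, #A < κ → ∀ x : B, x ≠ ⊥ → (∀ a ∈ A, x ⊓ a = ⊥) →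
    ∃ y ∈ C, y ≠ ⊥ ∧ ∀ a ∈ A, y ⊓ a = ⊥

theorem mk_witnessClosure_le {B : Type} [BooleanAlgebra B] {κ lam : Cardinal.{0}} (hκ : ℵ₀ ≤ κ)
    (hlam : ℵ₀ ≤ lam) (hpow : ∀ c < κ, lam ^ c ≤ lam) {T : Type} {ar : T → Type}
    (hT : #T ≤ lam) (har : ∀ t, #(ar t) < κ) {X : Set B} (hX : #X ≤ lam) :
    #{b | WitnessClosure ar X b} ≤ lam := by
  let β : X ⊕ (Unit ⊕ T) → Type := Sum.elim (fun _ => Empty) (Sum.elim (fun _ => Bool) ar)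
  have hβ : ∀ s, #(β s) < κ := by
    rintro (x | u | t)
    · simpa [β] using aleph0_pos.trans_le hκ
    · simpa [β] using ofNat_lt_aleph0.trans_le hκ
    · exact har t
  have hW : #(WType β) ≤ lam := by
    refine WType.cardinalMk_le_of_le ((sum_le_sum _ (fun _ => lam)
      fun s => hpow _ (hβ s)).trans ?_)
    rw [sum_const']
    refine mul_le_of_le hlam ?_ le_rfl
    simp only [mk_sum, lift_id, mk_unit]
    exact add_le_of_le hlam hX (add_le_of_le hlam (one_lt_aleph0.le.trans hlam) hT)
  let step : (Σ s, β s → B) → B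
    | ⟨.inl x, _⟩ => x
    | ⟨.inr (.inl _), f⟩ => (f true ⊓ f false)ᶜ
    | ⟨.inr (.inr _), f⟩ => disjointWitness (Set.range f)
  have hsub : {b | WitnessClosure ar X b} ⊆ Set.range (WType.elim B step) := by
    intro b hb
    induction hb with
    | base hx => exact ⟨.mk (.inl ⟨_, hx⟩) Empty.elim, rfl⟩
    | nand _ _ iha ihb =>
      obtain ⟨u, rfl⟩ := iha
      obtain ⟨v, rfl⟩ := ihb
      exact ⟨.mk (.inr (.inl ())) (fun i : Bool => if i then u else v), rfl⟩
    | witness t f _ ih =>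
      choose u hu using ih
      obtain rfl : (fun i => WType.elim B step (u i)) = f := funext hu
      exact ⟨.mk (.inr (.inr t)) u, rfl⟩
  exact (mk_le_mk_of_subset hsub).trans (mk_range_le.trans hW)

theorem exists_reflecting_closure {B : Type} [BooleanAlgebra B] {κ lam : Cardinal.{0}}
    (hκ : ℵ₀ ≤ κ) (hlam : ℵ₀ ≤ lam) (hpow : ∀ c < κ, lam ^ c ≤ lam) :
    ∃ C : Set B → Set B, (∀ X, X ⊆ C X) ∧ Monotone C ∧ (∀ X : Set B, #X ≤ lam → #(C X) ≤ lam) ∧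
      ∀ X, IsReflecting κ (C X) := by
  obtain ⟨T, ar, hT, har, hsurj⟩ := exists_arities_lt κ
  refine ⟨fun X => {b | WitnessClosure ar X b}, fun X x hx => .base hx, ?_, fun X hX =>
    mk_witnessClosure_le hκ hlam hpow (hT.trans (le_of_forall_power_le hlam hpow)) har hX,
    fun X => ⟨fun a ha b hb => .nand ha hb, ?_⟩⟩
  · intro X Y hXY b hb
    induction hb with
    | base hx => exact .base (hXY hx)
    | nand _ _ iha ihb => exact .nand iha ihb
    | witness t f _ ih => exact .witness t f ih
  · intro A hA hcard x hx hxA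
    obtain ⟨t, ⟨e⟩⟩ := hsurj A hcard
    have hr : Set.range (fun i => (e i : B)) = A := by
      rw [Set.range_comp' Subtype.val e, e.surjective.range_eq]
      simp
    have hmem : WitnessClosure ar X (disjointWitness A) := by
      rw [← hr]
      exact .witness t _ fun i => hA (e i).2
    have hex : ∃ x : B, x ≠ ⊥ ∧ ∀ a ∈ A, x ⊓ a = ⊥ := ⟨x, hx, hxA⟩
    refine ⟨_, hmem, ?_⟩
    rw [disjointWitness, dif_pos hex]
    exact hex.choose_spec

namespace IsReflecting

variable {B : Type} [BooleanAlgebra B] {κ : Cardinal.{0}} {C : Set B}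

theorem compl_mem (hC : IsReflecting κ C) {a : B} (ha : a ∈ C) : aᶜ ∈ C := by
  simpa using hC.nand_mem a ha a ha

theorem inf_mem (hC : IsReflecting κ C) {a b : B} (ha : a ∈ C) (hb : b ∈ C) : a ⊓ b ∈ C := by
  simpa using hC.compl_mem (hC.nand_mem a ha b hb)

theorem top_mem [Nontrivial B] (hC : IsReflecting κ C) (hκ : ℵ₀ ≤ κ) : ⊤ ∈ C := by
  obtain ⟨y, hy, -⟩ := hC.exists_disjoint ∅ (by simp) (by simpa using aleph0_pos.trans_le hκ) ⊤
    top_ne_bot (by simp)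
  simpa using hC.nand_mem y hy _ (hC.compl_mem hy)

end IsReflecting

/-- The elements of `C` disjoint from `b`. -/
def disjointPart {B : Type} [BooleanAlgebra B] (C : Set B) (b : B) : Set B :=
  {c | c ∈ C ∧ c ⊓ b = ⊥}

/-- `b` splits off at `δ` from all earlier members of the chain `C`: some part of `C δ` disjoint
from `b` is not yet accounted for below `δ`. -/
def IsJump {B Γ : Type} [BooleanAlgebra B] [LinearOrder Γ] (C : Γ → Set B) (b : B) (δ : Γ) :
    Prop :=
  ∀ γ < δ, ∃ c ∈ disjointPart (C δ) b, c ≠ ⊥ ∧ ∀ a ∈ disjointPart (C γ) b, c ⊓ a = ⊥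

section ChainCondition

variable {B : Type} [BooleanAlgebra B] {κ : Cardinal.{0}}

theorem exists_maximal_antichain_subset
    (hcc : ∀ A : Set B, (∀ a ∈ A, a ≠ ⊥) → (A.Pairwise fun a b => a ⊓ b = ⊥) → #A < κ)
    (I : Set B) : ∃ A ⊆ I, #A < κ ∧ ∀ x ∈ I, x ≠ ⊥ → ∃ a ∈ A, x ⊓ a ≠ ⊥ := by
  obtain ⟨A, hA⟩ := zorn_subset
    {A : Set B | A ⊆ I ∧ (∀ a ∈ A, a ≠ ⊥) ∧ A.Pairwise fun a b => a ⊓ b = ⊥} (by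
      intro c hc hchain
      refine ⟨⋃₀ c, ⟨Set.sUnion_subset fun s hs => (hc hs).1, ?_, ?_⟩,
        fun s hs => Set.subset_sUnion_of_mem hs⟩
      · rintro a ⟨s, hs, ha⟩
        exact (hc hs).2.1 a ha
      · exact (Set.pairwise_sUnion hchain.directedOn).2 fun s hs => (hc hs).2.2)
  refine ⟨A, hA.prop.1, hcc A hA.prop.2.1 hA.prop.2.2, fun x hxI hx => ?_⟩
  by_contra! hdisj
  have hxA : x ∈ A := by
    refine hA.le_of_ge (y := insert x A) ⟨?_, ?_, ?_⟩ (Set.subset_insert x A)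
      (Set.mem_insert x A)
    · exact Set.insert_subset hxI hA.prop.1
    · rintro a (rfl | ha)
      exacts [hx, hA.prop.2.1 a ha]
    · refine hA.prop.2.2.insert fun b hb _ => ⟨hdisj b hb, ?_⟩
      rw [inf_comm]
      exact hdisj b hb
  exact hx (by simpa using hdisj x hxA)

theorem exists_le_forall_inf_ne_bot (hκ : ℵ₀ ≤ κ)
    (hcc : ∀ A : Set B, (∀ a ∈ A, a ≠ ⊥) → (A.Pairwise fun a b => a ⊓ b = ⊥) → #A < κ)
    {C : Set B} (hC : IsReflecting κ C) {b c : B} (hc : c ∈ C) (hcb : c ⊓ b ≠ ⊥) :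
    ∃ d ∈ C, d ≠ ⊥ ∧ d ≤ c ∧ ∀ x ∈ C, x ≠ ⊥ → x ≤ d → x ⊓ b ≠ ⊥ := by
  obtain ⟨A, hAI, hA, hmax⟩ := exists_maximal_antichain_subset hcc (disjointPart C b)
  obtain ⟨d, hdC, hd, hdA⟩ := hC.exists_disjoint (insert cᶜ A)
    (Set.insert_subset (hC.compl_mem hc) fun a ha => (hAI ha).1)
    ((mk_insert_le).trans_lt (add_lt_of_lt hκ hA (one_lt_aleph0.trans_le hκ))) (c ⊓ b) hcb (by
      rintro a (rfl | ha)
      · rw [inf_right_comm, inf_compl_self, bot_inf_eq]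
      · rw [inf_assoc, inf_comm b, (hAI ha).2, inf_bot_eq])
  refine ⟨d, hdC, hd, ?_, fun x hxC hx hxd hxb => ?_⟩
  · simpa [disjoint_iff] using (disjoint_iff.2 (hdA _ (Set.mem_insert _ _))).le_compl_right
  · obtain ⟨a, ha, hxa⟩ := hmax x ⟨hxC, hxb⟩ hx
    exact hxa (le_bot_iff.1 ((inf_le_inf_right a hxd).trans (hdA a (.inr ha)).le))

theorem mk_range_disjointPart_le {lam : Cardinal.{0}} (hκ : ℵ₀ ≤ κ) (hlam : ℵ₀ ≤ lam)
    (hpow : ∀ c < κ, lam ^ c ≤ lam)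
    (hcc : ∀ A : Set B, (∀ a ∈ A, a ≠ ⊥) → (A.Pairwise fun a b => a ⊓ b = ⊥) → #A < κ)
    {C : Set B} (hC : IsReflecting κ C) (hCcard : #C ≤ lam) :
    #(Set.range (disjointPart C)) ≤ lam := by
  obtain ⟨T, ar, hT, har, hsurj⟩ := exists_arities_lt κ
  let F : (Σ t, (ar t → C)) → Set B := fun p =>
    {c | c ∈ C ∧ ¬ ∃ x ∈ C, x ≠ ⊥ ∧ x ≤ c ∧ ∀ i, x ⊓ p.2 i = ⊥}
  have hdom : #(Σ t, (ar t → C)) ≤ lam := by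
    refine mk_sigma_le hlam (hT.trans (le_of_forall_power_le hlam hpow)) fun t => ?_
    rw [← power_def]
    exact (power_le_power_right hCcard).trans (hpow _ (har t))
  refine (mk_le_mk_of_subset ?_).trans ((mk_range_le (f := F)).trans hdom)
  rintro _ ⟨b, rfl⟩
  obtain ⟨A, hAI, hA, hmax⟩ := exists_maximal_antichain_subset hcc (disjointPart C b)
  obtain ⟨t, ⟨e⟩⟩ := hsurj A hA
  refine ⟨⟨t, fun i => ⟨e i, (hAI (e i).2).1⟩⟩, ?_⟩
  ext c
  refine and_congr_right fun hc => ⟨fun h => ?_, ?_⟩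
  · by_contra hcb
    obtain ⟨d, hdC, hd, hdc, hdb⟩ := exists_le_forall_inf_ne_bot hκ hcc hC hc hcb
    refine h ⟨d, hdC, hd, hdc, fun i => ?_⟩
    by_contra hne
    refine hdb _ (hC.inf_mem hdC (hAI (e i).2).1) hne inf_le_left ?_
    rw [inf_assoc, (hAI (e i).2).2, inf_bot_eq]
  · rintro hcb ⟨x, hxC, hx, hxc, hxA⟩
    obtain ⟨a, ha, hxa⟩ := hmax x
      ⟨hxC, le_bot_iff.1 ((inf_le_inf_right b hxc).trans hcb.le)⟩ hx
    exact hxa (by simpa using hxA (e.symm ⟨a, ha⟩))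

variable {Γ : Type} [LinearOrder Γ] [WellFoundedLT Γ] {C : Γ → Set B}

theorem mk_isJump_lt (hκ : ℵ₀ ≤ κ)
    (hcc : ∀ A : Set B, (∀ a ∈ A, a ≠ ⊥) → (A.Pairwise fun a b => a ⊓ b = ⊥) → #A < κ)
    (hmono : Monotone C) (b : B) : #{δ | IsJump C b δ} < κ := by
  have hnext : ∀ s : {s | IsJump C b s ∧ ∃ t, IsJump C b t ∧ s < t}, ∃ c : B, c ≠ ⊥ ∧
      c ⊓ b = ⊥ ∧ (∀ a ∈ disjointPart (C s) b, c ⊓ a = ⊥) ∧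
      ∀ t, IsJump C b t → s.1 < t → c ∈ C t := by
    rintro ⟨s, -, ht⟩
    obtain ⟨t, ⟨htJ, hst⟩, hmin⟩ := WellFounded.has_min (wellFounded_lt (α := Γ))
      {t | IsJump C b t ∧ s < t} ht
    obtain ⟨c, hc, hc0, hcs⟩ := htJ s hst
    exact ⟨c, hc0, hc.2, hcs, fun u hu hsu => hmono (not_lt.1 (hmin u ⟨hu, hsu⟩)) hc.1⟩
  choose c hc0 hcb hcs hct using hnext
  have hdisj : ∀ s t, s < t → c t ⊓ c s = ⊥ := fun s t hst =>
    hcs t _ ⟨hct s t t.2.1 hst, hcb s⟩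
  have hinj : Function.Injective c := by
    intro s t hst
    by_contra hne
    rcases lt_or_gt_of_ne hne with h | h
    · exact hc0 s (by simpa [hst] using hdisj s t h)
    · exact hc0 s (by simpa [hst] using hdisj t s h)
  have hsmall : #{s | IsJump C b s ∧ ∃ t, IsJump C b t ∧ s < t} < κ := by
    rw [← mk_range_eq c hinj]
    refine hcc _ (by rintro _ ⟨s, rfl⟩; exact hc0 s) ?_
    rintro _ ⟨s, rfl⟩ _ ⟨t, rfl⟩ hne
    rcases lt_or_gt_of_ne (ne_of_apply_ne c hne) with h | h
    · rw [inf_comm]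
      exact hdisj s t h
    · exact hdisj t s h
  have hlast : #{s | IsJump C b s ∧ ∀ t, IsJump C b t → t ≤ s} ≤ 1 :=
    mk_le_one_iff_set_subsingleton.2 fun s hs t ht => le_antisymm (ht.2 s hs.1) (hs.2 t ht.1)
  have hunion : {δ | IsJump C b δ} ⊆ {s | IsJump C b s ∧ ∃ t, IsJump C b t ∧ s < t} ∪
      {s | IsJump C b s ∧ ∀ t, IsJump C b t → t ≤ s} := by
    intro s hs
    by_cases h : ∃ t, IsJump C b t ∧ s < t
    · exact .inl ⟨hs, h⟩
    · push Not at h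
      exact .inr ⟨hs, h⟩
  exact ((mk_le_mk_of_subset hunion).trans (mk_union_le _ _)).trans_lt
    (add_lt_of_lt hκ hsmall (hlast.trans_lt (one_lt_aleph0.trans_le hκ)))

theorem exists_forall_inf_ne_bot_of_agree [Nontrivial B] (hκ : ℵ₀ ≤ κ)
    (hcc : ∀ A : Set B, (∀ a ∈ A, a ≠ ⊥) → (A.Pairwise fun a b => a ⊓ b = ⊥) → #A < κ)
    (hmono : Monotone C) (hC : ∀ γ, IsReflecting κ (C γ)) {F : Finset B} (hF : ∀ b ∈ F, b ≠ ⊥)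
    (hagree : ∀ b ∈ F, ∀ b' ∈ F, ∀ δ, IsJump C b δ → IsJump C b' δ →
      disjointPart (C δ) b = disjointPart (C δ) b') (δ : Γ) :
    ∃ c ∈ C δ, c ≠ ⊥ ∧ ∀ x ∈ C δ, x ≠ ⊥ → x ≤ c → ∀ b ∈ F, x ⊓ b ≠ ⊥ := by
  classical
  induction δ using WellFoundedLT.induction with
  | ind δ ih =>
  have hstart : ∃ c ∈ C δ, c ≠ ⊥ ∧ (∀ b ∈ F, c ⊓ b ≠ ⊥) ∧
      ∀ b ∈ F, ¬ IsJump C b δ → ∀ x ∈ C δ, x ≠ ⊥ → x ≤ c → x ⊓ b ≠ ⊥ := by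
    rcases (F.filter fun b => ¬ IsJump C b δ).eq_empty_or_nonempty with hE | hN
    · refine ⟨⊤, (hC δ).top_mem hκ, top_ne_bot, by simpa using hF, fun b hb hbJ => ?_⟩
      exact absurd hbJ (Finset.filter_eq_empty_iff.1 hE hb)
    · have hstable : ∀ b, ∃ γ, ¬ IsJump C b δ → γ < δ ∧ ∀ c ∈ disjointPart (C δ) b, c ≠ ⊥ →
          ∃ a ∈ disjointPart (C γ) b, c ⊓ a ≠ ⊥ := by
        intro b
        by_cases hb : IsJump C b δ
        · exact ⟨δ, fun h => absurd hb h⟩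
        · rw [IsJump] at hb
          push Not at hb
          obtain ⟨γ, hγ, h⟩ := hb
          exact ⟨γ, fun _ => ⟨hγ, h⟩⟩
      choose g hg using hstable
      obtain ⟨b₀, hb₀, hmax⟩ := Finset.exists_max_image _ g hN
      have hlt := (hg b₀ (Finset.mem_filter.1 hb₀).2).1
      obtain ⟨c, hcC, hc0, hc⟩ := ih (g b₀) hlt
      refine ⟨c, hmono hlt.le hcC, hc0, hc c hcC hc0 le_rfl, fun b hb hbJ x hx hx0 hxc hxb => ?_⟩
      obtain ⟨a, ha, hxa⟩ := (hg b hbJ).2 x ⟨hx, hxb⟩ hx0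
      have haC := hmono (hmax b (Finset.mem_filter.2 ⟨hb, hbJ⟩)) ha.1
      refine hc (c ⊓ a) ((hC _).inf_mem hcC haC) (fun h => hxa ?_) inf_le_left b hb ?_
      · exact le_bot_iff.1 ((inf_le_inf_right a hxc).trans h.le)
      · rw [inf_assoc, ha.2, inf_bot_eq]
  obtain ⟨c, hcC, hc0, hcF, hc⟩ := hstart
  by_cases hJ : ∃ b ∈ F, IsJump C b δ
  · obtain ⟨b₁, hb₁, hJ₁⟩ := hJ
    obtain ⟨d, hdC, hd0, hdc, hd⟩ := exists_le_forall_inf_ne_bot hκ hcc (hC δ) hcC (hcF b₁ hb₁)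
    refine ⟨d, hdC, hd0, fun x hx hx0 hxd b hb => ?_⟩
    by_cases hbJ : IsJump C b δ
    · intro hxb
      have hx' : x ∈ disjointPart (C δ) b := ⟨hx, hxb⟩
      rw [hagree b hb b₁ hb₁ δ hbJ hJ₁] at hx'
      exact hd x hx hx0 hxd hx'.2
    · exact hc b hb hbJ x hx hx0 (hxd.trans hdc)
  · push Not at hJ
    exact ⟨c, hcC, hc0, fun x hx hx0 hxc b hb => hc b hb (hJ b hb) x hx hx0 hxc⟩

theorem inf_ne_bot_of_agree [Nontrivial B] (hκ : ℵ₀ ≤ κ)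
    (hcc : ∀ A : Set B, (∀ a ∈ A, a ≠ ⊥) → (A.Pairwise fun a b => a ⊓ b = ⊥) → #A < κ)
    (hmono : Monotone C) (hC : ∀ γ, IsReflecting κ (C γ)) (hcover : ∀ b, ∃ γ, b ∈ C γ)
    {F : Finset B} (hF : ∀ b ∈ F, b ≠ ⊥)
    (hagree : ∀ b ∈ F, ∀ b' ∈ F, ∀ δ, IsJump C b δ → IsJump C b' δ →
      disjointPart (C δ) b = disjointPart (C δ) b') : F.inf id ≠ ⊥ := by
  rcases F.eq_empty_or_nonempty with rfl | hne
  · simp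
  choose g hg using hcover
  obtain ⟨b₀, -, hmax⟩ := Finset.exists_max_image F g hne
  obtain ⟨c, hcC, hc0, hc⟩ :=
    exists_forall_inf_ne_bot_of_agree hκ hcc hmono hC hF hagree (g b₀)
  refine ne_bot_of_le_ne_bot hc0 (Finset.le_inf fun b hb => ?_)
  have hbC : b ∈ C (g b₀) := hmono (hmax b hb) (hg b)
  by_contra hle
  refine hc (c ⊓ bᶜ) ((hC _).inf_mem hcC ((hC _).compl_mem hbC)) (fun h => hle ?_)
    inf_le_left b hb ?_
  · simpa using (disjoint_iff.2 h).le_compl_right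
  · rw [inf_assoc, compl_inf_self, inf_bot_eq]

end ChainCondition

theorem exists_ultrafilters_covering {B Λ : Type} [BooleanAlgebra B] {κ : Cardinal.{0}}
    (hκ : ℵ₀ ≤ κ) (hΛ : ℵ₀ ≤ #Λ) (hpow : ∀ c < κ, #Λ ^ c ≤ #Λ)
    (hcc : ∀ A : Set B, (∀ a ∈ A, a ≠ ⊥) → (A.Pairwise fun a b => a ⊓ b = ⊥) → #A < κ)
    (hB : #B = Order.succ #Λ) :
    ∃ U : Λ → Set B, (∀ i, IsBAUltrafilter (U i)) ∧ ∀ b : B, b ≠ ⊥ → ∃ i, b ∈ U i := by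
  have : Nontrivial B := by
    rw [← one_lt_iff_nontrivial, hB]
    exact one_lt_aleph0.trans_le (hΛ.trans (Order.le_succ _))
  let Γ := (Order.succ #Λ).ord.ToType
  have hΓ : #Γ = Order.succ #Λ := mk_ord_toType _
  obtain ⟨e⟩ := Cardinal.eq.1 (hΓ.trans hB.symm)
  obtain ⟨cl, hsub, hclmono, hclcard, hcl⟩ := exists_reflecting_closure (B := B) hκ hΛ hpow
  let C : Γ → Set B := fun γ => cl (e '' Set.Iic γ)
  have hmono : Monotone C := fun γ δ h => hclmono (Set.image_mono (Set.Iic_subset_Iic.2 h))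
  have hcover : ∀ b, ∃ γ, b ∈ C γ := fun b =>
    ⟨e.symm b, hsub _ ⟨e.symm b, Set.self_mem_Iic, by simp⟩⟩
  have hcard : ∀ γ, #(C γ) ≤ #Λ := by
    intro γ
    refine hclcard _ (mk_image_le.trans ?_)
    have hlt : #(Set.Iio γ) < #Γ := mk_Iio_lt γ (by simp [Γ])
    rw [hΓ, Order.lt_succ_iff] at hlt
    rw [← Set.Iio_insert]
    exact mk_insert_le.trans (add_le_of_le hΛ hlt (one_lt_aleph0.le.trans hΛ))
  have hcode : ∀ γ, Nonempty (Set.range (disjointPart (C γ)) ↪ Λ) := fun γ =>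
    mk_range_disjointPart_le hκ hΛ hpow hcc (hcl _) (hcard γ)
  let g : B → Γ → Λ := fun b γ => (hcode γ).some ⟨disjointPart (C γ) b, b, rfl⟩
  have hg : ∀ {b b' γ}, g b γ = g b' γ → disjointPart (C γ) b = disjointPart (C γ) b' :=
    fun h => congrArg Subtype.val ((hcode _).some.injective h)
  obtain ⟨H, hH⟩ := exists_functions_extending (Γ := Γ) hκ hΛ hpow
    (hΓ.le.trans (Order.succ_le_of_lt (cantor _)))
  have hultra : ∀ i, ∃ U, IsBAUltrafilter U ∧
      {b | b ≠ ⊥ ∧ ∀ δ, IsJump C b δ → H i δ = g b δ} ⊆ U := by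
    intro i
    refine exists_ultrafilter_of_finset_inf_ne_bot fun F hF => ?_
    exact inf_ne_bot_of_agree hκ hcc hmono (fun γ => hcl _) hcover (fun b hb => (hF hb).1)
      fun b hb b' hb' δ hδ hδ' => hg (((hF hb).2 δ hδ).symm.trans ((hF hb').2 δ hδ'))
  choose U hU hSU using hultra
  refine ⟨U, hU, fun b hb => ?_⟩
  obtain ⟨i, hi⟩ := hH {δ | IsJump C b δ} (g b) (mk_isJump_lt hκ hcc hmono b)
  exact ⟨i, hSU i ⟨hb, hi⟩⟩

/-- In a Boolean algebra with only two elements, `{⊤}` is an ultrafilter. -/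
theorem isBAUltrafilter_singleton_top {B : Type} [BooleanAlgebra B] [Nontrivial B]
    (h : ∀ x : B, x = ⊥ ∨ x = ⊤) : IsBAUltrafilter ({⊤} : Set B) := by
  refine ⟨?_, ?_, bot_ne_top, fun a => ?_⟩
  · rintro a rfl b hb
    exact top_le_iff.1 hb
  · rintro a rfl b rfl
    exact inf_idem _
  · rcases h a with rfl | rfl
    · exact .inr compl_bot
    · exact .inl rfl

/-- With a finite cardinal `lam = lam ^< κ`, the chain condition leaves only `⊥` and `⊤`. -/
theorem eq_bot_or_eq_top_of_lt_aleph0 {B : Type} [BooleanAlgebra B] {κ lam : Cardinal.{0}}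
    (hfin : lam < ℵ₀) (hpow : ∀ c < κ, lam ^ c ≤ lam)
    (hcc : ∀ A : Set B, (∀ a ∈ A, a ≠ ⊥) → (A.Pairwise fun a b => a ⊓ b = ⊥) → #A < κ)
    (hB : #B = Order.succ lam) (x : B) : x = ⊥ ∨ x = ⊤ := by
  classical
  by_contra! hx
  have hxc : xᶜ ≠ ⊥ := by simpa using hx.2
  have : Nontrivial B := ⟨x, ⊥, hx.1⟩
  have hpair : #({x, xᶜ} : Set B) < κ := by
    refine hcc _ ?_ ?_
    · rintro a (rfl | rfl)
      exacts [hx.1, hxc]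
    · rintro a (rfl | rfl) b (rfl | rfl) hne <;> simp at hne ⊢
  have htwo : (2 : Cardinal) < κ := by
    rwa [mk_insert (by simp), mk_singleton, one_add_one_eq_two] at hpair
  have hthree : (3 : Cardinal) ≤ #B := by
    have h3 : ({⊥, x, ⊤} : Finset B).card = 3 :=
      Finset.card_eq_three.2 ⟨⊥, x, ⊤, hx.1.symm, bot_ne_top, hx.2, rfl⟩
    have hle := mk_set_le (({⊥, x, ⊤} : Finset B) : Set B)
    simpa only [Finset.coe_sort_coe, mk_coe_finset, h3, Nat.cast_ofNat] using hle
  obtain ⟨n, rfl⟩ := lt_aleph0.1 hfin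
  have hsq := hpow 2 htwo
  rw [hB, Cardinal.succ_natCast] at hthree
  norm_cast at hsq hthree
  nlinarith

/-- Shelah: if a Boolean algebra `B` satisfies the `κ`-chain condition,
`λ = λ^{<κ}`, and `|B| = λ⁺`, then `B \ {0}` is the union of `λ` ultrafilters. -/
theorem stmt_15 (B : Type) [BooleanAlgebra B] (κ lam : Cardinal)
    (hcc : ∀ A : Set B, (∀ a ∈ A, a ≠ ⊥) →
      (A.Pairwise fun a b => a ⊓ b = ⊥) → #A < κ)
    (hlam : lam ^< κ = lam)
    (hB : #B = Order.succ lam) :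
    ∃ (ι : Type) (U : ι → Set B), #ι = lam ∧
      (∀ i, IsBAUltrafilter (U i)) ∧
      ∀ b : B, b ≠ ⊥ → ∃ i, b ∈ U i := by
  have hpow : ∀ c < κ, lam ^ c ≤ lam := fun c hc => (le_powerlt lam hc).trans hlam.le
  refine ⟨lam.out, ?_⟩
  rcases lt_or_ge lam ℵ₀ with hfin | hinf
  · have hone : 1 ≤ lam := by
      have h0 : 0 < κ := by simpa using hcc ∅ (by simp) (by simp)
      simpa using hpow 0 h0
    have : Nontrivial B := by
      rw [← one_lt_iff_nontrivial, hB]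
      exact hone.trans_lt (Order.lt_succ _)
    have htwo := eq_bot_or_eq_top_of_lt_aleph0 hfin hpow hcc hB
    obtain ⟨i⟩ : Nonempty lam.out := by
      rw [← mk_ne_zero_iff, mk_out]
      exact (zero_lt_one.trans_le hone).ne'
    exact ⟨fun _ => {⊤}, mk_out lam, fun _ => isBAUltrafilter_singleton_top htwo,
      fun b hb => ⟨i, (htwo b).resolve_left hb⟩⟩
  · have hpow' : ∀ c < max κ ℵ₀, lam ^ c ≤ lam := by
      intro c hc
      rcases lt_max_iff.1 hc with h | h
      · exact hpow c h
      · exact pow_le hinf h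
    obtain ⟨U, hU, hcov⟩ := exists_ultrafilters_covering (Λ := lam.out) (le_max_right κ ℵ₀)
      (by simpa using hinf) (by simpa using hpow')
      (fun A hA hA' => (hcc A hA hA').trans_le (le_max_left κ ℵ₀)) (by simpa using hB)
    exact ⟨U, mk_out lam, hU, hcov⟩
end

section
/- If the real line can be partitioned into κ nonempty G_δ sets, where κ is uncountable, then the real line can be covered by κ nowhere dense closed sets. -/
open Set Topology

section Traces

variable {X ι : Type*}

/-- The indices of the members of the family `P` that meet `S`. -/
def meetingIndices (P : ι → Set X) (S : Set X) : Set ι := {i | (P i ∩ S).Nonempty}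

lemma meetingIndices_mono (P : ι → Set X) {S T : Set X} (h : S ⊆ T) :
    meetingIndices P S ⊆ meetingIndices P T :=
  fun _ hi => hi.mono (inter_subset_inter_right _ h)

lemma meetingIndices_iUnion (P : ι → Set X) {α : Sort*} (S : α → Set X) :
    meetingIndices P (⋃ a, S a) = ⋃ a, meetingIndices P (S a) := by
  ext i
  simp [meetingIndices, inter_iUnion]

lemma meetingIndices_union (P : ι → Set X) (S T : Set X) :
    meetingIndices P (S ∪ T) = meetingIndices P S ∪ meetingIndices P T := by
  ext i
  simp [meetingIndices, inter_union_distrib_left, union_nonempty]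

variable [TopologicalSpace X]

/-- A nonempty compact set each of whose nonempty relatively open subsets meets uncountably many
members of the family `P`. -/
structure IsUncountablySplit (P : ι → Set X) (F : Set X) : Prop where
  isCompact : IsCompact F
  nonempty : F.Nonempty
  not_countable : ∀ V, IsOpen V → (V ∩ F).Nonempty → ¬ (meetingIndices P (V ∩ F)).Countable

/-- Removing from a compact set the points near which it meets only countably many members of
`P` leaves an uncountably split set. -/
lemma exists_isUncountablySplit_subset [SecondCountableTopology X] {P : ι → Set X} {E : Set X}
    (hE : IsCompact E) (hunc : ¬ (meetingIndices P E).Countable) :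
    ∃ F ⊆ E, IsUncountablySplit P F := by
  let G : Set X := ⋃₀ {W | IsOpen W ∧ (meetingIndices P (W ∩ E)).Countable}
  have hG : IsOpen G := isOpen_sUnion fun W hW => hW.1
  have hGE : (meetingIndices P (E ∩ G)).Countable := by
    have hL : IsLindelof (E ∩ G) := HereditarilyLindelofSpace.isLindelof _
    refine hL.induction_on (p := fun S => (meetingIndices P S).Countable)
      (fun S T hST hT => hT.mono (meetingIndices_mono P hST)) ?_ ?_
    · intro S hS h
      rw [sUnion_eq_iUnion, meetingIndices_iUnion]
      have := hS.to_subtype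
      exact countable_iUnion fun s => h s s.2
    · rintro x ⟨hxE, W, hW, hxW⟩
      refine ⟨W ∩ E, ?_, hW.2⟩
      filter_upwards [self_mem_nhdsWithin, mem_nhdsWithin_of_mem_nhds (hW.1.mem_nhds hxW)]
        with y hy hyW using ⟨hyW, hy.1⟩
  have hsplit : ∀ V, meetingIndices P (V ∩ E) ⊆
      meetingIndices P (V ∩ (E \ G)) ∪ meetingIndices P (E ∩ G) := by
    intro V
    rw [← meetingIndices_union]
    refine meetingIndices_mono P fun x hx => ?_
    by_cases hxG : x ∈ G
    · exact Or.inr ⟨hx.2, hxG⟩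
    · exact Or.inl ⟨hx.1, hx.2, hxG⟩
  refine ⟨E \ G, sdiff_subset, hE.diff hG, ?_, ?_⟩
  · by_contra hempty
    rw [not_nonempty_iff_eq_empty, sdiff_eq_empty] at hempty
    exact hunc (inter_eq_left.2 hempty ▸ hGE)
  · rintro V hV ⟨x, hxV, hxE, hxG⟩ hc
    exact hxG ⟨V, ⟨hV, (hc.union hGE).mono (hsplit V)⟩, hxV⟩

/-- Two disjoint `G_δ` sets cannot both have dense trace on the same nonempty compact set. -/
lemma not_disjoint_of_isGδ_of_dense_traces [T2Space X] {F A B : Set X} (hF : IsCompact F)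
    (hne : F.Nonempty) (hA : IsGδ A) (hB : IsGδ B) (hAd : F ⊆ closure (A ∩ F))
    (hBd : F ⊆ closure (B ∩ F)) : ¬ Disjoint A B := by
  have := isCompact_iff_compactSpace.1 hF
  have := hne.to_subtype
  have key : ∀ S : Set X, F ⊆ closure (S ∩ F) → Dense ((↑) ⁻¹' S : Set F) := by
    intro S hS
    rw [Subtype.dense_iff]
    intro x hx
    rw [Subtype.image_preimage_coe, inter_comm]
    exact hS hx
  have hd := Dense.inter_of_Gδ (hA.preimage continuous_subtype_val)
    (hB.preimage continuous_subtype_val) (key A hAd) (key B hBd)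
  obtain ⟨x, hxA, hxB⟩ := hd.nonempty
  exact not_disjoint_iff.2 ⟨x, hxA, hxB⟩

/-- Inside any nonempty open part of an uncountably split set `F` there is an uncountably split set
missing every member of `P` that is dense in `F`. -/
lemma IsUncountablySplit.exists_subset_disjoint [SecondCountableTopology X] [T2Space X]
    [LocallyCompactSpace X] {P : ι → Set X} (hgδ : ∀ i, IsGδ (P i))
    (hdisj : Pairwise (Function.onFun Disjoint P)) {F : Set X} (hF : IsUncountablySplit P F)
    {V : Set X} (hV : IsOpen V) (hVF : (V ∩ F).Nonempty) :
    ∃ F', F' ⊆ V ∩ F ∧ IsUncountablySplit P F' ∧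
      ∀ i, F ⊆ closure (P i ∩ F) → Disjoint F' (P i) := by
  obtain ⟨x, hxV, hxF⟩ := hVF
  obtain ⟨K, hK, hxK, hKV⟩ := exists_compact_subset hV hxV
  have hKF : IsCompact (K ∩ F) := hK.inter hF.isCompact
  have hunc : ¬ (meetingIndices P (K ∩ F)).Countable := fun h =>
    hF.not_countable _ isOpen_interior ⟨x, hxK, hxF⟩
      (h.mono (meetingIndices_mono P (inter_subset_inter_left _ interior_subset)))
  by_cases hex : ∃ i, F ⊆ closure (P i ∩ F)
  · obtain ⟨i, hi⟩ := hex
    obtain ⟨U, hU, hPU⟩ := (hgδ i).eq_iInter_nat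
    have hn : ∃ n, ¬ (meetingIndices P (K ∩ F ∩ (U n)ᶜ)).Countable := by
      by_contra! hcount
      refine hunc (((countable_iUnion hcount).union (countable_singleton i)).mono ?_)
      rintro j ⟨y, hyj, hyK⟩
      by_cases hji : j = i
      · exact Or.inr hji
      · have hyi : y ∉ P i := disjoint_left.1 (hdisj hji) hyj
        rw [hPU, mem_iInter, not_forall] at hyi
        obtain ⟨n, hn⟩ := hyi
        exact Or.inl (mem_iUnion.2 ⟨n, y, hyj, hyK, hn⟩)
    obtain ⟨n, hn⟩ := hn
    obtain ⟨F', hF', hs⟩ :=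
      exists_isUncountablySplit_subset (hKF.inter_right (hU n).isClosed_compl) hn
    refine ⟨F', fun y hy => ⟨hKV (hF' hy).1.1, (hF' hy).1.2⟩, hs, fun j hj => ?_⟩
    obtain rfl : j = i := by
      by_contra hji
      exact not_disjoint_of_isGδ_of_dense_traces hF.isCompact hF.nonempty (hgδ j) (hgδ i) hj hi
        (hdisj hji)
    refine disjoint_left.2 fun y hy hyj => (hF' hy).2 ?_
    rw [hPU] at hyj
    exact mem_iInter.1 hyj n
  · obtain ⟨F', hF', hs⟩ := exists_isUncountablySplit_subset hKF hunc
    exact ⟨F', fun y hy => ⟨hKV (hF' hy).1, (hF' hy).2⟩, hs, fun i hi => (hex ⟨i, hi⟩).elim⟩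

end Traces

section DyadicScheme

variable {σ : Type*}

/-- The state attached to the dyadic interval `[m / 2 ^ j, (m + 1) / 2 ^ j)`: passing to the left
half increments a counter, passing to the right half applies `next` to the counter and resets
it. -/
def dyadicState (next : σ → ℕ → σ) (s : σ) : ℕ → ℤ → σ × ℕ
  | 0, _ => (s, 0)
  | j + 1, m =>
    let q := dyadicState next s j (m / 2)
    if Even m then (q.1, q.2 + 1) else (next q.1 q.2, 0)

lemma dyadicState_even (next : σ → ℕ → σ) (s : σ) (j : ℕ) (m : ℤ) :
    dyadicState next s (j + 1) (2 * m) =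
      ((dyadicState next s j m).1, (dyadicState next s j m).2 + 1) := by
  simp [dyadicState]

lemma dyadicState_odd (next : σ → ℕ → σ) (s : σ) (j : ℕ) (m : ℤ) :
    dyadicState next s (j + 1) (2 * m + 1) =
      (next (dyadicState next s j m).1 (dyadicState next s j m).2, 0) := by
  have h : (2 * m + 1) / 2 = m := by omega
  simp [dyadicState, h]

lemma dyadicState_mul_two_pow (next : σ → ℕ → σ) (s : σ) (j : ℕ) (m : ℤ) (n : ℕ) :
    dyadicState next s (j + n) (2 ^ n * m) =
      ((dyadicState next s j m).1, (dyadicState next s j m).2 + n) := by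
  induction n with
  | zero => simp
  | succ n ih => rw [← add_assoc, pow_succ', mul_assoc, dyadicState_even, ih, add_assoc]

/-- The dyadic interval of level `j` and index `m`. -/
def dyadicIco (j : ℕ) (m : ℤ) : Set ℝ := {x | ⌊2 ^ j * x⌋ = m}

lemma floor_two_pow_succ_mul_div_two (j : ℕ) (x : ℝ) :
    ⌊2 ^ (j + 1) * x⌋ / 2 = ⌊2 ^ j * x⌋ := by
  have h := Int.floor_div_natCast ((2 : ℝ) ^ (j + 1) * x) 2
  rw [← Nat.cast_ofNat (R := ℤ), ← h]
  congr 1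
  push_cast
  ring

lemma dyadicIco_succ_subset (j : ℕ) (m : ℤ) : dyadicIco (j + 1) m ⊆ dyadicIco j (m / 2) := by
  rintro x rfl
  exact (floor_two_pow_succ_mul_div_two j x).symm

lemma dyadicIco_mul_two_pow_subset (j : ℕ) (m : ℤ) (n : ℕ) :
    dyadicIco (j + n) (2 ^ n * m) ⊆ dyadicIco j m := by
  induction n with
  | zero => simp
  | succ n ih =>
    refine (dyadicIco_succ_subset (j + n) _).trans ?_
    rwa [pow_succ', mul_assoc, Int.mul_ediv_cancel_left _ two_ne_zero]

lemma dyadicIco_odd_subset (j : ℕ) (m : ℤ) : dyadicIco (j + 1) (2 * m + 1) ⊆ dyadicIco j m := by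
  have h : (2 * m + 1) / 2 = m := by omega
  simpa [h] using dyadicIco_succ_subset j (2 * m + 1)

lemma interior_dyadicIco_nonempty (j : ℕ) (m : ℤ) : (interior (dyadicIco j m)).Nonempty := by
  have hp : (0 : ℝ) < 2 ^ j := by positivity
  have hopen : IsOpen ((fun x : ℝ => 2 ^ j * x) ⁻¹' Ioo (m : ℝ) (m + 1)) :=
    isOpen_Ioo.preimage (by fun_prop)
  refine ⟨(m + 1 / 2) / 2 ^ j, interior_maximal (fun x hx => ?_) hopen ?_⟩
  · exact Int.floor_eq_iff.2 ⟨hx.1.le, hx.2⟩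
  · rw [mem_preimage, mul_div_cancel₀ _ hp.ne']
    constructor <;> linarith

lemma exists_dyadicIco_subset {U : Set ℝ} (hU : IsOpen U) (hne : U.Nonempty) :
    ∃ j m, dyadicIco j m ⊆ U := by
  obtain ⟨x, hx⟩ := hne
  obtain ⟨ε, hε, hball⟩ := Metric.isOpen_iff.1 hU x hx
  obtain ⟨j, hj⟩ := exists_pow_lt_of_lt_one hε (by norm_num : (1 / 2 : ℝ) < 1)
  refine ⟨j, ⌊2 ^ j * x⌋, fun y hy => hball ?_⟩
  have hp : (0 : ℝ) < 2 ^ j := by positivity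
  have h := Int.abs_sub_lt_one_of_floor_eq_floor (show ⌊2 ^ j * y⌋ = ⌊2 ^ j * x⌋ from hy)
  rw [← mul_sub, abs_mul, abs_of_pos hp] at h
  rw [Metric.mem_ball, Real.dist_eq]
  refine lt_trans ?_ hj
  rw [one_div, inv_pow, ← one_div, lt_div_iff₀ hp]
  linarith

end DyadicScheme

/-- If uncountably many members of a disjoint family of `G_δ` sets are nonempty, then there is a
selector from the real line all of whose fibres over the family are nowhere dense. -/
lemma exists_forall_isNowhereDense_preimage {X ι : Type*} [TopologicalSpace X]
    [SecondCountableTopology X] [T2Space X] [LocallyCompactSpace X] {P : ι → Set X}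
    (hgδ : ∀ i, IsGδ (P i)) (hdisj : Pairwise (Function.onFun Disjoint P))
    (hunc : ¬ (meetingIndices P univ).Countable) :
    ∃ f : ℝ → X, ∀ i, IsNowhereDense (f ⁻¹' P i) := by
  obtain ⟨F₀, hF₀⟩ : ∃ F, IsUncountablySplit P F := by
    have hn : ∃ n, ¬ (meetingIndices P (compactCovering X n)).Countable := by
      by_contra! h
      rw [← iUnion_compactCovering, meetingIndices_iUnion] at hunc
      exact hunc (countable_iUnion h)
    obtain ⟨n, hn⟩ := hn
    obtain ⟨F, -, hF⟩ := exists_isUncountablySplit_subset (isCompact_compactCovering X n) hn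
    exact ⟨F, hF⟩
  obtain ⟨x₀, -⟩ := hF₀.nonempty
  obtain ⟨W₀, hW₀, -⟩ := (TopologicalSpace.isBasis_countableBasis X).exists_subset_of_mem_open
    (mem_univ x₀) isOpen_univ
  obtain ⟨V, hV⟩ := (TopologicalSpace.countable_countableBasis X).exists_eq_range
    ⟨W₀, hW₀⟩
  have hVb : TopologicalSpace.IsTopologicalBasis (range V) :=
    hV ▸ TopologicalSpace.isBasis_countableBasis X
  have hstep : ∀ (F : {F // IsUncountablySplit P F}) (n : ℕ),
      ∃ F' : {F // IsUncountablySplit P F}, F'.1 ⊆ F.1 ∧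
        ((V n ∩ F.1).Nonempty → F'.1 ⊆ V n) ∧
        ∀ i, F.1 ⊆ closure (P i ∩ F.1) → Disjoint F'.1 (P i) := by
    rintro ⟨F, hF⟩ n
    by_cases hn : (V n ∩ F).Nonempty
    · obtain ⟨F', hsub, hs, hd⟩ :=
        hF.exists_subset_disjoint hgδ hdisj (hVb.isOpen (mem_range_self n)) hn
      exact ⟨⟨F', hs⟩, fun x hx => (hsub hx).2, fun _ x hx => (hsub hx).1, hd⟩
    · obtain ⟨F', hsub, hs, hd⟩ :=
        hF.exists_subset_disjoint hgδ hdisj isOpen_univ (by simpa using hF.nonempty)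
      exact ⟨⟨F', hs⟩, fun x hx => (hsub hx).2, fun h => (hn h).elim, hd⟩
  choose next hnext_sub hnext_V hnext_disj using hstep
  let S := dyadicState next ⟨F₀, hF₀⟩
  have hmono : ∀ j m, (S (j + 1) m).1.1 ⊆ (S j (m / 2)).1.1 := by
    intro j m
    rcases Int.even_or_odd' m with ⟨k, rfl | rfl⟩
    · simp [S, dyadicState_even]
    · have h : (2 * k + 1) / 2 = k := by omega
      simpa only [S, dyadicState_odd, h] using hnext_sub _ _
  have hpoint : ∀ b : ℝ, (⋂ j, (S j ⌊2 ^ j * b⌋).1.1).Nonempty := by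
    intro b
    refine IsCompact.nonempty_iInter_of_sequence_nonempty_isCompact_isClosed _ (fun j => ?_)
      (fun j => (S j _).1.2.nonempty) (S 0 _).1.2.isCompact
      (fun j => (S j _).1.2.isCompact.isClosed)
    rw [← floor_two_pow_succ_mul_div_two j b]
    exact hmono j _
  choose f hf using hpoint
  have hf_mem : ∀ {j m b}, b ∈ dyadicIco j m → f b ∈ (S j m).1.1 := by
    rintro j m b rfl
    exact mem_iInter.1 (hf b) j
  refine ⟨f, fun i => ?_⟩
  by_contra hdense
  obtain ⟨j, m, hjm⟩ := exists_dyadicIco_subset isOpen_interior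
    (nonempty_iff_ne_empty.2 hdense)
  have hmeet : ∀ k l, dyadicIco k l ⊆ dyadicIco j m → ∃ b ∈ dyadicIco k l, f b ∈ P i := by
    intro k l hkl
    obtain ⟨x, hx⟩ := interior_dyadicIco_nonempty k l
    obtain ⟨b, hb, hbP⟩ := mem_closure_iff.1 (interior_subset (hjm (hkl (interior_subset hx))))
      _ isOpen_interior hx
    exact ⟨b, interior_subset hb, hbP⟩
  have hodd : S (j + 1) (2 * m + 1) = (next (S j m).1 (S j m).2, 0) := dyadicState_odd ..
  set F := (S (j + 1) (2 * m + 1)).1 with hFdef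
  have hchild : ∀ n, ∃ x ∈ (next F n).1, x ∈ P i := by
    intro n
    obtain ⟨b, hb, hbP⟩ := hmeet (j + 1 + n + 1) (2 * (2 ^ n * (2 * m + 1)) + 1)
      ((dyadicIco_odd_subset _ _).trans
        ((dyadicIco_mul_two_pow_subset _ _ _).trans (dyadicIco_odd_subset _ _)))
    refine ⟨f b, ?_, hbP⟩
    have h := hf_mem hb
    simp only [S, dyadicState_odd, dyadicState_mul_two_pow] at h
    simpa [hFdef, S, dyadicState_odd] using h
  have hFP : F.1 ⊆ closure (P i ∩ F.1) := by
    intro x hx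
    rw [hVb.mem_closure_iff]
    rintro _ ⟨n, rfl⟩ hxn
    obtain ⟨y, hy, hyP⟩ := hchild n
    exact ⟨y, hnext_V F n ⟨x, hxn, hx⟩ hy, hyP, hnext_sub F n hy⟩
  obtain ⟨x, hx, hxP⟩ := hchild 0
  exact disjoint_left.1 (hnext_disj F 0 i hFP) hx hxP


/-- Fremlin–Shelah: if the real line can be partitioned into uncountably many
nonempty `G_δ` sets, then it can be covered by that many nowhere dense closed
sets. -/
theorem stmt_18 (ι : Type) (hι : ¬ Countable ι) (P : ι → Set ℝ)
    (hne : ∀ i, (P i).Nonempty) (hgδ : ∀ i, IsGδ (P i))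
    (hdisj : Pairwise (Function.onFun Disjoint P))
    (hcover : ⋃ i, P i = Set.univ) :
    ∃ C : ι → Set ℝ, (∀ i, IsClosed (C i) ∧ IsNowhereDense (C i)) ∧
      ⋃ i, C i = Set.univ := by
  have hmeet : meetingIndices P univ = univ :=
    eq_univ_of_forall fun i => by simpa [meetingIndices] using hne i
  obtain ⟨f, hf⟩ := exists_forall_isNowhereDense_preimage hgδ hdisj
    (by rwa [hmeet, countable_univ_iff])
  refine ⟨fun i => closure (f ⁻¹' P i), fun i => ⟨isClosed_closure, (hf i).closure⟩, ?_⟩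
  refine eq_univ_of_forall fun b => ?_
  obtain ⟨i, hi⟩ := mem_iUnion.1 (hcover ▸ mem_univ (f b))
  exact mem_iUnion.2 ⟨i, subset_closure hi⟩
end
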